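/- There is an absolute constant C such that the following holds for all n and m. Let Q_1, …, Q_m be pairwise linearly independent homogeneous quadratic polynomials in ℂ[x_1, …, x_n], each of which is either irreducible or the square of a linear form. Assume that for every pair of indices i ≠ j there exists an index k ∉ {i, j} such that Q_k vanishes at every point a ∈ ℂⁿ with Q_i(a) = Q_j(a) = 0. Then the ℂ-linear span of {Q_1, …, Q_m} inside ℂ[x_1, …, x_n] has dimension at most C. -/

import Mathlib

open MvPolynomial

namespace QuadSG

open Finset in
theorem exists_scaling {ι ρ : Type*} [Fintype ι] [DecidableEq ι] (R : Finset ρ)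
    (c : ρ → ι → ℝ) (ω : ρ → ℝ) (o : ρ → ι) (hc : ∀ r a, 0 ≤ c r a)
    (hco : ∀ r ∈ R, 0 < c r (o r)) (hω : ∀ r ∈ R, 0 ≤ ω r)
    (hsum : ∀ i, ∑ r ∈ R with o r = i, ω r = 1) {η : ℝ} (hη : 0 < η) :
    ∃ w : ι → ℝ, (∀ i, 0 < w i) ∧
      ∀ i, ∑ r ∈ R, ω r * (c r i * w i / ∑ a, c r a * w a) ≤ 1 + η := by
  classical
  set s : (ι → ℝ) → ρ → ℝ := fun w r => ∑ a, c r a * w a with hs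
  have s_ge : ∀ w : ι → ℝ, (∀ i, 0 < w i) → ∀ r i, c r i * w i ≤ s w r := fun w hw r i =>
    Finset.single_le_sum (f := fun a => c r a * w a)
      (fun a _ => mul_nonneg (hc r a) (hw a).le) (Finset.mem_univ i)
  have s_pos : ∀ w : ι → ℝ, (∀ i, 0 < w i) → ∀ r ∈ R, 0 < s w r := fun w hw r hr =>
    lt_of_lt_of_le (mul_pos (hco r hr) (hw _)) (s_ge w hw r (o r))
  set F : (ι → ℝ) → ℝ := fun w => ∑ r ∈ R, ω r * (Real.log (s w r) - Real.log (w (o r))) with hF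
  set W : Set (ι → ℝ) := {w | ∀ i, 0 < w i} with hW
  have hbdd : BddBelow (F '' W) := by
    refine ⟨∑ r ∈ R, ω r * Real.log (c r (o r)), ?_⟩
    rintro _ ⟨w, hw, rfl⟩
    refine Finset.sum_le_sum fun r hr => mul_le_mul_of_nonneg_left ?_ (hω r hr)
    have := Real.log_le_log (mul_pos (hco r hr) (hw (o r))) (s_ge w hw r (o r))
    rw [Real.log_mul (hco r hr).ne' (hw _).ne'] at this
    linarith
  have hne : (F '' W).Nonempty := ⟨_, fun _ => 1, fun _ => one_pos, rfl⟩
  have hδ : 0 < η - Real.log (1 + η) := by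
    have := Real.log_lt_sub_one_of_pos (x := 1 + η) (by linarith) (by linarith)
    linarith
  obtain ⟨_, ⟨w, hw, rfl⟩, hlt⟩ := exists_lt_of_csInf_lt hne
    (show sInf (F '' W) < sInf (F '' W) + (η - Real.log (1 + η)) by linarith)
  refine ⟨w, hw, fun i => ?_⟩
  by_contra! hcon
  set w' : ι → ℝ := Function.update w i (w i / (1 + η)) with hw'def
  have h1η : (0:ℝ) < 1 + η := by linarith
  have hw' : w' ∈ W := by
    intro a
    by_cases h : a = i
    · subst h; simp only [hw'def, Function.update_self]; exact div_pos (hw a) h1η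
    · simp only [hw'def, Function.update_of_ne h]; exact hw a
  have hs' : ∀ r, s w' r = s w r - c r i * w i * (η / (1 + η)) := by
    intro r
    simp only [hs]
    rw [← Finset.add_sum_erase _ _ (Finset.mem_univ i),
      ← Finset.add_sum_erase (a := i) (f := fun a => c r a * w a) _ (Finset.mem_univ i)]
    have : ∑ a ∈ univ.erase i, c r a * w' a = ∑ a ∈ univ.erase i, c r a * w a := by
      refine Finset.sum_congr rfl fun a ha => ?_
      simp only [hw'def, Function.update_of_ne (Finset.ne_of_mem_erase ha)]
    rw [this]
    simp only [hw'def, Function.update_self]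
    field_simp
    ring
  have key : F w' ≤ F w - (∑ r ∈ R, ω r * (c r i * w i / s w r)) * (η / (1 + η))
      + ∑ r ∈ R, (if o r = i then ω r else 0) * Real.log (1 + η) := by
    simp only [hF]
    rw [Finset.sum_mul, ← Finset.sum_sub_distrib, ← Finset.sum_add_distrib]
    refine Finset.sum_le_sum fun r hr => ?_
    have hsr := s_pos w hw r hr
    have hsr' := s_pos w' hw' r hr
    have e1 : Real.log (s w' r) ≤ Real.log (s w r) - c r i * w i / s w r * (η / (1 + η)) := by
      have e2 : s w' r = s w r * (s w' r / s w r) := by field_simp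
      rw [e2, Real.log_mul hsr.ne' (div_pos hsr' hsr).ne']
      have e3 := Real.log_le_sub_one_of_pos (div_pos hsr' hsr)
      have e4 : s w' r / s w r - 1 = - (c r i * w i / s w r * (η / (1 + η))) := by
        rw [hs']; field_simp; ring
      linarith
    have e5 : Real.log (w' (o r)) = Real.log (w (o r)) -
        if o r = i then Real.log (1 + η) else 0 := by
      split_ifs with h
      · rw [h]; simp only [hw'def, Function.update_self]
        rw [Real.log_div (hw i).ne' h1η.ne']
      · simp only [hw'def, Function.update_of_ne h, sub_zero]
    rw [e5]
    have := mul_le_mul_of_nonneg_left e1 (hω r hr)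
    split_ifs <;> nlinarith
  rw [← Finset.sum_mul, ← Finset.sum_filter, hsum i, one_mul] at key
  have h2 : η < (∑ r ∈ R, ω r * (c r i * w i / s w r)) * (η / (1 + η)) := by
    have : η = (1 + η) * (η / (1 + η)) := by field_simp
    nlinarith [div_pos hη h1η]
  have h3 : sInf (F '' W) ≤ F w' := csInf_le hbdd ⟨w', hw', rfl⟩
  linarith

theorem finrank_le_sum_sq {ι : Type*} [Fintype ι] (M : ι → ι → ℂ)
    (K : Submodule ℂ (EuclideanSpace ℂ ι))
    (hK : ∀ u ∈ K, ∀ a, ∑ b, M a b * u b = - u a) :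
    (Module.finrank ℂ K : ℝ) ≤ ∑ a, ∑ b, ‖M a b‖ ^ 2 := by
  set u := stdOrthonormalBasis ℂ K
  have hu : Orthonormal ℂ (fun s => (u s : EuclideanSpace ℂ ι)) :=
    u.orthonormal.comp_linearIsometry K.subtypeₗᵢ
  have h1 : (Module.finrank ℂ K : ℝ) = ∑ s, ‖(u s : EuclideanSpace ℂ ι)‖ ^ 2 := by
    rw [Finset.sum_congr rfl fun s _ => by rw [hu.1 s]]
    simp
  rw [h1]
  have h2 : ∀ s, ‖(u s : EuclideanSpace ℂ ι)‖ ^ 2 =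
      ∑ a, ‖inner ℂ (u s : EuclideanSpace ℂ ι)
        (WithLp.toLp 2 fun b => star (M a b) : EuclideanSpace ℂ ι)‖ ^ 2 := by
    intro s
    rw [EuclideanSpace.norm_sq_eq]
    refine Finset.sum_congr rfl fun a _ => ?_
    rw [← norm_neg, ← hK _ (u s).2 a, ← norm_star]
    congr 2
    rw [PiLp.inner_apply]
    simp
  rw [Finset.sum_congr rfl fun s _ => h2 s, Finset.sum_comm]
  refine Finset.sum_le_sum fun a _ => ?_
  refine (hu.sum_inner_products_le _).trans ?_
  rw [EuclideanSpace.norm_sq_eq]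
  simp

open Finset in
theorem finrank_span_le_of_design {ι ρ E : Type*} [Fintype ι] [DecidableEq ι]
    [AddCommGroup E] [Module ℂ E] (v : ι → E) (R : Finset ρ) (A : ρ → ι → ℂ)
    (ω : ρ → ℝ) (o : ρ → ι) (hA : ∀ r ∈ R, A r (o r) ≠ 0)
    (hrel : ∀ r ∈ R, ∑ a, A r a • v a = 0) (hω : ∀ r ∈ R, 0 ≤ ω r)
    (hsum : ∀ i, ∑ r ∈ R with o r = i, ω r = 1) {τ : ℝ} (hτ0 : 0 ≤ τ)
    (hτ : ∀ a b, a ≠ b → ∑ r ∈ R with A r a ≠ 0 ∧ A r b ≠ 0, ω r ≤ τ) :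
    (Module.finrank ℂ (Submodule.span ℂ (Set.range v)) : ℝ) ≤ 1 + τ * Fintype.card ι := by
  classical
  set N : ℝ := ((Fintype.card ι : ℕ) : ℝ) with hN
  rcases isEmpty_or_nonempty ι with hι | hι
  · rw [Set.range_eq_empty v, Submodule.span_empty, finrank_bot]; simp [hN]
  have hN1 : 1 ≤ N := by
    rw [hN]; exact_mod_cast Fintype.card_pos
  obtain ⟨w, hw, hcol⟩ := exists_scaling R (fun r a => ‖A r a‖ ^ 2) ω o (fun _ _ => by positivity)
    (fun r hr => by have := hA r hr; positivity) hω hsum (η := 1 / N ^ 2) (by positivity)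
  set s : ρ → ℝ := fun r => ∑ a, ‖A r a‖ ^ 2 * w a with hs
  have s_pos : ∀ r ∈ R, 0 < s r := fun r hr => by
    refine lt_of_lt_of_le (mul_pos (pow_pos (norm_pos_iff.2 (hA r hr)) 2) (hw (o r)))
      (Finset.single_le_sum (f := fun a => ‖A r a‖ ^ 2 * w a)
      (fun a _ => mul_nonneg (by positivity) (hw a).le) (Finset.mem_univ (o r)))
  set B : ρ → ι → ℂ := fun r a => A r a * (√(w a) : ℝ) / (√(s r) : ℝ) with hB
  have hBn : ∀ r ∈ R, ∀ a, ‖B r a‖ ^ 2 = ‖A r a‖ ^ 2 * w a / s r := fun r hr a => by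
    simp only [hB, norm_div, norm_mul, Complex.norm_real, div_pow, mul_pow,
      Real.norm_eq_abs, sq_abs,
      Real.sq_sqrt (hw a).le, Real.sq_sqrt (s_pos r hr).le]
  have hBsum : ∀ r ∈ R, ∑ a, ‖B r a‖ ^ 2 = 1 := fun r hr => by
    rw [Finset.sum_congr rfl fun a _ => hBn r hr a, ← Finset.sum_div]
    exact div_self (s_pos r hr).ne'
  have hωsum : ∑ r ∈ R, ω r = N := by
    rw [← Finset.sum_fiberwise R o ω, Finset.sum_congr rfl fun i _ => hsum i]
    simp [hN]
  set S : ι → ℝ := fun a => ∑ r ∈ R, ω r * ‖B r a‖ ^ 2 with hS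
  have hSle : ∀ a, S a ≤ 1 + 1 / N ^ 2 := fun a => by
    refine le_trans (le_of_eq ?_) (hcol a)
    exact Finset.sum_congr rfl fun r hr => by rw [hBn r hr a]
  have hSsum : ∑ a, S a = N := by
    simp only [hS]
    rw [Finset.sum_comm, ← hωsum]
    refine Finset.sum_congr rfl fun r hr => ?_
    rw [← Finset.mul_sum, hBsum r hr, mul_one]
  have hSge : ∀ a, 1 - 1 / N ≤ S a := fun a => by
    have h1 : ∑ b ∈ univ.erase a, S b ≤ ∑ b ∈ univ.erase a, (1 + 1 / N ^ 2) :=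
      Finset.sum_le_sum fun b _ => hSle b
    have h2 := Finset.add_sum_erase univ S (Finset.mem_univ a)
    have h3 : ∑ b ∈ univ.erase a, (1 + 1 / N ^ 2) = (N - 1) * (1 + 1 / N ^ 2) := by
      rw [Finset.sum_const, Finset.card_erase_of_mem (Finset.mem_univ a), nsmul_eq_mul,
        Finset.card_univ, Nat.cast_sub Fintype.card_pos]
      simp [hN]
    have h4 : N * (1 / N ^ 2) = 1 / N := by field_simp
    have h5 : 0 < 1 / N ^ 2 := by positivity
    nlinarith
  set M : ι → ι → ℂ := fun a b => ∑ r ∈ R, (ω r : ℂ) * (star (B r a) * B r b) -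
    if a = b then 1 else 0 with hM
  set K : Submodule ℂ (EuclideanSpace ℂ ι) :=
    { carrier := {u | ∀ r ∈ R, ∑ a, B r a * u a = 0}
      add_mem' := fun {x y} hx hy r hr => by
        simp [mul_add, Finset.sum_add_distrib, hx r hr, hy r hr]
      zero_mem' := fun r _ => by simp
      smul_mem' := fun c x hx r hr => by
        have := hx r hr
        simp only [PiLp.smul_apply, smul_eq_mul, mul_left_comm _ c]
        rw [← Finset.mul_sum, this, mul_zero] } with hK
  have hKM : ∀ u ∈ K, ∀ a, ∑ b, M a b * u b = - u a := by
    intro u hu a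
    have hu' : ∀ r ∈ R, ∑ a, B r a * u a = 0 := hu
    simp only [hM, sub_mul, Finset.sum_sub_distrib, Finset.sum_mul]
    rw [Finset.sum_comm]
    have : ∑ r ∈ R, ∑ b, (ω r : ℂ) * (star (B r a) * B r b) * u b = 0 := by
      refine Finset.sum_eq_zero fun r hr => ?_
      have h := hu' r hr
      calc _ = (ω r : ℂ) * star (B r a) * ∑ b, B r b * u b := by
            rw [Finset.mul_sum]; exact Finset.sum_congr rfl fun b _ => by ring
        _ = 0 := by rw [h, mul_zero]
    rw [this]
    simp
  have hdim := finrank_le_sum_sq M K hKM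
  have hle : (Module.finrank ℂ (Submodule.span ℂ (Set.range v)) : ℝ) ≤ Module.finrank ℂ K := by
    have hfin : FiniteDimensional ℂ (Submodule.span ℂ (Set.range v)) :=
      FiniteDimensional.span_of_finite ℂ (Set.finite_range v)
    set v' : ι → Submodule.span ℂ (Set.range v) :=
      fun a => ⟨v a, Submodule.subset_span ⟨a, rfl⟩⟩ with hv'
    have hwc : ∀ a, ((√(w a) : ℝ) : ℂ) ≠ 0 := fun a => by
      exact_mod_cast (Real.sqrt_pos.2 (hw a)).ne'
    let T : Module.Dual ℂ (Submodule.span ℂ (Set.range v)) →ₗ[ℂ] K :=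
      { toFun := fun φ => ⟨WithLp.toLp 2 fun a => φ (v' a) / (√(w a) : ℝ), fun r hr => by
          have h1 : ∑ a, A r a • v' a = 0 := by
            apply Subtype.ext
            simpa [hv'] using hrel r hr
          have h2 := congrArg φ h1
          simp only [map_sum, map_smul, smul_eq_mul, map_zero] at h2
          calc _ = (∑ a, A r a * φ (v' a)) / (√(s r) : ℝ) := by
                rw [Finset.sum_div]
                refine Finset.sum_congr rfl fun a _ => ?_
                simp only [hB]
                have := hwc a
                field_simp
            _ = 0 := by rw [h2, zero_div]⟩
        map_add' := fun φ ψ => by ext a; simp [add_div]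
        map_smul' := fun c φ => by ext a; simp [mul_div_assoc] }
    have hT : Function.Injective T := by
      rw [← LinearMap.ker_eq_bot, LinearMap.ker_eq_bot']
      intro φ hφ
      have h0 : ∀ a, φ (v' a) = 0 := fun a => by
        have := congrArg (fun u : K => (u : EuclideanSpace ℂ ι) a) hφ
        simpa [T, hwc a, (hw a).le, (Real.sqrt_pos.2 (hw a)).ne'] using this
      apply LinearMap.ext_on_range (v := v')
      · rw [eq_top_iff]
        rintro ⟨x, hx⟩ -
        have : Submodule.span ℂ (Set.range v) =
            (Submodule.span ℂ (Set.range v')).map (Submodule.subtype _) := by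
          rw [Submodule.map_span, ← Set.range_comp]; rfl
        have hx2 := hx
        rw [this] at hx2
        obtain ⟨y, hy, hyx⟩ := hx2
        have : y = ⟨x, hx⟩ := Subtype.ext hyx
        rwa [← this]
      · intro a; simp [h0 a]
    have := LinearMap.finrank_le_finrank_of_injective hT
    rw [Subspace.dual_finrank_eq] at this
    exact_mod_cast this
  refine hle.trans (hdim.trans ?_)
  have hdiag : ∀ a, ‖M a a‖ ^ 2 ≤ 1 / N := fun a => by
    have h1 : M a a = ((S a - 1 : ℝ) : ℂ) := by
      simp only [hM, hS, if_true]
      push_cast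
      congr 1
      refine Finset.sum_congr rfl fun r _ => ?_
      congr 1
      have := Complex.conj_mul' (B r a)
      simpa using this
    rw [h1, Complex.norm_real, Real.norm_eq_abs, sq_abs]
    have h2 := hSle a
    have h3 := hSge a
    have h4 : 1 / N ^ 2 ≤ 1 / N := by
      apply one_div_le_one_div_of_le (by positivity); nlinarith
    have h5 : 1 / N ≤ 1 := by rw [div_le_one (by positivity)]; exact hN1
    have h6 : 0 < 1 / N := by positivity
    nlinarith
  have hoff : ∀ a b, a ≠ b → ‖M a b‖ ^ 2 ≤ τ * ∑ r ∈ R, ω r * (‖B r a‖ ^ 2 * ‖B r b‖ ^ 2) := by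
    intro a b hab
    set R' := R.filter fun r => A r a ≠ 0 ∧ A r b ≠ 0 with hR'
    have hR'sub : R' ⊆ R := Finset.filter_subset _ _
    have h1 : ‖M a b‖ ≤ ∑ r ∈ R', ω r * (‖B r a‖ * ‖B r b‖) := by
      simp only [hM, if_neg hab, sub_zero]
      rw [← Finset.sum_filter_of_ne (p := fun r => A r a ≠ 0 ∧ A r b ≠ 0)]
      · refine (norm_sum_le _ _).trans (Finset.sum_le_sum fun r hr => ?_)
        rw [norm_mul, norm_mul, norm_star, Complex.norm_real, Real.norm_eq_abs,
          abs_of_nonneg (hω r (hR'sub hr))]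
      · intro r _ h
        constructor <;> intro h0 <;> apply h <;> simp [hB, h0]
    have h2 : (∑ r ∈ R', ω r * (‖B r a‖ * ‖B r b‖)) ^ 2 ≤
        (∑ r ∈ R', ω r) * ∑ r ∈ R', ω r * (‖B r a‖ ^ 2 * ‖B r b‖ ^ 2) := by
      apply Finset.sum_sq_le_sum_mul_sum_of_sq_le_mul
      · intro r hr; exact hω r (hR'sub hr)
      · intro r hr; exact mul_nonneg (hω r (hR'sub hr)) (by positivity)
      · intro r _; exact le_of_eq (by ring)
    have h3 : ∑ r ∈ R', ω r * (‖B r a‖ ^ 2 * ‖B r b‖ ^ 2) ≤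
        ∑ r ∈ R, ω r * (‖B r a‖ ^ 2 * ‖B r b‖ ^ 2) :=
      Finset.sum_le_sum_of_subset_of_nonneg hR'sub fun r hr _ =>
        mul_nonneg (hω r hr) (by positivity)
    have h4 : 0 ≤ ∑ r ∈ R', ω r := Finset.sum_nonneg fun r hr => hω r (hR'sub hr)
    have h5 : 0 ≤ ∑ r ∈ R', ω r * (‖B r a‖ ^ 2 * ‖B r b‖ ^ 2) :=
      Finset.sum_nonneg fun r hr => mul_nonneg (hω r (hR'sub hr)) (by positivity)
    calc ‖M a b‖ ^ 2 ≤ (∑ r ∈ R', ω r * (‖B r a‖ * ‖B r b‖)) ^ 2 := by gcongr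
      _ ≤ _ := h2
      _ ≤ τ * ∑ r ∈ R', ω r * (‖B r a‖ ^ 2 * ‖B r b‖ ^ 2) :=
          mul_le_mul_of_nonneg_right (hτ a b hab) h5
      _ ≤ _ := mul_le_mul_of_nonneg_left h3 (h4.trans (hτ a b hab))
  have h1 : ∀ a b, ‖M a b‖ ^ 2 ≤ (if a = b then 1 / N else 0) +
      τ * ∑ r ∈ R, ω r * (‖B r a‖ ^ 2 * ‖B r b‖ ^ 2) := by
    intro a b
    split_ifs with h
    · subst h
      have : 0 ≤ τ * ∑ r ∈ R, ω r * (‖B r a‖ ^ 2 * ‖B r a‖ ^ 2) :=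
        mul_nonneg hτ0 (Finset.sum_nonneg fun r hr => mul_nonneg (hω r hr) (by positivity))
      linarith [hdiag a]
    · simpa using hoff a b h
  calc _ ≤ ∑ a, ∑ b, ((if a = b then 1 / N else 0) +
      τ * ∑ r ∈ R, ω r * (‖B r a‖ ^ 2 * ‖B r b‖ ^ 2)) :=
        Finset.sum_le_sum fun a _ => Finset.sum_le_sum fun b _ => h1 a b
    _ = 1 + τ * ∑ r ∈ R, ω r := by
        simp only [Finset.sum_add_distrib, ← Finset.mul_sum]
        congr 1
        · simp [← hN]
        · congr 1
          rw [Finset.sum_congr rfl fun a _ => Finset.sum_comm, Finset.sum_comm]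
          refine Finset.sum_congr rfl fun r hr => ?_
          simp only [← Finset.mul_sum]
          rw [← Finset.sum_mul, hBsum r hr]; simp
    _ = 1 + τ * N := by rw [hωsum]

theorem smul_ne_of_linearIndependent_pair {E : Type*} [AddCommGroup E] [Module ℂ E] {x y : E}
    (h : LinearIndependent ℂ ![x, y]) (c : ℂ) : c • y ≠ x := by
  intro hc
  have := LinearIndependent.pair_iff.1 h 1 (-c) (by rw [← hc]; simp)
  exact one_ne_zero this.1

theorem span_pair_eq_of_mem {ι E : Type*} [AddCommGroup E] [Module ℂ E] {v : ι → E}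
    (hv : ∀ i j, i ≠ j → LinearIndependent ℂ ![v i, v j]) {i j a b : ι} (hab : a ≠ b)
    (ha : v a ∈ Submodule.span ℂ {v i, v j}) (hb : v b ∈ Submodule.span ℂ {v i, v j}) :
    Submodule.span ℂ {v a, v b} = Submodule.span ℂ {v i, v j} := by
  have : FiniteDimensional ℂ (Submodule.span ℂ {v i, v j}) :=
    FiniteDimensional.span_of_finite ℂ (Set.toFinite _)
  apply Submodule.eq_of_le_of_finrank_le
  · rw [Submodule.span_le]
    rintro x (rfl | rfl) <;> assumption
  · have h1 : Set.finrank ℂ _ = _ := finrank_span_eq_card (hv a b hab)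
    have h2 := finrank_range_le_card (R := ℂ) ![v i, v j]
    simp only [Matrix.range_cons, Matrix.range_empty, Set.union_empty, Fintype.card_fin,
      Set.singleton_union] at h1 h2
    exact h2.trans h1.ge

theorem card_triples_le {ι : Type*} [DecidableEq ι] (S : Finset (ι × ι × ι)) (T : Finset ι)
    {a b : ι} (hab : a ≠ b)
    (h : ∀ r ∈ S, r.1 ≠ r.2.1 ∧ r.1 ≠ r.2.2 ∧ r.2.1 ≠ r.2.2 ∧
      (a = r.1 ∨ a = r.2.1 ∨ a = r.2.2) ∧ (b = r.1 ∨ b = r.2.1 ∨ b = r.2.2) ∧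
      ∀ x, (x = r.1 ∨ x = r.2.1 ∨ x = r.2.2) → x ≠ a → x ≠ b → x ∈ T) :
    S.card ≤ 6 * T.card := by
  let f : Fin 6 → ι → ι × ι × ι := ![fun x => (a, b, x), fun x => (b, a, x), fun x => (a, x, b),
    fun x => (b, x, a), fun x => (x, a, b), fun x => (x, b, a)]
  have hsub : S ⊆ (Finset.univ : Finset (Fin 6)).biUnion fun n => T.image (f n) := by
    rintro ⟨i, j, k⟩ hr
    obtain ⟨h1, h2, h3, ha, hb, hx⟩ := h _ hr
    simp only at h1 h2 h3 ha hb hx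
    simp only [Finset.mem_biUnion, Finset.mem_univ, true_and, Finset.mem_image]
    rcases ha with rfl | rfl | rfl <;> rcases hb with rfl | rfl | rfl
    · exact absurd rfl hab
    · exact ⟨0, k, hx k (by simp) h2.symm h3.symm, rfl⟩
    · exact ⟨2, j, hx j (by simp) h1.symm h3, rfl⟩
    · exact ⟨1, k, hx k (by simp) h3.symm h2.symm, rfl⟩
    · exact absurd rfl hab
    · exact ⟨4, i, hx i (by simp) h1 h2, rfl⟩
    · exact ⟨3, j, hx j (by simp) h3 h1.symm, rfl⟩
    · exact ⟨5, i, hx i (by simp) h2 h1, rfl⟩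
    · exact absurd rfl hab
  refine (Finset.card_le_card hsub).trans (Finset.card_biUnion_le.trans ?_)
  refine (Finset.sum_le_card_nsmul _ _ T.card fun n _ => Finset.card_image_le).trans ?_
  simp

open Finset in
theorem robust_sylvester_gallai {ι E : Type*} [Fintype ι] [DecidableEq ι]
    [AddCommGroup E] [Module ℂ E] (v : ι → E)
    (hv : ∀ i j, i ≠ j → LinearIndependent ℂ ![v i, v j]) (κ : ℕ)
    (hκ : ∀ i, ∃ J : Finset ι, Fintype.card ι ≤ κ * #J ∧ ∀ j ∈ J, j ≠ i ∧
      ∃ k, k ≠ i ∧ k ≠ j ∧ v k ∈ Submodule.span ℂ {v i, v j}) :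
    Module.finrank ℂ (Submodule.span ℂ (Set.range v)) ≤ 6 * κ + 1 := by
  classical
  rcases isEmpty_or_nonempty ι with hι | hι
  · rw [Set.range_eq_empty v, Submodule.span_empty, finrank_bot]; omega
  set N : ℝ := ((Fintype.card ι : ℕ) : ℝ) with hN
  have hN0 : 0 < N := by rw [hN]; exact_mod_cast Fintype.card_pos
  choose J hJ using hκ
  let P : ι × ι × ι → Prop := fun r => r.2.1 ∈ J r.1 ∧ r.2.2 ≠ r.1 ∧ r.2.2 ≠ r.2.1 ∧
    v r.2.2 ∈ Submodule.span ℂ {v r.1, v r.2.1}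
  let T : ι → ι → Finset ι := fun i j =>
    univ.filter fun k => k ≠ i ∧ k ≠ j ∧ v k ∈ Submodule.span ℂ {v i, v j}
  have hTcard : ∀ i j, i ≠ j →
      #(T i j) + 2 = #{k | v k ∈ Submodule.span ℂ {v i, v j}} := by
    intro i j hij
    have : (univ.filter fun k => v k ∈ Submodule.span ℂ {v i, v j}) =
        insert i (insert j (T i j)) := by
      ext k
      simp only [mem_filter, mem_univ, true_and, mem_insert, T]
      constructor
      · intro h; tauto
      · rintro (rfl | rfl | h)
        · exact Submodule.subset_span (by simp)
        · exact Submodule.subset_span (by simp)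
        · exact h.2.2
    rw [this, card_insert_of_notMem, card_insert_of_notMem]
    · simp [T]
    · simp [T, hij]
  have hTeq : ∀ r, P r → ∀ a b, a ≠ b → (a = r.1 ∨ a = r.2.1 ∨ a = r.2.2) →
      (b = r.1 ∨ b = r.2.1 ∨ b = r.2.2) → #(T r.1 r.2.1) = #(T a b) := by
    rintro ⟨i, j, k⟩ ⟨h1, h2, h3, h4⟩ a b hab ha hb
    have hij := ((hJ i).2 j h1).1
    have hmem : ∀ x, (x = i ∨ x = j ∨ x = k) → v x ∈ Submodule.span ℂ {v i, v j} := by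
      rintro x (rfl | rfl | rfl)
      · exact Submodule.subset_span (by simp)
      · exact Submodule.subset_span (by simp)
      · exact h4
    have e := span_pair_eq_of_mem hv hab (hmem a ha) (hmem b hb)
    have e1 := hTcard i j hij.symm
    have e2 := hTcard a b hab
    rw [e] at e2
    simp only
    omega
  have hex : ∀ r : ι × ι × ι, ∃ f : ι → ℂ, P r → f r.1 ≠ 0 ∧ ∑ a, f a • v a = 0 ∧
      ∀ a, f a ≠ 0 → a = r.1 ∨ a = r.2.1 ∨ a = r.2.2 := by
    rintro ⟨i, j, k⟩
    by_cases hP : P (i, j, k)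
    · obtain ⟨h1, h2, h3, h4⟩ := hP
      have hij := ((hJ i).2 j h1).1
      simp only at h2 h3 h4 hij
      obtain ⟨α, β, hαβ⟩ := Submodule.mem_span_pair.1 h4
      refine ⟨Pi.single i α + Pi.single j β - Pi.single k 1, fun _ => ⟨?_, ?_, ?_⟩⟩
      · simp only [Pi.add_apply, Pi.sub_apply, Pi.single_eq_same, Pi.single_eq_of_ne hij.symm,
          Pi.single_eq_of_ne h2.symm]
        rintro h0
        have : α = 0 := by simpa using h0
        rw [this, zero_smul, zero_add] at hαβ
        exact smul_ne_of_linearIndependent_pair (hv k j h3) β hαβ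
      · simp only [Pi.add_apply, Pi.sub_apply, add_smul, sub_smul, Finset.sum_add_distrib,
          Finset.sum_sub_distrib, Pi.single_apply, ite_smul, zero_smul]
        simp [hαβ]
      · intro a ha
        by_contra! h
        apply ha
        simp [Pi.single_eq_of_ne h.1, Pi.single_eq_of_ne h.2.1, Pi.single_eq_of_ne h.2.2]
    · exact ⟨0, fun h => absurd h hP⟩
  choose A hA using hex
  set R : Finset (ι × ι × ι) := univ.filter P with hR
  set ω : ι × ι × ι → ℝ := fun r => 1 / ((#(T r.1 r.2.1) : ℝ) * #(J r.1)) with hω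
  have hJpos : ∀ i, 0 < #(J i) := fun i => by
    have h1 := (hJ i).1
    have h2 : 0 < Fintype.card ι := Fintype.card_pos
    exact Nat.pos_of_ne_zero fun h => by rw [h] at h1; omega
  have hJinv : ∀ i, 1 / (#(J i) : ℝ) ≤ κ / N := fun i => by
    have h1 : (0 : ℝ) < #(J i) := by exact_mod_cast hJpos i
    rw [div_le_div_iff₀ h1 hN0]
    have := (hJ i).1
    rw [one_mul, hN]; exact_mod_cast this
  have main := finrank_span_le_of_design v R A ω (fun r => r.1) (τ := 6 * κ / N)
    (hτ0 := by positivity) (fun r hr => (hA r (mem_filter.1 hr).2).1)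
    (fun r hr => (hA r (mem_filter.1 hr).2).2.1)
    (fun r _ => by positivity) ?_ ?_
  · rw [← hN, div_mul_cancel₀ _ hN0.ne'] at main
    have : Module.finrank ℂ (Submodule.span ℂ (Set.range v)) ≤ 1 + 6 * κ := by exact_mod_cast main
    omega
  · intro i
    have e1 : ∑ r ∈ R with r.1 = i, ω r = ∑ j ∈ J i, ∑ k ∈ T i j, ω (i, j, k) := by
      rw [Finset.sum_sigma']
      symm
      refine Finset.sum_bij (fun x _ => (i, x.1, x.2)) ?_ ?_ ?_ ?_
      · rintro ⟨j, k⟩ hx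
        simp only [mem_sigma, T, mem_filter, mem_univ, true_and] at hx
        simp only [hR, mem_filter, mem_univ, true_and, P, and_true]
        exact ⟨hx.1, hx.2.1, hx.2.2.1, hx.2.2.2⟩
      · rintro ⟨j, k⟩ _ ⟨j', k'⟩ _ h
        simp only [Prod.mk.injEq, true_and] at h
        rw [h.1, h.2]
      · rintro ⟨i', j, k⟩ hx
        simp only [hR, mem_filter, mem_univ, true_and, P] at hx
        obtain ⟨hx, rfl⟩ := hx
        exact ⟨⟨j, k⟩, by simp [T, hx.1, hx.2.1, hx.2.2.1, hx.2.2.2], rfl⟩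
      · rintro ⟨j, k⟩ _; rfl
    rw [e1]
    have e2 : ∀ j ∈ J i, ∑ k ∈ T i j, ω (i, j, k) = 1 / #(J i) := by
      intro j hj
      obtain ⟨hij, k, hk⟩ := (hJ i).2 j hj
      have : 0 < #(T i j) := Finset.card_pos.2 ⟨k, by simp [T, hk]⟩
      have h' : (#(T i j) : ℝ) ≠ 0 := by exact_mod_cast this.ne'
      simp only [hω, sum_const, nsmul_eq_mul]
      field_simp
    rw [Finset.sum_congr rfl e2, sum_const, nsmul_eq_mul]
    have : (#(J i) : ℝ) ≠ 0 := by exact_mod_cast (hJpos i).ne'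
    field_simp
  · intro a b hab
    set R' := R.filter fun r => A r a ≠ 0 ∧ A r b ≠ 0 with hR'
    have hmem : ∀ r ∈ R', P r ∧ (a = r.1 ∨ a = r.2.1 ∨ a = r.2.2) ∧
        (b = r.1 ∨ b = r.2.1 ∨ b = r.2.2) := by
      intro r hr
      simp only [hR', hR, mem_filter, mem_univ, true_and] at hr
      exact ⟨hr.1, (hA r hr.1).2.2 a hr.2.1, (hA r hr.1).2.2 b hr.2.2⟩
    have h1 : ∀ r ∈ R', ω r ≤ (κ / N) / #(T a b) := by
      intro r hr
      obtain ⟨hP, ha, hb⟩ := hmem r hr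
      simp only [hω, hTeq r hP a b hab ha hb]
      rw [mul_comm, ← div_div]
      exact div_le_div_of_nonneg_right (hJinv _) (by positivity)
    have h3 : #R' ≤ 6 * #(T a b) := by
      refine card_triples_le R' (T a b) hab fun r hr => ?_
      obtain ⟨⟨g1, g2, g3, g4⟩, ha, hb⟩ := hmem _ hr
      have hij := ((hJ r.1).2 r.2.1 g1).1
      have hm : ∀ x, (x = r.1 ∨ x = r.2.1 ∨ x = r.2.2) →
          v x ∈ Submodule.span ℂ {v r.1, v r.2.1} := by
        rintro x (rfl | rfl | rfl)
        · exact Submodule.subset_span (by simp)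
        · exact Submodule.subset_span (by simp)
        · exact g4
      have e := span_pair_eq_of_mem hv hab (hm a ha) (hm b hb)
      refine ⟨hij.symm, g2.symm, g3.symm, ha, hb, fun x hx hxa hxb => ?_⟩
      simp only [T, mem_filter, mem_univ, true_and, e]
      exact ⟨hxa, hxb, hm x hx⟩
    calc ∑ r ∈ R', ω r ≤ #R' • ((κ / N) / #(T a b)) := Finset.sum_le_card_nsmul _ _ _ h1
      _ = #R' * ((κ / N) / #(T a b)) := nsmul_eq_mul _ _
      _ ≤ (6 * #(T a b) : ℝ) * ((κ / N) / #(T a b)) := by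
          gcongr; exact_mod_cast h3
      _ ≤ 6 * κ / N := by
          rcases Nat.eq_zero_or_pos #(T a b) with h0 | h0
          · rw [h0]; simp; positivity
          · have : (#(T a b) : ℝ) ≠ 0 := by exact_mod_cast h0.ne'
            apply le_of_eq; field_simp

theorem linearIndependent_pair_iff_ne_smul {E : Type*} [AddCommGroup E] [Module ℂ E] {x y : E}
    (hx : x ≠ 0) : LinearIndependent ℂ ![x, y] ↔ ∀ c : ℂ, c • x ≠ y := by
  rw [LinearIndependent.pair_iff' hx]

theorem linearIndependent_pair_of_span_ne {E : Type*} [AddCommGroup E] [Module ℂ E] {x y : E}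
    (hx : x ≠ 0) (hy : y ≠ 0) (h : Submodule.span ℂ {x} ≠ Submodule.span ℂ {y}) :
    LinearIndependent ℂ ![x, y] := by
  rw [linearIndependent_pair_iff_ne_smul hx]
  rintro c rfl
  have hc : c ≠ 0 := fun h => hy (by rw [h, zero_smul])
  exact h (Submodule.span_singleton_smul_eq (IsUnit.mk0 c hc) x).symm

theorem span_ne_of_linearIndependent_pair {E : Type*} [AddCommGroup E] [Module ℂ E] {x y : E}
    (h : LinearIndependent ℂ ![x, y]) : Submodule.span ℂ {x} ≠ Submodule.span ℂ {y} := by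
  intro he
  have hx : x ∈ Submodule.span ℂ {y} := he ▸ Submodule.mem_span_singleton_self x
  obtain ⟨c, hc⟩ := Submodule.mem_span_singleton.1 hx
  exact smul_ne_of_linearIndependent_pair h c hc

/-- A Sylvester-Gallai theorem for finite families in which parallel and zero vectors
are allowed. -/
theorem sylvester_gallai_of_linearIndependent {ι E : Type*} [Finite ι]
    [AddCommGroup E] [Module ℂ E] (v : ι → E)
    (h : ∀ i j, LinearIndependent ℂ ![v i, v j] → ∃ k, v k ∈ Submodule.span ℂ {v i, v j} ∧
      LinearIndependent ℂ ![v i, v k] ∧ LinearIndependent ℂ ![v j, v k]) :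
    Module.finrank ℂ (Submodule.span ℂ (Set.range v)) ≤ 13 := by
  classical
  let κ := {L : Submodule ℂ E // L ≠ ⊥ ∧ ∃ i, Submodule.span ℂ {v i} = L}
  have hfin : Finite κ := by
    have : Set.Finite (Set.range fun i => Submodule.span ℂ {v i}) := Set.finite_range _
    exact Set.Finite.subset this fun L hL => hL.2
  have := Fintype.ofFinite κ
  choose s hs using fun L : κ => L.2.2
  have hne : ∀ L : κ, v (s L) ≠ 0 := fun L h0 => L.2.1 (by rw [← hs L, h0]; simp)
  have hspan : Submodule.span ℂ (Set.range v) = Submodule.span ℂ (Set.range fun L => v (s L)) := by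
    apply le_antisymm
    · rw [Submodule.span_le]
      rintro _ ⟨i, rfl⟩
      by_cases h0 : v i = 0
      · rw [h0]; exact Submodule.zero_mem _
      · let L : κ := ⟨Submodule.span ℂ {v i}, by simpa using h0, i, rfl⟩
        have h1 : v i ∈ Submodule.span ℂ {v (s L)} := by
          rw [hs L]; exact Submodule.mem_span_singleton_self _
        exact Submodule.span_mono (by rintro _ rfl; exact ⟨L, rfl⟩) h1
    · exact Submodule.span_mono (by rintro _ ⟨L, rfl⟩; exact ⟨s L, rfl⟩)
  have hLI : ∀ L M : κ, L ≠ M → LinearIndependent ℂ ![v (s L), v (s M)] := fun L M hLM =>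
    linearIndependent_pair_of_span_ne (hne L) (hne M) (by
      rw [hs, hs]; exact fun he => hLM (Subtype.ext he))
  rw [hspan]
  rcases Nat.lt_or_ge (Fintype.card κ) 2 with hc | hc
  · exact (finrank_range_le_card (R := ℂ) fun L : κ => v (s L)).trans (by omega)
  · refine robust_sylvester_gallai (fun L : κ => v (s L)) hLI 2 fun L =>
      ⟨Finset.univ.erase L, ?_, fun M hM => ⟨Finset.ne_of_mem_erase hM, ?_⟩⟩
    · rw [Finset.card_erase_of_mem (Finset.mem_univ L), Finset.card_univ]; omega
    · obtain ⟨k, hk, h1, h2⟩ := h _ _ (hLI L M (Finset.ne_of_mem_erase hM).symm)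
      have hk0 : v k ≠ 0 := fun h0 => by
        apply smul_ne_of_linearIndependent_pair (x := v k) (y := v (s L)) _ 0
        · rw [h0, zero_smul]
        · exact (LinearIndependent.pair_symm_iff).1 h1
      let K : κ := ⟨Submodule.span ℂ {v k}, by simpa using hk0, k, rfl⟩
      have hK : Submodule.span ℂ {v (s K)} = Submodule.span ℂ {v k} := hs K
      refine ⟨K, ?_, ?_, ?_⟩
      · rintro rfl
        exact span_ne_of_linearIndependent_pair h1 hK
      · rintro rfl
        exact span_ne_of_linearIndependent_pair h2 hK
      · have h3 : v (s K) ∈ Submodule.span ℂ {v k} := hK ▸ Submodule.mem_span_singleton_self _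
        exact (Submodule.span_singleton_le_iff_mem _ _).2 hk h3

theorem IsHomogeneous.aeval_C_mul_X {σ : Type*} {f : MvPolynomial σ ℂ} {m : ℕ}
    (hf : f.IsHomogeneous m) :
    aeval (fun i => Polynomial.C (X i : MvPolynomial σ ℂ) * Polynomial.X) f =
      Polynomial.C f * Polynomial.X ^ m := by
  rw [aeval_def, eval₂_eq]
  conv_rhs => rw [f.as_sum, map_sum, Finset.sum_mul]
  refine Finset.sum_congr rfl fun d hd => ?_
  have hdeg : d.degree = m := by
    by_contra h
    exact (mem_support_iff.1 hd) (hf.coeff_eq_zero h)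
  simp only [mul_pow, Finset.prod_mul_distrib, Finset.prod_pow_eq_pow_sum]
  rw [← hdeg, monomial_eq, Finsupp.prod]
  simp only [map_mul, map_prod, map_pow, Finsupp.degree]
  rw [mul_assoc]; rfl

theorem coeff_aeval_C_mul_X {σ : Type*} (f : MvPolynomial σ ℂ) (j : ℕ) :
    (aeval (fun i => Polynomial.C (X i : MvPolynomial σ ℂ) * Polynomial.X) f).coeff j =
      homogeneousComponent j f := by
  conv_lhs => rw [← sum_homogeneousComponent f, map_sum]
  rw [Polynomial.finsetSum_coeff]
  simp only [IsHomogeneous.aeval_C_mul_X (homogeneousComponent_isHomogeneous _ f),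
    Polynomial.coeff_C_mul_X_pow]
  rw [Finset.sum_ite_eq]
  split_ifs with h
  · rfl
  · rw [homogeneousComponent_eq_zero]
    simpa using h

theorem isHomogeneous_of_mul {σ : Type*} {f g : MvPolynomial σ ℂ} {m : ℕ}
    (h : (f * g).IsHomogeneous m) (h0 : f * g ≠ 0) :
    f.IsHomogeneous f.totalDegree ∧ g.IsHomogeneous g.totalDegree := by
  set ψ : MvPolynomial σ ℂ →ₐ[ℂ] Polynomial (MvPolynomial σ ℂ) :=
    aeval (fun i => Polynomial.C (X i : MvPolynomial σ ℂ) * Polynomial.X) with hψ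
  have hf0 : f ≠ 0 := left_ne_zero_of_mul h0
  have hg0 : g ≠ 0 := right_ne_zero_of_mul h0
  have hψ0 : ∀ p, p ≠ 0 → ψ p ≠ 0 := by
    intro p hp h1
    apply hp
    rw [← sum_homogeneousComponent p]
    refine Finset.sum_eq_zero fun j _ => ?_
    rw [← coeff_aeval_C_mul_X, ← hψ, h1, Polynomial.coeff_zero]
  have e1 : ψ f * ψ g = Polynomial.C (f * g) * Polynomial.X ^ m := by
    rw [← map_mul]; exact IsHomogeneous.aeval_C_mul_X h
  have d1 : (ψ f).natDegree + (ψ g).natDegree = m := by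
    rw [← Polynomial.natDegree_mul (hψ0 f hf0) (hψ0 g hg0), e1,
      Polynomial.natDegree_C_mul_X_pow _ _ h0]
  have d2 : (ψ f).natTrailingDegree + (ψ g).natTrailingDegree = m := by
    rw [← Polynomial.natTrailingDegree_mul (hψ0 f hf0) (hψ0 g hg0), e1,
      Polynomial.C_mul_X_pow_eq_monomial, Polynomial.natTrailingDegree_monomial h0]
  have d3 := (ψ f).natTrailingDegree_le_natDegree
  have d4 := (ψ g).natTrailingDegree_le_natDegree
  have key : ∀ p, p ≠ 0 → (ψ p).natTrailingDegree = (ψ p).natDegree →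
      p.IsHomogeneous p.totalDegree := by
    intro p hp he
    have h1 : p = homogeneousComponent (ψ p).natDegree p := by
      conv_lhs => rw [← sum_homogeneousComponent p]
      by_cases hr : (ψ p).natDegree ∈ Finset.range (p.totalDegree + 1)
      · rw [Finset.sum_eq_single_of_mem _ hr]
        intro j _ hj
        rw [← coeff_aeval_C_mul_X, ← hψ]
        rcases lt_or_gt_of_ne hj with hj | hj
        · exact Polynomial.coeff_eq_zero_of_lt_natTrailingDegree (he ▸ hj)
        · exact Polynomial.coeff_eq_zero_of_natDegree_lt hj
      · exfalso
        have h2 : homogeneousComponent (ψ p).natDegree p = 0 :=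
          homogeneousComponent_eq_zero _ _ (by simpa using hr)
        rw [← coeff_aeval_C_mul_X, ← hψ, Polynomial.coeff_natDegree,
          Polynomial.leadingCoeff_eq_zero] at h2
        exact hψ0 p hp h2
    have h2 : p.IsHomogeneous (ψ p).natDegree := by
      have := homogeneousComponent_isHomogeneous (ψ p).natDegree p
      rwa [← h1] at this
    rw [h2.totalDegree hp]; exact h2
  exact ⟨key f hf0 (by omega), key g hg0 (by omega)⟩

theorem dvd_pow_of_forall_eval {n : ℕ} {f g : MvPolynomial (Fin n) ℂ}
    (h : ∀ a, eval a f = 0 → eval a g = 0) : ∃ N : ℕ, f ∣ g ^ N := by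
  have h1 : g ∈ vanishingIdeal ℂ (zeroLocus ℂ (Ideal.span {f})) := by
    rw [mem_vanishingIdeal_iff]
    intro a ha
    rw [zeroLocus_span] at ha
    have := ha f rfl
    simp only [aeval_eq_eval] at *
    exact h a this
  rw [vanishingIdeal_zeroLocus_eq_radical] at h1
  obtain ⟨N, hN⟩ := h1
  exact ⟨N, Ideal.mem_span_singleton.1 hN⟩

theorem dvd_of_forall_eval {n : ℕ} {f g : MvPolynomial (Fin n) ℂ} (hf : Squarefree f)
    (h : ∀ a, eval a f = 0 → eval a g = 0) : f ∣ g := by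
  obtain ⟨N, hN⟩ := dvd_pow_of_forall_eval h
  rcases eq_or_ne f 0 with rfl | h0
  · rw [zero_dvd_iff] at hN ⊢
    exact eq_zero_of_pow_eq_zero hN
  · exact hf.isRadical N g hN

theorem exists_smul_of_dvd {n d : ℕ} {f g : MvPolynomial (Fin n) ℂ} (hf : f.IsHomogeneous d)
    (hg : g.IsHomogeneous d) (h0 : f ≠ 0) (h : f ∣ g) : ∃ c : ℂ, g = c • f := by
  obtain ⟨q, rfl⟩ := h
  rcases eq_or_ne q 0 with rfl | hq
  · exact ⟨0, by simp⟩
  · have h1 := totalDegree_mul_of_isDomain h0 hq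
    rw [hg.totalDegree (mul_ne_zero h0 hq), hf.totalDegree h0] at h1
    have h2 : q.totalDegree = 0 := by omega
    refine ⟨coeff 0 q, ?_⟩
    rw [totalDegree_eq_zero_iff_eq_C.1 h2, coeff_C, if_pos rfl, mul_comm, C_mul']

variable {n : ℕ}

/-- Polynomials in `n` variables. -/
abbrev Poly (n : ℕ) := MvPolynomial (Fin n) ℂ

/-- The space of linear forms. -/
abbrev Lin (n : ℕ) : Submodule ℂ (Poly n) := homogeneousSubmodule (Fin n) ℂ 1

theorem quad_iff {f : Poly n} : f.IsHomogeneous 2 ↔ f ∈ Lin n * Lin n := by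
  rw [← pow_two, homogeneousSubmodule_one_pow]; rfl

theorem lin_induction {p : Poly n → Prop} (hX : ∀ i, p (X i)) (h0 : p 0)
    (hadd : ∀ x y, p x → p y → p (x + y)) (hsmul : ∀ (c : ℂ) x, p x → p (c • x))
    {ℓ : Poly n} (hℓ : ℓ ∈ Lin n) : p ℓ := by
  rw [Lin, homogeneousSubmodule_one_eq_span_X] at hℓ
  induction hℓ using Submodule.span_induction with
  | mem x h => obtain ⟨i, rfl⟩ := h; exact hX i
  | zero => exact h0
  | add x y _ _ hx hy => exact hadd x y hx hy
  | smul c x _ hx => exact hsmul c x hx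

instance finiteDimensional_lin : FiniteDimensional ℂ (Lin n) := by
  rw [Lin, homogeneousSubmodule_one_eq_span_X]
  exact FiniteDimensional.span_of_finite ℂ (Set.finite_range _)

theorem finiteDimensional_of_le {X : Submodule ℂ (Poly n)} (hX : X ≤ Lin n) :
    FiniteDimensional ℂ X := Submodule.finiteDimensional_of_le hX

theorem eval_add_lin {ℓ : Poly n} (hℓ : ℓ ∈ Lin n) (a b : Fin n → ℂ) :
    eval (a + b) ℓ = eval a ℓ + eval b ℓ := by
  refine lin_induction (p := fun ℓ => eval (a + b) ℓ = eval a ℓ + eval b ℓ)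
    (by simp) (by simp) ?_ ?_ hℓ
  · intro x y hx hy; simp only [map_add, hx, hy]; ring
  · intro c x hx; simp only [smul_eval, hx]; ring

theorem eval_smul_lin {ℓ : Poly n} (hℓ : ℓ ∈ Lin n) (t : ℂ) (a : Fin n → ℂ) :
    eval (t • a) ℓ = t * eval a ℓ := by
  refine lin_induction (p := fun ℓ => eval (t • a) ℓ = t * eval a ℓ)
    (by simp) (by simp) ?_ ?_ hℓ
  · intro x y hx hy; simp only [map_add, hx, hy]; ring
  · intro c x hx; simp only [smul_eval, hx]; ring

theorem exists_point (ψ : Poly n →ₗ[ℂ] ℂ) : ∃ d : Fin n → ℂ, ∀ ℓ ∈ Lin n, eval d ℓ = ψ ℓ := by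
  refine ⟨fun i => ψ (X i), fun ℓ hℓ => ?_⟩
  refine lin_induction (p := fun ℓ => eval (fun i => ψ (X i)) ℓ = ψ ℓ)
    (by simp) (by simp) ?_ ?_ hℓ
  · intro x y hx hy; simp only [map_add, hx, hy]
  · intro c x hx; simp only [smul_eval, hx, map_smul, smul_eq_mul]

theorem exists_point_of_notMem {X : Submodule ℂ (Poly n)} (hX : X ≤ Lin n) {ℓ : Poly n}
    (hℓ : ℓ ∈ Lin n) (h : ℓ ∉ X) :
    ∃ d : Fin n → ℂ, (∀ x ∈ X, eval d x = 0) ∧ eval d ℓ = 1 := by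
  obtain ⟨f, hf, hfX⟩ := Submodule.exists_le_ker_of_notMem h
  obtain ⟨d, hd⟩ := exists_point ((f ℓ)⁻¹ • f)
  refine ⟨d, fun x hx => ?_, ?_⟩
  · rw [hd x (hX hx)]
    simp [LinearMap.mem_ker.1 (hfX hx)]
  · rw [hd ℓ hℓ]; simp [hf]

/-- Linear substitution along `φ`. -/
noncomputable def subst (φ : Poly n →ₗ[ℂ] Poly n) : Poly n →ₐ[ℂ] Poly n :=
  aeval fun i => φ (X i)

theorem subst_lin (φ : Poly n →ₗ[ℂ] Poly n) {ℓ : Poly n} (hℓ : ℓ ∈ Lin n) :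
    subst φ ℓ = φ ℓ := by
  refine lin_induction (p := fun ℓ => subst φ ℓ = φ ℓ) (by simp [subst]) (by simp) ?_ ?_ hℓ
  · intro x y hx hy; simp only [map_add, hx, hy]
  · intro c x hx; simp only [map_smul, hx]

theorem eval_subst (φ : Poly n →ₗ[ℂ] Poly n) (d : Fin n → ℂ) (f : Poly n) :
    eval d (subst φ f) = eval (fun i => eval d (φ (X i))) f := by
  have : (aeval d).comp (subst φ) = aeval (R := ℂ) (fun i => eval d (φ (X i))) := by
    ext i; simp [subst, aeval_eq_eval]
  have := congrArg (fun g => g f) this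
  simpa [aeval_eq_eval] using this

theorem eval_pull (φ : Poly n →ₗ[ℂ] Poly n) (d : Fin n → ℂ) {ℓ : Poly n} (hℓ : ℓ ∈ Lin n) :
    eval (fun i => eval d (φ (X i))) ℓ = eval d (φ ℓ) := by
  rw [← eval_subst, subst_lin φ hℓ]

theorem subst_mem_mul {φ : Poly n →ₗ[ℂ] Poly n} {A B A' B' : Submodule ℂ (Poly n)}
    (hA : A ≤ Lin n) (hB : B ≤ Lin n) (hA' : ∀ x ∈ A, φ x ∈ A') (hB' : ∀ x ∈ B, φ x ∈ B')
    {f : Poly n} (hf : f ∈ A * B) : subst φ f ∈ A' * B' := by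
  induction hf using Submodule.mul_induction_on' with
  | mem_mul_mem x hx y hy =>
    rw [map_mul, subst_lin φ (hA hx), subst_lin φ (hB hy)]
    exact Submodule.mul_mem_mul (hA' x hx) (hB' y hy)
  | add x _ y _ hx hy => rw [map_add]; exact Submodule.add_mem _ hx hy

theorem subst_quad {φ : Poly n →ₗ[ℂ] Poly n} (hφ : ∀ x ∈ Lin n, φ x ∈ Lin n)
    {f : Poly n} (hf : f.IsHomogeneous 2) : (subst φ f).IsHomogeneous 2 := by
  rw [quad_iff] at *
  exact subst_mem_mul le_rfl le_rfl hφ hφ hf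

/-- If `φ` is the identity on `A` and `B` then substitution fixes `A * B`. -/
theorem subst_eq_self {φ : Poly n →ₗ[ℂ] Poly n} {A B : Submodule ℂ (Poly n)}
    (hA : A ≤ Lin n) (hB : B ≤ Lin n) (hA' : ∀ x ∈ A, φ x = x) (hB' : ∀ x ∈ B, φ x = x)
    {f : Poly n} (hf : f ∈ A * B) : subst φ f = f := by
  induction hf using Submodule.mul_induction_on' with
  | mem_mul_mem x hx y hy =>
    rw [map_mul, subst_lin φ (hA hx), subst_lin φ (hB hy), hA' x hx, hB' y hy]
  | add x _ y _ hx hy => rw [map_add, hx, hy]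

theorem sub_subst_mem {φ : Poly n →ₗ[ℂ] Poly n} (hφ : ∀ x ∈ Lin n, φ x ∈ Lin n)
    {V : Submodule ℂ (Poly n)} (hV : ∀ x ∈ Lin n, x - φ x ∈ V)
    {f : Poly n} (hf : f.IsHomogeneous 2) : f - subst φ f ∈ V * Lin n := by
  rw [quad_iff] at hf
  induction hf using Submodule.mul_induction_on' with
  | mem_mul_mem x hx y hy =>
    rw [map_mul, subst_lin φ hx, subst_lin φ hy]
    have : x * y - φ x * φ y = (x - φ x) * y + (y - φ y) * φ x := by ring
    rw [this]
    exact Submodule.add_mem _ (Submodule.mul_mem_mul (hV x hx) hy)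
      (Submodule.mul_mem_mul (hV y hy) (hφ x hx))
  | add x _ y _ hx hy =>
    rw [map_add]
    have : x + y - (subst φ x + subst φ y) = (x - subst φ x) + (y - subst φ y) := by ring
    rw [this]; exact Submodule.add_mem _ hx hy

theorem exists_projection {X K : Submodule ℂ (Poly n)} (h : Disjoint X K) :
    ∃ φ : Poly n →ₗ[ℂ] Poly n, (∀ x ∈ X, φ x = x) ∧ (∀ x ∈ K, φ x = 0) ∧ ∀ x, φ x ∈ X := by
  obtain ⟨K', hKK', hK'⟩ := h.symm.exists_isCompl
  refine ⟨X.subtype ∘ₗ Submodule.projectionOnto X K' hK'.symm, ?_, ?_, ?_⟩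
  · intro x hx
    exact congrArg Subtype.val (Submodule.projectionOnto_apply_left hK'.symm ⟨x, hx⟩)
  · intro x hx
    have := Submodule.projectionOnto_apply_right hK'.symm ⟨x, hKK' hx⟩
    simp only [LinearMap.comp_apply, Submodule.subtype_apply]
    rw [show x = ((⟨x, hKK' hx⟩ : K') : Poly n) from rfl, this]; rfl
  · intro x; exact Subtype.mem _

theorem exists_point_extend {X Y : Submodule ℂ (Poly n)} (hX : X ≤ Lin n) (hY : Y ≤ Lin n)
    (h : Disjoint X Y) (d : Fin n → ℂ) :
    ∃ d' : Fin n → ℂ, (∀ x ∈ X, eval d' x = eval d x) ∧ ∀ y ∈ Y, eval d' y = 0 := by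
  obtain ⟨φ, h1, h2, h3⟩ := exists_projection h
  refine ⟨fun i => eval d (φ (MvPolynomial.X i)), fun x hx => ?_, fun y hy => ?_⟩
  · rw [eval_pull φ d (hX hx), h1 x hx]
  · rw [eval_pull φ d (hY hy), h2 y hy, map_zero]

theorem eval_mul_eq_zero {V B : Submodule ℂ (Poly n)} {d : Fin n → ℂ}
    (hV : ∀ x ∈ V, eval d x = 0) {f : Poly n} (hf : f ∈ V * B) : eval d f = 0 := by
  induction hf using Submodule.mul_induction_on' with
  | mem_mul_mem x hx y hy => rw [map_mul, hV x hx, zero_mul]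
  | add x _ y _ hx hy => rw [map_add, hx, hy, add_zero]

theorem mem_mul_lin_of_vanish {V : Submodule ℂ (Poly n)} (hV : V ≤ Lin n) {f : Poly n}
    (hf : f.IsHomogeneous 2) (h : ∀ d, (∀ x ∈ V, eval d x = 0) → eval d f = 0) :
    f ∈ V * Lin n := by
  obtain ⟨φ, h1, -, h3⟩ := exists_projection (disjoint_bot_right (a := V))
  set ψ : Poly n →ₗ[ℂ] Poly n := LinearMap.id - φ with hψ
  have e := sub_subst_mem (φ := ψ) (V := V) (fun x hx => Submodule.sub_mem _ hx (hV (h3 x)))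
    (fun x _ => by simpa [hψ] using h3 x) hf
  have h0 : subst ψ f = 0 := by
    apply MvPolynomial.funext
    intro d
    rw [eval_subst, map_zero]
    refine h _ fun x hx => ?_
    rw [eval_pull ψ d (hV hx)]
    simp [hψ, h1 x hx]
  rwa [h0, sub_zero] at e

theorem lin_mem_of_mul_mem {V : Submodule ℂ (Poly n)} (hV : V ≤ Lin n) {a b : Poly n}
    (ha : a ∈ Lin n) (hb : b ∈ Lin n) (h : a * b ∈ V * Lin n) : a ∈ V ∨ b ∈ V := by
  by_contra! hcon
  obtain ⟨d, hd, hd1⟩ := exists_point_of_notMem hV ha hcon.1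
  obtain ⟨e, he, he1⟩ := exists_point_of_notMem hV hb hcon.2
  have key : ∀ t : ℂ, eval (d + t • e) a * eval (d + t • e) b = 0 := fun t => by
    rw [← map_mul]
    refine eval_mul_eq_zero (fun x hx => ?_) h
    rw [eval_add_lin (hV hx), eval_smul_lin (hV hx), hd x hx, he x hx]; simp
  simp only [eval_add_lin ha, eval_smul_lin ha, eval_add_lin hb, eval_smul_lin hb, hd1, he1] at key
  have k0 := key 0
  have k1 := key 1
  have k2 := key (-1)
  have hb0 : eval d b = 0 := by simpa using k0
  rw [hb0] at k1 k2
  have : (1 + 1 : ℂ) = 0 := by linear_combination k1 - k2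
  norm_num at this

theorem lin_mem_of_sq_mem {V : Submodule ℂ (Poly n)} (hV : V ≤ Lin n) {a : Poly n}
    (ha : a ∈ Lin n) (h : a ^ 2 ∈ V * Lin n) : a ∈ V := by
  rw [pow_two] at h
  exact (lin_mem_of_mul_mem hV ha ha h).elim id id

theorem mem_span_range_mul_iff {ι : Type*} [Fintype ι] {b : ι → Poly n}
    {B : Submodule ℂ (Poly n)} {f : Poly n} :
    f ∈ Submodule.span ℂ (Set.range b) * B ↔
      ∃ h : ι → Poly n, (∀ i, h i ∈ B) ∧ f = ∑ i, b i * h i := by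
  classical
  constructor
  · intro hf
    induction hf using Submodule.mul_induction_on' with
    | mem_mul_mem x hx y hy =>
      obtain ⟨c, rfl⟩ := (Submodule.mem_span_range_iff_exists_fun ℂ).1 hx
      exact ⟨fun i => c i • y, fun i => Submodule.smul_mem _ _ hy, by
        rw [Finset.sum_mul]; exact Finset.sum_congr rfl fun i _ => by simp⟩
    | add x _ y _ hx hy =>
      obtain ⟨h1, h2, rfl⟩ := hx
      obtain ⟨g1, g2, rfl⟩ := hy
      exact ⟨fun i => h1 i + g1 i, fun i => Submodule.add_mem _ (h2 i) (g2 i), by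
        simp [mul_add, Finset.sum_add_distrib]⟩
  · rintro ⟨h, hh, rfl⟩
    exact Submodule.sum_mem _ fun i _ =>
      Submodule.mul_mem_mul (Submodule.subset_span ⟨i, rfl⟩) (hh i)

theorem exists_mem_mul_self {V : Submodule ℂ (Poly n)} (hV : V ≤ Lin n) {f : Poly n}
    (hf : f ∈ V * Lin n) : ∃ W : Submodule ℂ (Poly n), V ≤ W ∧ W ≤ Lin n ∧
      Module.finrank ℂ W ≤ 2 * Module.finrank ℂ V ∧ f ∈ W * W := by
  have := finiteDimensional_of_le hV
  have e : V = Submodule.span ℂ (Set.range fun i => ((Module.finBasis ℂ V i : V) : Poly n)) := by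
    have h1 := (Module.finBasis ℂ V).span_eq
    have h2 := congrArg (Submodule.map V.subtype) h1
    rw [Submodule.map_span, Submodule.map_subtype_top, ← Set.range_comp] at h2
    exact h2.symm
  have hf' := hf
  rw [e, mem_span_range_mul_iff] at hf'
  obtain ⟨h, hh, hfe⟩ := hf'
  refine ⟨V ⊔ Submodule.span ℂ (Set.range h), le_sup_left, sup_le hV ?_, ?_, ?_⟩
  · rw [Submodule.span_le]; rintro _ ⟨i, rfl⟩; exact hh i
  · have : FiniteDimensional ℂ (Submodule.span ℂ (Set.range h)) :=
      FiniteDimensional.span_of_finite ℂ (Set.finite_range _)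
    have h1 := Submodule.finrank_add_le_finrank_add_finrank V (Submodule.span ℂ (Set.range h))
    have h2 : Set.finrank ℂ (Set.range h) ≤ _ := finrank_range_le_card (R := ℂ) h
    rw [Fintype.card_fin] at h2
    unfold Set.finrank at h2
    omega
  · rw [hfe]
    refine Submodule.sum_mem _ fun i _ => Submodule.mul_mem_mul ?_ ?_
    · exact Submodule.mem_sup_left (Subtype.mem _)
    · exact Submodule.mem_sup_right (Submodule.subset_span ⟨i, rfl⟩)

/-- Directional derivative. -/
noncomputable def der (d : Fin n → ℂ) : Derivation ℂ (Poly n) (Poly n) :=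
  mkDerivation ℂ fun i => C (d i)

theorem der_lin (d : Fin n → ℂ) {ℓ : Poly n} (hℓ : ℓ ∈ Lin n) : der d ℓ = C (eval d ℓ) := by
  refine lin_induction (p := fun ℓ => der d ℓ = C (eval d ℓ)) (by simp [der]) (by simp) ?_ ?_ hℓ
  · intro x y hx hy; simp only [map_add, hx, hy]
  · intro c x hx; simp only [Derivation.map_smul, hx, smul_eval, C_mul, C_mul']

theorem der_mul_lin (d : Fin n → ℂ) {x y : Poly n} (hx : x ∈ Lin n) (hy : y ∈ Lin n) :
    der d (x * y) = eval d y • x + eval d x • y := by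
  rw [Derivation.leibniz, der_lin d hx, der_lin d hy, smul_eq_mul, smul_eq_mul, mul_comm x,
    mul_comm y, C_mul', C_mul']

theorem der_mem {A B : Submodule ℂ (Poly n)} (hA : A ≤ Lin n) (hB : B ≤ Lin n)
    (d : Fin n → ℂ) {f : Poly n} (hf : f ∈ A * B) : der d f ∈ A ⊔ B := by
  induction hf using Submodule.mul_induction_on' with
  | mem_mul_mem x hx y hy =>
    rw [der_mul_lin d (hA hx) (hB hy)]
    exact Submodule.add_mem _ (Submodule.smul_mem _ _ (Submodule.mem_sup_left hx))
      (Submodule.smul_mem _ _ (Submodule.mem_sup_right hy))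
  | add x _ y _ hx hy => rw [map_add]; exact Submodule.add_mem _ hx hy

theorem der_mem_left {A B : Submodule ℂ (Poly n)} (hA : A ≤ Lin n) (hB : B ≤ Lin n)
    {d : Fin n → ℂ} (hd : ∀ x ∈ A, eval d x = 0) {f : Poly n} (hf : f ∈ A * B) :
    der d f ∈ A := by
  induction hf using Submodule.mul_induction_on' with
  | mem_mul_mem x hx y hy =>
    rw [der_mul_lin d (hA hx) (hB hy), hd x hx, zero_smul, add_zero]
    exact Submodule.smul_mem _ _ hx
  | add x _ y _ hx hy => rw [map_add]; exact Submodule.add_mem _ hx hy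

theorem der_eq_zero {A B : Submodule ℂ (Poly n)} (hA : A ≤ Lin n) (hB : B ≤ Lin n)
    {d : Fin n → ℂ} (hd : ∀ x ∈ A, eval d x = 0) (hd' : ∀ x ∈ B, eval d x = 0) {f : Poly n}
    (hf : f ∈ A * B) : der d f = 0 := by
  induction hf using Submodule.mul_induction_on' with
  | mem_mul_mem x hx y hy =>
    rw [der_mul_lin d (hA hx) (hB hy), hd x hx, hd' y hy, zero_smul, zero_smul, add_zero]
  | add x _ y _ hx hy => rw [map_add, hx, hy, add_zero]

theorem der_quad (d : Fin n → ℂ) {f : Poly n} (hf : f.IsHomogeneous 2) : der d f ∈ Lin n := by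
  have := der_mem le_rfl le_rfl d (quad_iff.1 hf)
  rwa [sup_idem] at this

theorem eval_add_smul_quad {f : Poly n} (hf : f.IsHomogeneous 2) (a e : Fin n → ℂ) (t : ℂ) :
    eval (a + t • e) f = eval a f + t * eval a (der e f) + t ^ 2 * eval e f := by
  rw [quad_iff] at hf
  induction hf using Submodule.mul_induction_on' with
  | mem_mul_mem x hx y hy =>
    rw [der_mul_lin e hx hy]
    simp only [map_mul, map_add, smul_eval, eval_add_lin hx, eval_add_lin hy, eval_smul_lin hx,
      eval_smul_lin hy]
    ring
  | add x _ y _ hx hy => simp only [map_add, hx, hy]; ring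

theorem eval_add_quad {f : Poly n} (hf : f.IsHomogeneous 2) (a e : Fin n → ℂ) :
    eval (a + e) f = eval a f + eval a (der e f) + eval e f := by
  have := eval_add_smul_quad hf a e 1
  simpa using this

theorem eval_smul_quad {f : Poly n} (hf : f.IsHomogeneous 2) (t : ℂ) (a : Fin n → ℂ) :
    eval (t • a) f = t ^ 2 * eval a f := by
  have := eval_add_smul_quad hf 0 a t
  rw [zero_add] at this
  have h0 : eval (0 : Fin n → ℂ) f = 0 := by
    have h1 := eval_add_smul_quad hf 0 0 (2 : ℂ)
    have h2 : eval (0 : Fin n → ℂ) (der 0 f) = 0 := by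
      have h3 := eval_smul_lin (der_quad 0 hf) 0 (0 : Fin n → ℂ)
      simpa using h3
    rw [h2] at h1
    simp only [smul_zero, add_zero] at h1
    linear_combination (-1 / 4 : ℂ) * h1
  have h2 : eval (0 : Fin n → ℂ) (der a f) = 0 := by
    have h3 := eval_smul_lin (der_quad a hf) 0 (0 : Fin n → ℂ)
    simpa using h3
  rw [this, h0, h2]; ring

theorem eval_der_comm {f : Poly n} (hf : f.IsHomogeneous 2) (a e : Fin n → ℂ) :
    eval a (der e f) = eval e (der a f) := by
  have h1 := eval_add_quad hf a e
  have h2 := eval_add_quad hf e a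
  rw [add_comm e a] at h2
  linear_combination h2 - h1

theorem eval_der_self {f : Poly n} (hf : f.IsHomogeneous 2) (a : Fin n → ℂ) :
    eval a (der a f) = 2 * eval a f := by
  have h1 := eval_add_quad hf a a
  have h2 : a + a = (2 : ℂ) • a := by rw [two_smul]
  rw [h2, eval_smul_quad hf] at h1
  linear_combination -h1

theorem der_add (d e : Fin n → ℂ) {f : Poly n} (hf : f.IsHomogeneous 2) :
    der (d + e) f = der d f + der e f := by
  apply MvPolynomial.funext
  intro a
  rw [map_add, eval_der_comm hf, eval_der_comm hf a d, eval_der_comm hf a e,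
    eval_add_lin (der_quad a hf)]

theorem der_smul (t : ℂ) (d : Fin n → ℂ) {f : Poly n} (hf : f.IsHomogeneous 2) :
    der (t • d) f = t • der d f := by
  apply MvPolynomial.funext
  intro a
  rw [smul_eval, eval_der_comm hf, eval_der_comm hf a d, eval_smul_lin (der_quad a hf)]

theorem quad_eq_zero_of_der {f : Poly n} (hf : f.IsHomogeneous 2) (h : ∀ d, der d f = 0) :
    f = 0 := by
  apply MvPolynomial.funext
  intro a
  have := eval_der_self hf a
  rw [h a, map_zero] at this
  rw [map_zero]
  linear_combination (-1 / 2 : ℂ) * this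

/-- A quadratic all of whose derivatives lie in `A` belongs to `A * A`. -/
theorem mem_mul_self_of_der {A : Submodule ℂ (Poly n)} (hA : A ≤ Lin n) {f : Poly n}
    (hf : f.IsHomogeneous 2) (h : ∀ d, der d f ∈ A) : f ∈ A * A := by
  obtain ⟨φ, h1, -, h3⟩ := exists_projection (disjoint_bot_right (a := A))
  have hφ : ∀ x ∈ Lin n, φ x ∈ Lin n := fun x _ => hA (h3 x)
  have e : f = subst φ f := by
    apply MvPolynomial.funext
    intro d
    rw [eval_subst]
    set d' : Fin n → ℂ := fun i => eval d (φ (X i)) with hd'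
    have hk : ∀ x ∈ A, eval (d - d') x = 0 := fun x hx => by
      rw [sub_eq_add_neg, eval_add_lin (hA hx), ← neg_one_smul ℂ d', eval_smul_lin (hA hx),
        hd', eval_pull φ d (hA hx), h1 x hx]; ring
    have h4 := eval_add_quad hf d' (d - d')
    have h5 := eval_der_self hf (d - d')
    rw [hk _ (h _)] at h5
    rw [eval_der_comm hf, hk _ (h _), add_sub_cancel] at h4
    rw [h4]
    linear_combination (-1 / 2 : ℂ) * h5
  rw [e]
  exact subst_mem_mul le_rfl le_rfl (fun x _ => h3 x) (fun x _ => h3 x) (quad_iff.1 hf)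

theorem not_irreducible_mul_lin {a b : Poly n} (ha : a ∈ Lin n) (hb : b ∈ Lin n) :
    ¬ Irreducible (a * b) := by
  have key : ∀ x ∈ Lin n, ¬ IsUnit x := fun x hx hu => by
    have h1 := hu.map (eval (0 : Fin n → ℂ))
    have h2 := eval_smul_lin hx 0 (0 : Fin n → ℂ)
    rw [smul_zero, zero_mul] at h2
    rw [h2] at h1
    exact not_isUnit_zero h1
  intro h
  rcases h.isUnit_or_isUnit rfl with h | h
  · exact key a ha h
  · exact key b hb h

theorem not_irreducible_sq {a : Poly n} (ha : a ∈ Lin n) : ¬ Irreducible (a ^ 2) := by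
  rw [pow_two]; exact not_irreducible_mul_lin ha ha

theorem mul_quad {a b : Poly n} (ha : a ∈ Lin n) (hb : b ∈ Lin n) : (a * b).IsHomogeneous 2 :=
  quad_iff.2 (Submodule.mul_mem_mul ha hb)

theorem sq_quad {a : Poly n} (ha : a ∈ Lin n) : (a ^ 2).IsHomogeneous 2 := by
  rw [pow_two]; exact mul_quad ha ha

theorem smul_quad {f : Poly n} (c : ℂ) (hf : f.IsHomogeneous 2) : (c • f).IsHomogeneous 2 :=
  (homogeneousSubmodule (Fin n) ℂ 2).smul_mem c hf

/-- A factor of a quadratic which is homogeneous of degree one. -/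
theorem mem_lin_mul_iff {v f : Poly n} : f ∈ Submodule.span ℂ {v} * Lin n ↔
    ∃ b ∈ Lin n, f = v * b := by
  constructor
  · intro hf
    induction hf using Submodule.mul_induction_on' with
    | mem_mul_mem x hx y hy =>
      obtain ⟨c, rfl⟩ := Submodule.mem_span_singleton.1 hx
      exact ⟨c • y, Submodule.smul_mem _ _ hy, by simp⟩
    | add x _ y _ hx hy =>
      obtain ⟨b, hb, rfl⟩ := hx
      obtain ⟨c, hc, rfl⟩ := hy
      exact ⟨b + c, Submodule.add_mem _ hb hc, by ring⟩
  · rintro ⟨b, hb, rfl⟩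
    exact Submodule.mul_mem_mul (Submodule.mem_span_singleton_self v) hb

theorem mem_span_pair_mul_iff {v w f : Poly n} : f ∈ Submodule.span ℂ {v, w} * Lin n ↔
    ∃ a ∈ Lin n, ∃ b ∈ Lin n, f = v * a + w * b := by
  rw [Submodule.span_insert, Submodule.sup_mul, Submodule.mem_sup]
  constructor
  · rintro ⟨x, hx, y, hy, rfl⟩
    obtain ⟨a, ha, rfl⟩ := mem_lin_mul_iff.1 hx
    obtain ⟨b, hb, rfl⟩ := mem_lin_mul_iff.1 hy
    exact ⟨a, ha, b, hb, rfl⟩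
  · rintro ⟨a, ha, b, hb, rfl⟩
    exact ⟨_, mem_lin_mul_iff.2 ⟨a, ha, rfl⟩, _, mem_lin_mul_iff.2 ⟨b, hb, rfl⟩, rfl⟩

theorem dvd_lin_quad {v f : Poly n} (hv : v ∈ Lin n) (hf : f.IsHomogeneous 2)
    (h : v ∣ f) : ∃ b ∈ Lin n, f = v * b := by
  rw [← mem_lin_mul_iff]
  refine mem_mul_lin_of_vanish (by rwa [Submodule.span_singleton_le_iff_mem]) hf fun d hd => ?_
  obtain ⟨q, rfl⟩ := h
  rw [map_mul, hd v (Submodule.mem_span_singleton_self v), zero_mul]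

/-- If an irreducible quadratic is a polynomial in the forms of `X` and lies in the ideal
`(v, w)` of linear forms, then `v` and `w` belong to `X`. -/
theorem mem_of_irreducible {X : Submodule ℂ (Poly n)} (hX : X ≤ Lin n) {f v a w b : Poly n}
    (hf : Irreducible f) (hfX : f ∈ X * X) (hv : v ∈ Lin n) (hw : w ∈ Lin n) (ha : a ∈ Lin n)
    (hb : b ∈ Lin n) (e : f = v * a + w * b) : v ∈ X ∧ w ∈ X := by
  have main : ∀ v w a b : Poly n, v ∈ Lin n → w ∈ Lin n → a ∈ Lin n → b ∈ Lin n →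
      f = v * a + w * b → v ∈ X := by
    intro v w a b hv hw ha hb e
    by_contra hvX
    obtain ⟨φ, h1, h2, h3⟩ := exists_projection
      (X := X) (K := Submodule.span ℂ {v}) (by
        rw [Submodule.disjoint_span_singleton]
        exact fun h => absurd h hvX)
    have := subst_eq_self hX hX h1 h1 hfX
    rw [e, map_add, map_mul, map_mul, subst_lin φ hv,
      h2 v (Submodule.mem_span_singleton_self v), zero_mul, zero_add, ← e] at this
    rw [subst_lin φ hw, subst_lin φ hb] at this
    exact not_irreducible_mul_lin (hX (h3 w)) (hX (h3 b)) (this ▸ hf)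
  exact ⟨main v w a b hv hw ha hb e, main w v b a hw hv hb ha (by rw [e]; ring)⟩

theorem prime_lin {x : Poly n} (hx : x ∈ Lin n) (h0 : x ≠ 0) : Prime x := by
  rw [← UniqueFactorizationMonoid.irreducible_iff_prime]
  have hu : ∀ f : Poly n, f ≠ 0 → f.totalDegree = 0 → IsUnit f := by
    intro f hf hd
    rw [totalDegree_eq_zero_iff_eq_C] at hd
    have hc : coeff 0 f ≠ 0 := fun h => hf (by rw [hd, h, C_0])
    rw [hd]
    exact (IsUnit.mk0 _ hc).map C
  refine ⟨fun h => ?_, fun f g hfg => ?_⟩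
  · have h1 := h.map (eval (0 : Fin n → ℂ))
    have h2 := eval_smul_lin hx 0 (0 : Fin n → ℂ)
    rw [smul_zero, zero_mul] at h2
    rw [h2] at h1
    exact not_isUnit_zero h1
  · have hf : f ≠ 0 := left_ne_zero_of_mul (hfg ▸ h0)
    have hg : g ≠ 0 := right_ne_zero_of_mul (hfg ▸ h0)
    have h1 := totalDegree_mul_of_isDomain hf hg
    rw [← hfg, IsHomogeneous.totalDegree hx h0] at h1
    rcases Nat.eq_zero_or_pos f.totalDegree with h | h
    · exact Or.inl (hu f hf h)
    · exact Or.inr (hu g hg (by omega))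

theorem exists_sq_mul_of_not_squarefree {m : ℕ} {f : Poly n} (hf : f.IsHomogeneous m)
    (h0 : f ≠ 0) (h : ¬ Squarefree f) : ∃ (g h : Poly n) (k l : ℕ), g.IsHomogeneous k ∧
      h.IsHomogeneous l ∧ 1 ≤ k ∧ 2 * k + l = m ∧ f = g ^ 2 * h := by
  simp only [Squarefree, not_forall] at h
  obtain ⟨g, ⟨q, hq⟩, hg⟩ := h
  have h1 := isHomogeneous_of_mul (hq ▸ hf) (hq ▸ h0)
  have hgg : g * g ≠ 0 := left_ne_zero_of_mul (hq ▸ h0)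
  have hg0 : g ≠ 0 := left_ne_zero_of_mul hgg
  have hq0 : q ≠ 0 := right_ne_zero_of_mul (hq ▸ h0)
  have h2 := isHomogeneous_of_mul h1.1 hgg
  refine ⟨g, q, _, _, h2.1, h1.2, ?_, ?_, by rw [hq]; ring⟩
  · by_contra! hd
    have hd : g.totalDegree = 0 := by omega
    rw [totalDegree_eq_zero_iff_eq_C] at hd
    have hc : coeff 0 g ≠ 0 := fun h => hg0 (by rw [hd, h, C_0])
    apply hg
    rw [hd]
    exact (IsUnit.mk0 _ hc).map C
  · have h3 := totalDegree_mul_of_isDomain hgg hq0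
    rw [← hq, totalDegree_mul_of_isDomain hg0 hg0, hf.totalDegree h0] at h3
    omega

theorem exists_sq_of_isHomogeneous_zero {g h : Poly n} (hh : h.IsHomogeneous 0) :
    ∃ c : ℂ, g ^ 2 * h = (c • g) ^ 2 := by
  have h1 : h ∈ homogeneousSubmodule (Fin n) ℂ 0 := hh
  have h2 : h.totalDegree = 0 := by
    rcases eq_or_ne h 0 with rfl | h0
    · simp
    · exact hh.totalDegree h0
  rw [totalDegree_eq_zero_iff_eq_C] at h2
  obtain ⟨c, hc⟩ := IsAlgClosed.exists_pow_nat_eq (coeff 0 h) (n := 2) two_pos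
  refine ⟨c, ?_⟩
  rw [h2, ← hc, smul_pow, mul_comm, C_mul']

/-- A linear map of linear forms whose kernel is spanned by `ℓ`. -/
theorem exists_kill (ℓ : Poly n) (hℓ : ℓ ∈ Lin n) : ∃ φ : Poly n →ₗ[ℂ] Poly n,
    φ ℓ = 0 ∧ (∀ x ∈ Lin n, φ x ∈ Lin n) ∧ ∀ x ∈ Lin n, x - φ x ∈ Submodule.span ℂ {ℓ} := by
  obtain ⟨φ, h1, -, h3⟩ := exists_projection (disjoint_bot_right (a := Submodule.span ℂ {ℓ}))
  have hle : Submodule.span ℂ {ℓ} ≤ Lin n := by rwa [Submodule.span_singleton_le_iff_mem]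
  refine ⟨LinearMap.id - φ, ?_, fun x hx => Submodule.sub_mem _ hx (hle (h3 x)), fun x _ => ?_⟩
  · simp [h1 ℓ (Submodule.mem_span_singleton_self ℓ)]
  · simpa using h3 x

/-- The quadratics vanishing on the intersection of an irreducible quadric with a hyperplane. -/
theorem structure_of_linear {A F ℓ : Poly n} (hA : A.IsHomogeneous 2) (hA' : Irreducible A)
    (hℓ : ℓ ∈ Lin n) (hF : F.IsHomogeneous 2)
    (h : ∀ a, eval a A = 0 → eval a ℓ = 0 → eval a F = 0) :
    (∃ c : ℂ, ∃ b ∈ Lin n, F = c • A + ℓ * b) ∨ ∃ b ∈ Lin n, ∃ v ∈ Lin n, A = ℓ * b + v ^ 2 := by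
  obtain ⟨φ, h1, h2, h3⟩ := exists_kill ℓ hℓ
  obtain ⟨b, hb, eA⟩ := mem_lin_mul_iff.1 (sub_subst_mem h2 h3 hA)
  obtain ⟨b', hb', eF⟩ := mem_lin_mul_iff.1 (sub_subst_mem h2 h3 hF)
  have hA0 : subst φ A ≠ 0 := fun h0 => by
    rw [h0, sub_zero] at eA
    exact not_irreducible_mul_lin hℓ hb (eA ▸ hA')
  by_cases hsq : Squarefree (subst φ A)
  · left
    have hd : subst φ A ∣ subst φ F := by
      refine dvd_of_forall_eval hsq fun a ha => ?_
      rw [eval_subst] at ha ⊢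
      exact h _ ha (by rw [eval_pull φ a hℓ, h1, map_zero])
    obtain ⟨c, hc⟩ := exists_smul_of_dvd (subst_quad h2 hA) (subst_quad h2 hF) hA0 hd
    refine ⟨c, b' - c • b, Submodule.sub_mem _ hb' (Submodule.smul_mem _ _ hb), ?_⟩
    have e1 : subst φ A = A - ℓ * b := by rw [← eA]; ring
    have e2 : F = ℓ * b' + subst φ F := by rw [← eF]; ring
    rw [e2, hc, e1, mul_sub, smul_sub, mul_smul_comm]; ring
  · right
    obtain ⟨g, q, k, l, hg, hq, hk, hkl, e⟩ :=
      exists_sq_mul_of_not_squarefree (subst_quad h2 hA) hA0 hsq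
    obtain rfl : k = 1 := by omega
    obtain rfl : l = 0 := by omega
    obtain ⟨c, hc⟩ := exists_sq_of_isHomogeneous_zero (g := g) hq
    refine ⟨b, hb, c • g, Submodule.smul_mem _ _ hg, ?_⟩
    rw [← hc, ← e, ← eA]; ring

theorem exists_good_point {A B : Poly n} (hA : A.IsHomogeneous 2) (hA' : Irreducible A)
    (hB : B.IsHomogeneous 2) (hAB : ¬ ∃ c : ℂ, B = c • A) :
    ∃ p : Fin n → ℂ, eval p A = 0 ∧ eval p B ≠ 0 ∧ der p A ≠ 0 := by
  by_contra! hcon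
  have hP : Prime A := UniqueFactorizationMonoid.irreducible_iff_prime.1 hA'
  have h1 : ∀ e, A ∣ B * der e A := fun e => by
    refine dvd_of_forall_eval hA'.squarefree fun p hp => ?_
    rw [map_mul]
    by_cases hB0 : eval p B = 0
    · rw [hB0, zero_mul]
    · rw [eval_der_comm hA, hcon p hp hB0, map_zero, mul_zero]
  by_cases hd : A ∣ B
  · exact hAB (exists_smul_of_dvd hA hB hA'.ne_zero hd)
  · refine hA'.ne_zero (quad_eq_zero_of_der hA fun e => ?_)
    obtain ⟨q, hq⟩ := (hP.dvd_or_dvd (h1 e)).resolve_left hd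
    by_contra h0
    have hq0 : q ≠ 0 := fun h => h0 (by rw [hq, h, mul_zero])
    have h2 := totalDegree_mul_of_isDomain hA'.ne_zero hq0
    rw [← hq, hA.totalDegree hA'.ne_zero, IsHomogeneous.totalDegree (der_quad e hA) h0] at h2
    omega

theorem exists_lin_eval_eq_one {p : Fin n → ℂ} (hp : p ≠ 0) : ∃ y ∈ Lin n, eval p y = 1 := by
  obtain ⟨i, hi⟩ := Function.ne_iff.1 hp
  refine ⟨(p i)⁻¹ • X i, Submodule.smul_mem _ _ (isHomogeneous_X ℂ i), ?_⟩
  rw [smul_eval, eval_X]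
  exact inv_mul_cancel₀ hi

theorem eval_add_smul_eq_of_der_eq_zero {f : Poly n} (hf : f.IsHomogeneous 2)
    {p : Fin n → ℂ} (h : der p f = 0) (q : Fin n → ℂ) (t : ℂ) :
    eval (q + t • p) f = eval q f := by
  have h1 := eval_der_self hf p
  rw [h, map_zero] at h1
  rw [eval_add_smul_quad hf, h, map_zero]
  linear_combination (-t ^ 2 / 2) * h1

theorem dvd_lin_lin {x u : Poly n} (hx : x ∈ Lin n) (h0 : x ≠ 0) (hu : u ∈ Lin n)
    (h : x ∣ u) : ∃ c : ℂ, u = c • x := exists_smul_of_dvd hx hu h0 h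

theorem not_dvd_of_irreducible {A x y a : Poly n} (hA' : Irreducible A) (hx : x ∈ Lin n)
    (hy : y ∈ Lin n) (ha : a.IsHomogeneous 2) (e : A = x * y - a) : ¬ x ∣ a := by
  intro h
  obtain ⟨b, hb, rfl⟩ := dvd_lin_quad hx ha h
  rw [← mul_sub] at e
  exact not_irreducible_mul_lin hx (Submodule.sub_mem _ hy hb) (e ▸ hA')

/-- The quadratics vanishing on the intersection of two irreducible quadrics, normalized at a
point of the first one. -/
theorem structure_of_irreducible_aux {A B F : Poly n} (hA : A.IsHomogeneous 2)
    (hA' : Irreducible A) (hB : B.IsHomogeneous 2) (hF : F.IsHomogeneous 2)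
    {p : Fin n → ℂ} (hpA : eval p A = 0) (hpB : eval p B = 1) (hx0 : der p A ≠ 0)
    (h : ∀ a, eval a A = 0 → eval a B = 0 → eval a F = 0) :
    (∃ c d : ℂ, F = c • A + d • B) ∨ (∃ c : ℂ, ∃ ℓ ∈ Lin n, B = c • A + ℓ ^ 2) ∨
      ∃ v ∈ Lin n, ∃ w ∈ Lin n, A ∈ Submodule.span ℂ {v, w} * Lin n ∧
        B ∈ Submodule.span ℂ {v, w} * Lin n := by
  have hp : p ≠ 0 := by
    rintro rfl
    have := eval_smul_quad hB 0 (0 : Fin n → ℂ)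
    rw [smul_zero, hpB] at this
    norm_num at this
  obtain ⟨y, hy, hpy⟩ := exists_lin_eval_eq_one hp
  set x := der p A with hxdef
  have hx : x ∈ Lin n := der_quad p hA
  have hpx : eval p x = 0 := by rw [hxdef, eval_der_self hA, hpA, mul_zero]
  obtain ⟨a, ha⟩ : ∃ a, a = x * y - A := ⟨_, rfl⟩
  have haq : a.IsHomogeneous 2 := ha ▸ (mul_quad hx hy).sub hA
  have eA : A = x * y - a := by rw [ha]; ring
  have hda : der p a = 0 := by
    rw [ha, map_sub, der_mul_lin p hx hy, hpy, hpx, ← hxdef]; simp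
  obtain ⟨u, hu⟩ : ∃ u, u = der p B - (2 : ℂ) • y := ⟨_, rfl⟩
  have huL : u ∈ Lin n := hu ▸ Submodule.sub_mem _ (der_quad p hB) (Submodule.smul_mem _ _ hy)
  have hpu : eval p u = 0 := by
    rw [hu, map_sub, eval_der_self hB, smul_eval, hpB, hpy]; ring
  obtain ⟨w, hw⟩ : ∃ w, w = B - y * y - u * y := ⟨_, rfl⟩
  have hwq : w.IsHomogeneous 2 := hw ▸ (hB.sub (mul_quad hy hy)).sub (mul_quad huL hy)
  have eB : B = y ^ 2 + u * y + w := by rw [hw]; ring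
  have hdw : der p w = 0 := by
    rw [hw, map_sub, map_sub, der_mul_lin p hy hy, der_mul_lin p huL hy, hpy, hpu, hu]
    simp only [two_smul, one_smul, zero_smul]; ring
  obtain ⟨G, hG⟩ : ∃ G, G = F - eval p F • B := ⟨_, rfl⟩
  have hGq : G.IsHomogeneous 2 := hG ▸ hF.sub (smul_quad _ hB)
  have hpG : eval p G = 0 := by rw [hG, map_sub, smul_eval, hpB]; ring
  obtain ⟨u', hu'⟩ : ∃ u', u' = der p G := ⟨_, rfl⟩
  have hu'L : u' ∈ Lin n := hu' ▸ der_quad p hGq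
  have hpu' : eval p u' = 0 := by rw [hu', eval_der_self hGq, hpG, mul_zero]
  obtain ⟨w', hw'⟩ : ∃ w', w' = G - u' * y := ⟨_, rfl⟩
  have hw'q : w'.IsHomogeneous 2 := hw' ▸ hGq.sub (mul_quad hu'L hy)
  have hdw' : der p w' = 0 := by
    rw [hw', map_sub, der_mul_lin p hu'L hy, hpy, hpu', ← hu']; simp
  have eG : G = u' * y + w' := by rw [hw']; ring
  obtain ⟨b, hb⟩ : ∃ b, b = a ^ 2 + x * u * a + x ^ 2 * w := ⟨_, rfl⟩
  obtain ⟨c, hc⟩ : ∃ c, c = u' * a + x * w' := ⟨_, rfl⟩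
  have hbq : b.IsHomogeneous 4 := by
    rw [hb]
    exact ((haq.pow 2).add ((mul_quad hx huL).mul haq)).add ((sq_quad hx).mul hwq)
  have hcq : c.IsHomogeneous 3 := by
    rw [hc]
    exact (IsHomogeneous.mul hu'L haq).add (IsHomogeneous.mul hx hw'q)
  have hxP : Prime x := prime_lin hx hx0
  have hxa : ¬ x ∣ a := not_dvd_of_irreducible hA' hx hy haq eA
  have hxb : ¬ x ∣ b := by
    rintro ⟨q, hq⟩
    apply hxa
    apply hxP.dvd_of_dvd_pow (n := 2)
    exact ⟨q - u * a - x * w, by linear_combination hq - hb⟩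
  have hb0 : b ≠ 0 := fun h0 => hxb (h0 ▸ dvd_zero x)
  have hvan : ∀ q, eval q b = 0 → eval q (x * c) = 0 := by
    intro q hq
    rw [map_mul]
    by_cases hxq : eval q x = 0
    · rw [hxq, zero_mul]
    obtain ⟨t, ht⟩ : ∃ t, t = eval q a / eval q x - eval q y := ⟨_, rfl⟩
    have hrx : eval (q + t • p) x = eval q x := by
      rw [eval_add_lin hx, eval_smul_lin hx, hpx]; ring
    have hry : eval (q + t • p) y = eval q a / eval q x := by
      rw [eval_add_lin hy, eval_smul_lin hy, hpy, ht]; ring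
    have hru : eval (q + t • p) u = eval q u := by
      rw [eval_add_lin huL, eval_smul_lin huL, hpu]; ring
    have hru' : eval (q + t • p) u' = eval q u' := by
      rw [eval_add_lin hu'L, eval_smul_lin hu'L, hpu']; ring
    have hra := eval_add_smul_eq_of_der_eq_zero haq hda q t
    have hrw := eval_add_smul_eq_of_der_eq_zero hwq hdw q t
    have hrw' := eval_add_smul_eq_of_der_eq_zero hw'q hdw' q t
    have hrA : eval (q + t • p) A = 0 := by
      rw [eA, map_sub, map_mul, hrx, hry, hra]; field_simp; ring
    have hrB : eval (q + t • p) B = 0 := by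
      rw [eB, map_add, map_add, map_pow, map_mul, hry, hru, hrw]
      rw [hb] at hq
      simp only [map_add, map_mul, map_pow] at hq
      field_simp
      linear_combination hq
    have hrG : eval (q + t • p) G = 0 := by
      rw [hG, map_sub, smul_eval, h _ hrA hrB, hrB]; ring
    rw [eG, map_add, map_mul, hru', hry, hrw'] at hrG
    rw [hc]
    simp only [map_add, map_mul]
    field_simp at hrG
    linear_combination eval q x * hrG
  by_cases hsq : Squarefree b
  · left
    obtain ⟨q, hq⟩ := dvd_of_forall_eval hsq hvan
    obtain ⟨q', rfl⟩ : x ∣ q := (hxP.dvd_or_dvd (hq ▸ dvd_mul_right x c)).resolve_left hxb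
    have hcb : c = b * q' := mul_left_cancel₀ hx0 (by rw [hq]; ring)
    have hc0 : c = 0 := by
      by_contra h0
      have hq0 : q' ≠ 0 := fun h => h0 (by rw [hcb, h, mul_zero])
      have h2 := totalDegree_mul_of_isDomain hb0 hq0
      rw [← hcb, hbq.totalDegree hb0, hcq.totalDegree h0] at h2
      omega
    have hd : x ∣ u' * a := ⟨-w', by linear_combination hc0 - hc⟩
    obtain ⟨κ, hκ⟩ := dvd_lin_lin hx hx0 hu'L ((hxP.dvd_or_dvd hd).resolve_right hxa)
    have hw'a : w' = - (κ • a) := mul_left_cancel₀ hx0 (by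
      rw [hc, hκ] at hc0
      rw [mul_neg, mul_smul_comm, ← smul_mul_assoc]
      linear_combination hc0)
    refine ⟨κ, eval p F, ?_⟩
    have e1 : F = G + eval p F • B := by rw [hG]; ring
    have e2 : G = κ • A := by rw [eG, hw'a, hκ, eA, smul_sub, smul_mul_assoc]; ring
    rw [← e2]
    exact e1
  · right
    obtain ⟨g, q, k, l, hg, hq, hk, hkl, e⟩ := exists_sq_mul_of_not_squarefree hbq hb0 hsq
    obtain rfl | rfl : k = 1 ∨ k = 2 := by omega
    · right
      obtain ⟨φ, h1, h2, h3⟩ := exists_kill g hg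
      have hbb : subst φ b = 0 := by rw [e, map_mul, map_pow, subst_lin φ hg, h1]; ring
      have hbe := hbb
      rw [hb] at hbe
      simp only [map_add, map_mul, map_pow] at hbe
      have hxL : subst φ x ∈ Lin n := by rw [subst_lin φ hx]; exact h2 x hx
      have hyL : subst φ y ∈ Lin n := by rw [subst_lin φ hy]; exact h2 y hy
      have huL' : subst φ u ∈ Lin n := by rw [subst_lin φ huL]; exact h2 u huL
      obtain ⟨b1, hb1, eA1⟩ := mem_lin_mul_iff.1 (sub_subst_mem h2 h3 hA)
      obtain ⟨b2, hb2, eB1⟩ := mem_lin_mul_iff.1 (sub_subst_mem h2 h3 hB)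
      have hxbar : subst φ x ≠ 0 := by
        intro h0
        rw [h0] at hbe
        have ha0 : subst φ a = 0 := by
          apply pow_eq_zero_iff two_ne_zero |>.1
          linear_combination hbe
        have : subst φ A = 0 := by rw [eA, map_sub, map_mul, h0, ha0]; ring
        rw [this, sub_zero] at eA1
        exact not_irreducible_mul_lin hg hb1 (eA1 ▸ hA')
      have hd : subst φ x ∣ subst φ a := (prime_lin hxL hxbar).dvd_of_dvd_pow (n := 2)
        ⟨- (subst φ u * subst φ a + subst φ x * subst φ w), by linear_combination hbe⟩
      obtain ⟨s, hs, es⟩ := dvd_lin_quad hxL (subst_quad h2 haq) hd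
      rw [es] at hbe
      have hbe' : s ^ 2 + subst φ u * s + subst φ w = 0 := by
        apply mul_left_cancel₀ (pow_ne_zero 2 hxbar)
        linear_combination hbe
      refine ⟨g, hg, subst φ y - s, Submodule.sub_mem _ hyL hs, ?_, ?_⟩
      · rw [mem_span_pair_mul_iff]
        refine ⟨b1, hb1, subst φ x, hxL, ?_⟩
        have : A = g * b1 + subst φ A := by rw [← eA1]; ring
        rw [this]
        congr 1
        rw [eA, map_sub, map_mul, es]; ring
      · rw [mem_span_pair_mul_iff]
        refine ⟨b2, hb2, subst φ y + s + subst φ u,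
          Submodule.add_mem _ (Submodule.add_mem _ hyL hs) huL', ?_⟩
        have : B = g * b2 + subst φ B := by rw [← eB1]; ring
        rw [this]
        congr 1
        rw [eB]
        simp only [map_add, map_mul, map_pow]
        linear_combination hbe'
    · left
      obtain rfl : l = 0 := by omega
      obtain ⟨κ, hκ⟩ := exists_sq_of_isHomogeneous_zero (g := g) hq
      have key : ∀ g : Poly n, g.IsHomogeneous 2 → b = g ^ 2 → x ∣ g - a →
          ∃ c : ℂ, ∃ ℓ ∈ Lin n, B = c • A + ℓ ^ 2 := by
        intro g hg e hd
        obtain ⟨r, hr, er⟩ := dvd_lin_quad hx (hg.sub haq) hd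
        have e1 : (u - (2 : ℂ) • r) * a = x * (r ^ 2 - w) := by
          apply mul_left_cancel₀ hx0
          have eg : g = a + x * r := by rw [← er]; ring
          rw [two_smul]
          rw [eg, hb] at e
          linear_combination e
        obtain ⟨μ, hμ⟩ := dvd_lin_lin hx hx0
          (Submodule.sub_mem _ huL (Submodule.smul_mem _ (2 : ℂ) hr))
          ((hxP.dvd_or_dvd ⟨_, e1⟩).resolve_right hxa)
        have e2 : μ • a = r ^ 2 - w := by
          apply mul_left_cancel₀ hx0
          rw [← e1, hμ]; simp
        refine ⟨μ, y + r, Submodule.add_mem _ hy hr, ?_⟩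
        have e3 : u = (r + r) + μ • x := by rw [← hμ, two_smul]; ring
        rw [eA, smul_sub, e2, eB, ← smul_mul_assoc, e3]; ring
      rw [hκ] at e
      have hprod : x ∣ (κ • g - a) * (κ • g + a) :=
        ⟨u * a + x * w, by linear_combination hb - e⟩
      rcases hxP.dvd_or_dvd hprod with hd | hd
      · exact key _ (smul_quad κ hg) e hd
      · refine key (-(κ • g)) (smul_quad κ hg).neg (by rw [e]; ring) ?_
        obtain ⟨q', hq'⟩ := hd
        exact ⟨-q', by linear_combination -hq'⟩

theorem structure_of_irreducible {A B F : Poly n} (hA : A.IsHomogeneous 2)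
    (hA' : Irreducible A) (hB : B.IsHomogeneous 2) (hF : F.IsHomogeneous 2)
    (hAB : ¬ ∃ c : ℂ, B = c • A)
    (h : ∀ a, eval a A = 0 → eval a B = 0 → eval a F = 0) :
    (∃ c d : ℂ, F = c • A + d • B) ∨ (∃ c : ℂ, ∃ ℓ ∈ Lin n, B = c • A + ℓ ^ 2) ∨
      ∃ v ∈ Lin n, ∃ w ∈ Lin n, A ∈ Submodule.span ℂ {v, w} * Lin n ∧
        B ∈ Submodule.span ℂ {v, w} * Lin n := by
  obtain ⟨p, h1, h2, h3⟩ := exists_good_point hA hA' hB hAB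
  set β := eval p B with hβ
  rcases structure_of_irreducible_aux hA hA' (smul_quad β⁻¹ hB) hF h1
    (by rw [smul_eval, ← hβ, inv_mul_cancel₀ h2]) h3 (fun a ha hb => h a ha (by
      rw [smul_eval] at hb
      exact (mul_eq_zero.1 hb).resolve_left (inv_ne_zero h2))) with ⟨c, d, e⟩ | ⟨c, ℓ, hℓ, e⟩ | h4
  · exact Or.inl ⟨c, d * β⁻¹, by rw [e, mul_smul]⟩
  · obtain ⟨s, hs⟩ := IsAlgClosed.exists_pow_nat_eq β (n := 2) two_pos
    refine Or.inr (Or.inl ⟨β * c, s • ℓ, Submodule.smul_mem _ _ hℓ, ?_⟩)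
    have : B = β • (β⁻¹ • B) := by rw [smul_smul, mul_inv_cancel₀ h2, one_smul]
    rw [this, e, smul_add, smul_pow, hs, mul_smul]
  · obtain ⟨v, hv, w, hw, h5, h6⟩ := h4
    refine Or.inr (Or.inr ⟨v, hv, w, hw, h5, ?_⟩)
    have : B = β • (β⁻¹ • B) := by rw [smul_smul, mul_inv_cancel₀ h2, one_smul]
    rw [this]
    exact Submodule.smul_mem _ _ h6

variable {ι : Type*}

theorem mul_mem_mono {A A' B B' : Submodule ℂ (Poly n)} (hA : A ≤ A') (hB : B ≤ B') {f : Poly n}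
    (hf : f ∈ A * B) : f ∈ A' * B' := by
  have : A * B ≤ A' * B' := mul_le_mul' hA hB
  exact this hf

/-- A Sylvester-Gallai configuration of quadratics. -/
structure IsConfig (Q : ι → Poly n) : Prop where
  quad : ∀ i, (Q i).IsHomogeneous 2
  irr_or_sq : ∀ i, Irreducible (Q i) ∨ ∃ ℓ ∈ Lin n, Q i = ℓ ^ 2
  indep : ∀ i j, i ≠ j → LinearIndependent ℂ ![Q i, Q j]
  third : ∀ i j, i ≠ j → ∃ k, k ≠ i ∧ k ≠ j ∧
    ∀ a, eval a (Q i) = 0 → eval a (Q j) = 0 → eval a (Q k) = 0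

namespace IsConfig
variable {Q : ι → Poly n}

theorem ne_smul (hQ : IsConfig Q) {i j : ι} (h : i ≠ j) (c : ℂ) : Q j ≠ c • Q i :=
  fun e => smul_ne_of_linearIndependent_pair (hQ.indep j i h.symm) c e.symm

theorem ne_zero (hQ : IsConfig Q) {i j : ι} (h : i ≠ j) : Q j ≠ 0 := fun e =>
  hQ.ne_smul h 0 (by rw [e, zero_smul])

/-- Two squares of the configuration divisible by the same linear form coincide. -/
theorem eq_of_dvd (hQ : IsConfig Q) {i j : ι} {ℓ ℓ' : Poly n} (hℓ : ℓ ∈ Lin n) (hℓ' : ℓ' ∈ Lin n)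
    (hi : Q i = ℓ ^ 2) (hj : Q j = ℓ' ^ 2) (h : ℓ ∣ ℓ') (h0 : ℓ ≠ 0) : i = j := by
  by_contra hij
  obtain ⟨c, rfl⟩ := dvd_lin_lin hℓ h0 hℓ' h
  exact hQ.ne_smul hij (c ^ 2) (by rw [hi, hj, smul_pow])

theorem ne_mul_of_sq (hQ : IsConfig Q) {j k : ι} (hkj : k ≠ j) {ℓ b : Poly n} (hℓ : ℓ ∈ Lin n)
    (hb : b ∈ Lin n) (hj : Q j = ℓ ^ 2) : Q k ≠ ℓ * b := by
  intro e
  have h0 : ℓ ≠ 0 := by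
    rintro rfl
    exact hQ.ne_zero hkj (by rw [hj]; ring)
  rcases hQ.irr_or_sq k with h | ⟨x, hx, ex⟩
  · exact not_irreducible_mul_lin hℓ hb (e ▸ h)
  · have : ℓ ∣ x := (prime_lin hℓ h0).dvd_of_dvd_pow (n := 2) ⟨b, by rw [← ex, e]⟩
    exact hkj (hQ.eq_of_dvd hℓ hx hj ex this h0).symm

/-- The possible shapes of a third quadric through the intersection of two quadrics. -/
theorem edge_cases (hQ : IsConfig Q) {i j k : ι} (hi : Irreducible (Q i)) (hij : i ≠ j)
    (hki : k ≠ i) (hkj : k ≠ j)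
    (h : ∀ a, eval a (Q i) = 0 → eval a (Q j) = 0 → eval a (Q k) = 0) :
    (Irreducible (Q j) ∧
      ((∃ a b : ℂ, a ≠ 0 ∧ b ≠ 0 ∧ Q k = a • Q i + b • Q j) ∨
        (∃ c : ℂ, c ≠ 0 ∧ ∃ ℓ ∈ Lin n, Q j = c • Q i + ℓ ^ 2) ∨
        ∃ v ∈ Lin n, ∃ w ∈ Lin n, Q i ∈ Submodule.span ℂ {v, w} * Lin n ∧
          Q j ∈ Submodule.span ℂ {v, w} * Lin n)) ∨
    ∃ ℓ ∈ Lin n, ℓ ≠ 0 ∧ Q j = ℓ ^ 2 ∧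
      ((∃ c : ℂ, c ≠ 0 ∧ ∃ b ∈ Lin n, b ≠ 0 ∧ Q k = c • Q i + ℓ * b) ∨
        ∃ b ∈ Lin n, ∃ v ∈ Lin n, Q i = ℓ * b + v ^ 2) := by
  rcases hQ.irr_or_sq j with hj | ⟨ℓ, hℓ, ej⟩
  · left
    refine ⟨hj, ?_⟩
    rcases structure_of_irreducible (hQ.quad i) hi (hQ.quad j) (hQ.quad k)
      (fun ⟨c, hc⟩ => hQ.ne_smul hij c hc) h with ⟨a, b, e⟩ | ⟨c, ℓ, hℓ, e⟩ | h3
    · left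
      refine ⟨a, b, ?_, ?_, e⟩
      · rintro rfl; exact hQ.ne_smul hkj.symm b (by rw [e, zero_smul, zero_add])
      · rintro rfl; exact hQ.ne_smul hki.symm a (by rw [e, zero_smul, add_zero])
    · right; left
      refine ⟨c, ?_, ℓ, hℓ, e⟩
      rintro rfl
      rw [zero_smul, zero_add] at e
      exact not_irreducible_sq hℓ (e ▸ hj)
    · right; right; exact h3
  · right
    have h0 : ℓ ≠ 0 := by
      rintro rfl
      exact hQ.ne_zero hkj (by rw [ej]; ring)
    refine ⟨ℓ, hℓ, h0, ej, ?_⟩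
    rcases structure_of_linear (hQ.quad i) hi hℓ (hQ.quad k)
      (fun a h1 h2 => h a h1 (by rw [ej, map_pow, h2]; ring)) with ⟨c, b, hb, e⟩ | h2
    · left
      refine ⟨c, ?_, b, hb, ?_, e⟩
      · rintro rfl
        exact hQ.ne_mul_of_sq hkj hℓ hb ej (by rw [e, zero_smul, zero_add])
      · rintro rfl
        exact hQ.ne_smul hki.symm c (by rw [e, mul_zero, add_zero])
    · right; exact h2

/-- A nonzero quadratic is divisible by at most two of the linear forms whose squares belong
to the configuration. -/
theorem card_le_two_of_dvd (hQ : IsConfig Q) {J : Finset ι} {g : Poly n} (hg : g.IsHomogeneous 2)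
    (h0 : g ≠ 0)
    (h : ∀ j ∈ J, ∃ ℓ ∈ Lin n, ℓ ≠ 0 ∧ Q j = ℓ ^ 2 ∧ ℓ ∣ g) : J.card ≤ 2 := by
  by_contra! hJ
  obtain ⟨a, b, c, ha, hb, hc, hab, hac, hbc⟩ := Finset.two_lt_card_iff.1 hJ
  obtain ⟨x, hx, hx0, ex, dx⟩ := h a ha
  obtain ⟨y, hy, hy0, ey, dy⟩ := h b hb
  obtain ⟨z, hz, hz0, ez, dz⟩ := h c hc
  have key : ∀ u v : Poly n, u ∈ Lin n → v ∈ Lin n → u ≠ 0 → v ≠ 0 → v ∣ u → u ∣ v := by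
    intro u v hu hv hu0 hv0 hd
    obtain ⟨r, hr⟩ := dvd_lin_lin hv hv0 hu hd
    have hr0 : r ≠ 0 := fun h => hu0 (by rw [hr, h, zero_smul])
    exact ⟨C r⁻¹, by rw [hr, mul_comm, C_mul', smul_smul, inv_mul_cancel₀ hr0, one_smul]⟩
  obtain ⟨u, hu, rfl⟩ := dvd_lin_quad hx hg dx
  have hu0 : u ≠ 0 := right_ne_zero_of_mul h0
  rcases (prime_lin hy hy0).dvd_or_dvd dy with h1 | h1
  · exact hab (hQ.eq_of_dvd hx hy ex ey (key _ _ hx hy hx0 hy0 h1) hx0)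
  rcases (prime_lin hz hz0).dvd_or_dvd dz with h2 | h2
  · exact hac (hQ.eq_of_dvd hx hz ex ez (key _ _ hx hz hx0 hz0 h2) hx0)
  · exact hbc (hQ.eq_of_dvd hy hz ey ez (h1.trans (key _ _ hu hz hu0 hz0 h2)) hy0)

end IsConfig

/-- The quadratic `f` lies in the ideal generated by `t` linear forms. -/
def LowRank (t : ℕ) (f : Poly n) : Prop :=
  ∃ X : Submodule ℂ (Poly n), X ≤ Lin n ∧ Module.finrank ℂ X ≤ t ∧ f ∈ X * Lin n

namespace LowRank
variable {s t : ℕ} {f g : Poly n}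

theorem mono (h : s ≤ t) (hf : LowRank s f) : LowRank t f := by
  obtain ⟨X, h1, h2, h3⟩ := hf
  exact ⟨X, h1, h2.trans h, h3⟩

theorem add (hf : LowRank s f) (hg : LowRank t g) : LowRank (s + t) (f + g) := by
  obtain ⟨X, h1, h2, h3⟩ := hf
  obtain ⟨Y, h1', h2', h3'⟩ := hg
  have := finiteDimensional_of_le h1
  have := finiteDimensional_of_le h1'
  refine ⟨X ⊔ Y, sup_le h1 h1', (Submodule.finrank_add_le_finrank_add_finrank X Y).trans
    (by omega), Submodule.add_mem _ ?_ ?_⟩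
  · exact mul_mem_mono le_sup_left le_rfl h3
  · exact mul_mem_mono le_sup_right le_rfl h3'

theorem smul (c : ℂ) (hf : LowRank s f) : LowRank s (c • f) := by
  obtain ⟨X, h1, h2, h3⟩ := hf
  exact ⟨X, h1, h2, Submodule.smul_mem _ c h3⟩

theorem mul {a b : Poly n} (ha : a ∈ Lin n) (hb : b ∈ Lin n) : LowRank 1 (a * b) := by
  refine ⟨Submodule.span ℂ {a}, by rwa [Submodule.span_singleton_le_iff_mem],
    (finrank_span_le_card {a}).trans (by simp),
    Submodule.mul_mem_mul (Submodule.mem_span_singleton_self a) hb⟩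

theorem sq {a : Poly n} (ha : a ∈ Lin n) : LowRank 1 (a ^ 2) := by
  rw [pow_two]; exact mul ha ha

theorem of_pair {v w : Poly n} (hv : v ∈ Lin n) (hw : w ∈ Lin n)
    (hf : f ∈ Submodule.span ℂ {v, w} * Lin n) : LowRank 2 f := by
  obtain ⟨a, ha, b, hb, rfl⟩ := mem_span_pair_mul_iff.1 hf
  exact (mul hv ha).add (mul hw hb)

theorem zero : LowRank 0 (0 : Poly n) := ⟨⊥, bot_le, by simp, by simp⟩

end LowRank

/-- The quadratic `f` has low rank modulo a space of quadratics. -/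
def LowMod (𝒬 : Submodule ℂ (Poly n)) (t : ℕ) (f : Poly n) : Prop :=
  ∃ q ∈ 𝒬, LowRank t (f - q)

namespace LowMod
variable {𝒬 𝒬' : Submodule ℂ (Poly n)} {s t : ℕ} {f g : Poly n}

theorem mono (h : 𝒬 ≤ 𝒬') (hst : s ≤ t) (hf : LowMod 𝒬 s f) : LowMod 𝒬' t f := by
  obtain ⟨q, hq, h1⟩ := hf
  exact ⟨q, h hq, h1.mono hst⟩

theorem add (hf : LowMod 𝒬 s f) (hg : LowMod 𝒬 t g) : LowMod 𝒬 (s + t) (f + g) := by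
  obtain ⟨q, hq, h1⟩ := hf
  obtain ⟨q', hq', h1'⟩ := hg
  refine ⟨q + q', 𝒬.add_mem hq hq', ?_⟩
  rw [add_sub_add_comm]
  exact h1.add h1'

theorem smul (c : ℂ) (hf : LowMod 𝒬 s f) : LowMod 𝒬 s (c • f) := by
  obtain ⟨q, hq, h1⟩ := hf
  exact ⟨c • q, 𝒬.smul_mem c hq, by rw [← smul_sub]; exact h1.smul c⟩

theorem of_smul {c : ℂ} (hc : c ≠ 0) (hf : LowMod 𝒬 s (c • f)) : LowMod 𝒬 s f := by
  have := hf.smul c⁻¹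
  rwa [smul_smul, inv_mul_cancel₀ hc, one_smul] at this

theorem sub (hf : LowMod 𝒬 s f) (hg : LowMod 𝒬 t g) : LowMod 𝒬 (s + t) (f - g) := by
  have := hf.add (hg.smul (-1))
  rwa [neg_one_smul, ← sub_eq_add_neg] at this

theorem of_lowRank (hf : LowRank s f) : LowMod 𝒬 s f := ⟨0, 𝒬.zero_mem, by rwa [sub_zero]⟩

theorem of_mem (hf : f ∈ 𝒬) : LowMod 𝒬 s f :=
  ⟨f, hf, by rw [sub_self]; exact LowRank.zero.mono (Nat.zero_le _)⟩

end LowMod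

/-- A potential argument: a process whose steps decrease a potential by a fixed amount
reaches a stable state of controlled size. -/
theorem exists_stable {α : Type*} (Inv Stable : α → Prop) (d Ψ : α → ℕ) (g : ℕ → ℕ)
    (hg : Monotone g) (hg' : ∀ r, r ≤ g r) {m : ℕ} (hm : 0 < m)
    (step : ∀ x, Inv x → ¬ Stable x → ∃ x', Inv x' ∧ d x' ≤ g (d x) ∧ Ψ x' + m ≤ Ψ x)
    (K : ℕ) : ∀ x, Inv x → Ψ x ≤ K * m → ∃ y, Inv y ∧ Stable y ∧ d y ≤ g^[K] (d x) := by
  induction K with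
  | zero =>
    intro x hx h
    refine ⟨x, hx, ?_, le_rfl⟩
    by_contra hs
    obtain ⟨y, -, -, h3⟩ := step x hx hs
    omega
  | succ K ih =>
    intro x hx h
    by_cases hs : Stable x
    · refine ⟨x, hx, hs, ?_⟩
      exact Function.id_le_iterate_of_id_le hg' (K + 1) (d x)
    · obtain ⟨y, hy, h2, h3⟩ := step x hx hs
      obtain ⟨z, hz, hzs, h4⟩ := ih y hy (by rw [add_mul, one_mul] at h; omega)
      refine ⟨z, hz, hzs, h4.trans ?_⟩
      rw [Function.iterate_succ_apply]
      exact hg.iterate K h2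

instance finiteDimensional_quad : FiniteDimensional ℂ ↥(Lin n * Lin n) := by
  have h : (Lin n).FG := (Submodule.fg_top _).1 (Module.finite_def.1 inferInstance)
  exact (Submodule.fg_top _).1 ((Submodule.fg_top _).2 (h.mul h)) |> Module.Finite.of_fg

theorem finiteDimensional_of_le_quad {𝒬 : Submodule ℂ (Poly n)} (h : 𝒬 ≤ Lin n * Lin n) :
    FiniteDimensional ℂ 𝒬 := Submodule.finiteDimensional_of_le h

namespace IsConfig
variable {Q : ι → Poly n}

theorem exists_third (hQ : IsConfig Q) (i : ι) : ∃ κ : ι → ι, ∀ j, i ≠ j → κ j ≠ i ∧ κ j ≠ j ∧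
    ∀ a, eval a (Q i) = 0 → eval a (Q j) = 0 → eval a (Q (κ j)) = 0 := by
  have : ∀ j, ∃ k, i ≠ j → k ≠ i ∧ k ≠ j ∧
    ∀ a, eval a (Q i) = 0 → eval a (Q j) = 0 → eval a (Q k) = 0 := fun j => by
    by_cases h : i = j
    · exact ⟨i, fun h' => absurd h h'⟩
    · obtain ⟨k, hk⟩ := hQ.third i j h
      exact ⟨k, fun _ => hk⟩
  choose κ hκ using this
  exact ⟨κ, hκ⟩

theorem irreducible_of_not_lowMod (hQ : IsConfig Q) {𝒬 : Submodule ℂ (Poly n)} {t : ℕ}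
    (ht : 1 ≤ t) {i : ι} (h : ¬ LowMod 𝒬 t (Q i)) : Irreducible (Q i) := by
  rcases hQ.irr_or_sq i with h1 | ⟨ℓ, hℓ, e⟩
  · exact h1
  · exact absurd (LowMod.of_lowRank (e ▸ (LowRank.sq hℓ).mono ht)) h

/-- Seen from a quadric of high rank, third points are of one of three simple shapes. -/
theorem edge_cases_of_not_lowMod (hQ : IsConfig Q) {𝒬 : Submodule ℂ (Poly n)} {t : ℕ}
    (ht : 2 ≤ t) {i j k : ι} (h : ¬ LowMod 𝒬 t (Q i)) (hij : i ≠ j) (hki : k ≠ i) (hkj : k ≠ j)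
    (hk : ∀ a, eval a (Q i) = 0 → eval a (Q j) = 0 → eval a (Q k) = 0) :
    (Irreducible (Q j) ∧ ∃ a b : ℂ, a ≠ 0 ∧ b ≠ 0 ∧ Q k = a • Q i + b • Q j) ∨
    (Irreducible (Q j) ∧ ∃ c : ℂ, c ≠ 0 ∧ ∃ ℓ ∈ Lin n, Q j = c • Q i + ℓ ^ 2) ∨
    ∃ ℓ ∈ Lin n, ℓ ≠ 0 ∧ Q j = ℓ ^ 2 ∧
      ∃ c : ℂ, c ≠ 0 ∧ ∃ b ∈ Lin n, b ≠ 0 ∧ Q k = c • Q i + ℓ * b := by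
  have hi := hQ.irreducible_of_not_lowMod (by omega) h
  rcases hQ.edge_cases hi hij hki hkj hk with
    ⟨hj, h1 | h2 | ⟨v, hv, w, hw, h3, -⟩⟩ | ⟨ℓ, hℓ, h0, e, h4 | ⟨b, hb, v, hv, h5⟩⟩
  · exact .inl ⟨hj, h1⟩
  · exact .inr (.inl ⟨hj, h2⟩)
  · exact absurd (LowMod.of_lowRank ((LowRank.of_pair hv hw h3).mono ht)) h
  · exact .inr (.inr ⟨ℓ, hℓ, h0, e, h4⟩)
  · refine absurd (LowMod.of_lowRank (LowRank.mono ht ?_)) h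
    rw [h5]
    exact (LowRank.mul hℓ hb).add (LowRank.sq hv)

end IsConfig

section
variable [Fintype ι] {Q : ι → Poly n}

open Classical in
/-- The members of the family which have high rank modulo `𝒬`. -/
noncomputable def highSet (Q : ι → Poly n) (𝒬 : Submodule ℂ (Poly n)) (t : ℕ) : Finset ι :=
  Finset.univ.filter fun k => ¬ LowMod 𝒬 t (Q k)

open Classical in
/-- The members of high rank which are close to a multiple of `Q i`. -/
noncomputable def nearSet (Q : ι → Poly n) (𝒬 : Submodule ℂ (Poly n)) (t : ℕ) (i : ι) :
    Finset ι :=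
  Finset.univ.filter fun k => ¬ LowMod 𝒬 t (Q k) ∧ ∃ c : ℂ, c ≠ 0 ∧ LowMod 𝒬 t (Q k - c • Q i)

theorem mem_highSet {𝒬 : Submodule ℂ (Poly n)} {t : ℕ} {k : ι} :
    k ∈ highSet Q 𝒬 t ↔ ¬ LowMod 𝒬 t (Q k) := by simp [highSet]

theorem mem_nearSet {𝒬 : Submodule ℂ (Poly n)} {t : ℕ} {i k : ι} : k ∈ nearSet Q 𝒬 t i ↔
    ¬ LowMod 𝒬 t (Q k) ∧ ∃ c : ℂ, c ≠ 0 ∧ LowMod 𝒬 t (Q k - c • Q i) := by simp [nearSet]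

theorem highSet_anti {𝒬 𝒬' : Submodule ℂ (Poly n)} {s t : ℕ} (h : 𝒬 ≤ 𝒬') (hst : s ≤ t) :
    highSet Q 𝒬' t ⊆ highSet Q 𝒬 s := fun k hk => by
  rw [mem_highSet] at *
  exact fun h1 => hk (h1.mono h hst)

namespace IsConfig

open Classical in
theorem card_compl_highSet_le (hQ : IsConfig Q) {𝒬 : Submodule ℂ (Poly n)} {t t' : ℕ}
    (ht : 2 ≤ t) (htt : 2 * t ≤ t') {i : ι} (hi : ¬ LowMod 𝒬 t' (Q i)) :
    (highSet Q 𝒬 t)ᶜ.card ≤ 3 * (nearSet Q 𝒬 t i).card := by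
  obtain ⟨κ, hκ⟩ := hQ.exists_third i
  have hit : ∀ s, s ≤ t' → ¬ LowMod 𝒬 s (Q i) := fun s hs h => hi (h.mono le_rfl hs)
  have hmem : ∀ j ∈ (highSet Q 𝒬 t)ᶜ, LowMod 𝒬 t (Q j) ∧ i ≠ j := by
    intro j hj
    rw [Finset.mem_compl, mem_highSet, not_not] at hj
    exact ⟨hj, by rintro rfl; exact hit t (by omega) hj⟩
  have hcases := fun j (hj : i ≠ j) =>
    hQ.edge_cases_of_not_lowMod ht (hit t (by omega)) hj (hκ j hj).1 (hκ j hj).2.1 (hκ j hj).2.2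
  have hlin : ∀ j ∈ (highSet Q 𝒬 t)ᶜ, Irreducible (Q j) →
      ∃ a b : ℂ, a ≠ 0 ∧ b ≠ 0 ∧ Q (κ j) = a • Q i + b • Q j := by
    intro j hj hirr
    obtain ⟨hj1, hj2⟩ := hmem j hj
    rcases hcases j hj2 with ⟨-, h⟩ | ⟨-, c, hc, ℓ, hℓ, e⟩ | ⟨ℓ, hℓ, -, e, -⟩
    · exact h
    · exfalso
      refine hit (t + 1) (by omega) (LowMod.of_smul hc ?_)
      have := hj1.sub (LowMod.of_lowRank (𝒬 := 𝒬) (LowRank.sq hℓ))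
      rwa [e, add_sub_cancel_right] at this
    · exact absurd (e ▸ hirr) (not_irreducible_sq hℓ)
  have hsq : ∀ j ∈ (highSet Q 𝒬 t)ᶜ, ¬ Irreducible (Q j) → ∃ ℓ ∈ Lin n, ℓ ≠ 0 ∧ Q j = ℓ ^ 2 ∧
      ∃ c : ℂ, c ≠ 0 ∧ ∃ b ∈ Lin n, b ≠ 0 ∧ Q (κ j) = c • Q i + ℓ * b := by
    intro j hj hirr
    rcases hcases j (hmem j hj).2 with ⟨h, -⟩ | ⟨h, -⟩ | h
    · exact absurd h hirr
    · exact absurd h hirr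
    · exact h
  have h1 : ((highSet Q 𝒬 t)ᶜ.filter fun j => Irreducible (Q j)).card ≤
      (nearSet Q 𝒬 t i).card := by
    refine Finset.card_le_card_of_injOn κ (fun j hj => ?_) fun j hj j' hj' he => ?_
    · rw [Finset.mem_coe, Finset.mem_filter] at hj
      obtain ⟨a, b, ha, hb, e⟩ := hlin j hj.1 hj.2
      have hjl := (hmem j hj.1).1
      rw [Finset.mem_coe, mem_nearSet]
      refine ⟨fun h => ?_, a, ha, ?_⟩
      · refine hit (t + t) (by omega) (LowMod.of_smul ha ?_)
        have := h.sub (hjl.smul b)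
        rwa [e, add_sub_cancel_right] at this
      · rw [e, add_sub_cancel_left]; exact hjl.smul b
    · rw [Finset.mem_coe, Finset.mem_filter] at hj hj'
      obtain ⟨a, b, ha, hb, e⟩ := hlin j hj.1 hj.2
      obtain ⟨a', b', ha', hb', e'⟩ := hlin j' hj'.1 hj'.2
      by_contra hne
      have e2 : (a - a') • Q i = b' • Q j' - b • Q j := by
        rw [he, e'] at e
        rw [sub_smul, sub_eq_sub_iff_add_eq_add, ← e, add_comm]
      by_cases haa : a - a' = 0
      · rw [haa, zero_smul, eq_comm, sub_eq_zero] at e2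
        refine hQ.ne_smul hne (b'⁻¹ * b) ?_
        rw [mul_smul, ← e2, smul_smul, inv_mul_cancel₀ hb', one_smul]
      · refine hit (t + t) (by omega) (LowMod.of_smul haa ?_)
        rw [e2]
        exact ((hmem j' hj'.1).1.smul b').sub ((hmem j hj.1).1.smul b)
  have h2 : ((highSet Q 𝒬 t)ᶜ.filter fun j => ¬ Irreducible (Q j)).card ≤
      2 * (nearSet Q 𝒬 t i).card := by
    refine Finset.card_le_mul_card_image_of_maps_to (f := κ) (fun j hj => ?_) 2 fun k hk => ?_
    · rw [Finset.mem_filter] at hj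
      obtain ⟨ℓ, hℓ, h0, -, c, hc, b, hb, -, e⟩ := hsq j hj.1 hj.2
      rw [mem_nearSet]
      have hlow := LowMod.of_lowRank (𝒬 := 𝒬) ((LowRank.mul hℓ hb).mono (show 1 ≤ t by omega))
      refine ⟨fun h => ?_, c, hc, ?_⟩
      · refine hit (t + t) (by omega) (LowMod.of_smul hc ?_)
        have := h.sub hlow
        rwa [e, add_sub_cancel_right] at this
      · rw [e, add_sub_cancel_left]; exact hlow
    · rcases Finset.eq_empty_or_nonempty
        {j ∈ {j ∈ (highSet Q 𝒬 t)ᶜ | ¬ Irreducible (Q j)} | κ j = k} with h | ⟨j₀, hj₀⟩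
      · rw [h]; simp
      rw [Finset.mem_filter, Finset.mem_filter] at hj₀
      obtain ⟨ℓ₀, hℓ₀, h₀, -, c₀, -, b₀, hb₀, hb0, e₀⟩ := hsq j₀ hj₀.1.1 hj₀.1.2
      rw [hj₀.2] at e₀
      refine hQ.card_le_two_of_dvd (g := ℓ₀ * b₀) (mul_quad hℓ₀ hb₀) (mul_ne_zero h₀ hb0)
        fun j hj => ?_
      rw [Finset.mem_filter, Finset.mem_filter] at hj
      obtain ⟨ℓ, hℓ, h0, ej, c, -, b, hb, -, e⟩ := hsq j hj.1.1 hj.1.2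
      rw [hj.2] at e
      refine ⟨ℓ, hℓ, h0, ej, b, ?_⟩
      have e2 : (c - c₀) • Q i = ℓ₀ * b₀ - ℓ * b := by
        rw [sub_smul, sub_eq_sub_iff_add_eq_add, ← e, e₀, add_comm]
      by_cases hcc : c - c₀ = 0
      · rw [hcc, zero_smul, eq_comm, sub_eq_zero] at e2
        exact e2
      · exfalso
        refine hit (1 + 1) (by omega) (LowMod.of_smul hcc ?_)
        rw [e2]
        exact (LowMod.of_lowRank (LowRank.mul hℓ₀ hb₀)).sub
          (LowMod.of_lowRank (LowRank.mul hℓ hb))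
  have h3 := Finset.card_filter_add_card_filter_not (s := (highSet Q 𝒬 t)ᶜ)
    (fun j => Irreducible (Q j))
  omega

open Classical in
theorem card_highSet_le (hQ : IsConfig Q) {𝒬 : Submodule ℂ (Poly n)} {t t' : ℕ}
    (ht : 2 ≤ t) (htt : 2 * t ≤ t') {i : ι} (hi : i ∈ highSet Q 𝒬 t') :
    (highSet Q 𝒬 t').card ≤ 1 + (nearSet Q 𝒬 t i).card + (highSet Q 𝒬 t')ᶜ.card +
      ((highSet Q 𝒬 t').filter fun j => j ≠ i ∧ ∃ k ∈ highSet Q 𝒬 t', k ≠ i ∧ k ≠ j ∧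
        Q k ∈ Submodule.span ℂ {Q i, Q j}).card := by
  obtain ⟨κ, hκ⟩ := hQ.exists_third i
  rw [mem_highSet] at hi
  set N := highSet Q 𝒬 t' with hN
  set good := N.filter fun j => j ≠ i ∧ ∃ k ∈ N, k ≠ i ∧ k ≠ j ∧
        Q k ∈ Submodule.span ℂ {Q i, Q j} with hgood
  set rest := ((N.erase i) \ good) \ nearSet Q 𝒬 t i with hrest
  have hr : ∀ j ∈ rest, i ≠ j ∧ j ∈ N ∧ (∀ k ∈ N, k ≠ i → k ≠ j →
      Q k ∉ Submodule.span ℂ {Q i, Q j}) ∧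
      ∃ a b : ℂ, a ≠ 0 ∧ b ≠ 0 ∧ Q (κ j) = a • Q i + b • Q j := by
    intro j hj
    simp only [hrest, hgood, Finset.mem_sdiff, Finset.mem_erase, Finset.mem_filter] at hj
    obtain ⟨⟨⟨h1, h2⟩, h3⟩, h4⟩ := hj
    have hij : i ≠ j := h1.symm
    refine ⟨hij, h2, fun k hk hki hkj h => h3 ⟨h2, h1, k, hk, hki, hkj, h⟩, ?_⟩
    have hjt : ¬ LowMod 𝒬 t' (Q j) := mem_highSet.1 h2
    rcases hQ.edge_cases_of_not_lowMod (by omega) hi hij (hκ j hij).1 (hκ j hij).2.1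
      (hκ j hij).2.2 with ⟨-, h⟩ | ⟨-, c, hc, ℓ, hℓ, e⟩ | ⟨ℓ, hℓ, -, e, -⟩
    · exact h
    · exfalso
      apply h4
      rw [mem_nearSet]
      refine ⟨fun h => hjt (h.mono le_rfl (by omega)), c, hc, ?_⟩
      rw [e, add_sub_cancel_left]
      exact LowMod.of_lowRank ((LowRank.sq hℓ).mono (by omega))
    · exact absurd (e ▸ hQ.irreducible_of_not_lowMod (by omega) hjt) (not_irreducible_sq hℓ)
  have hspan : ∀ j ∈ rest, Q (κ j) ∈ Submodule.span ℂ {Q i, Q j} := fun j hj => by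
    obtain ⟨-, -, -, a, b, -, -, e⟩ := hr j hj
    exact Submodule.mem_span_pair.2 ⟨a, b, e.symm⟩
  have hcard : rest.card ≤ Nᶜ.card := by
    refine Finset.card_le_card_of_injOn κ (fun j hj => ?_) fun j hj j' hj' he => ?_
    · have hj := Finset.mem_coe.1 hj
      obtain ⟨h1, h2, h3, -⟩ := hr j hj
      rw [Finset.mem_coe, Finset.mem_compl]
      exact fun h => h3 _ h (hκ j h1).1 (hκ j h1).2.1 (hspan j hj)
    · have hj := Finset.mem_coe.1 hj
      have hj' := Finset.mem_coe.1 hj'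
      by_contra hne
      obtain ⟨h1, h2, h3, -⟩ := hr j hj
      obtain ⟨h1', h2', -, a, b, ha, hb, e⟩ := hr j' hj'
      refine h3 j' h2' h1'.symm (Ne.symm hne) ?_
      have : Q j' = b⁻¹ • (Q (κ j) - a • Q i) := by
        rw [he, e, add_sub_cancel_left, smul_smul, inv_mul_cancel₀ hb, one_smul]
      rw [this]
      exact Submodule.smul_mem _ _ (Submodule.sub_mem _ (hspan j hj)
        (Submodule.smul_mem _ _ (Submodule.subset_span (by simp))))
  have h1 : N ⊆ insert i (good ∪ nearSet Q 𝒬 t i ∪ rest) := fun j hj => by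
    simp only [hrest, Finset.mem_insert, Finset.mem_union, Finset.mem_sdiff, Finset.mem_erase]
    tauto
  have h2 := (Finset.card_le_card h1).trans (Finset.card_insert_le _ _)
  have h3 := Finset.card_union_le (good ∪ nearSet Q 𝒬 t i) rest
  have h4 := Finset.card_union_le good (nearSet Q 𝒬 t i)
  omega

end IsConfig
end

theorem finrank_sup_span_singleton_le {E : Type*} [AddCommGroup E] [Module ℂ E]
    (V : Submodule ℂ E) [FiniteDimensional ℂ V] (x : E) :
    Module.finrank ℂ ↥(V ⊔ Submodule.span ℂ {x}) ≤ Module.finrank ℂ V + 1 :=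
  (Submodule.finrank_add_le_finrank_add_finrank _ _).trans
    (Nat.add_le_add_left ((finrank_span_le_card {x}).trans (by simp)) _)

section
variable [Fintype ι] {Q : ι → Poly n}

/-- In a suitable sense the family has almost no members of intermediate rank. -/
theorem IsConfig.exists_stable_space (hQ : IsConfig Q) (hm : 0 < Fintype.card ι) :
    ∃ 𝒬 ≤ Lin n * Lin n, Module.finrank ℂ 𝒬 ≤ 1640 ∧
      ∀ i, ∀ s < 41, 40 * (nearSet Q 𝒬 (2 ^ (s + 1)) i).card ≤ Fintype.card ι := by
  classical
  set Ψ : Submodule ℂ (Poly n) → ℕ := fun 𝒬 =>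
    40 * ∑ s ∈ Finset.range 41, (highSet Q 𝒬 (2 ^ (s + 1))).card with hΨ
  have hstep : ∀ 𝒬 : Submodule ℂ (Poly n), 𝒬 ≤ Lin n * Lin n →
      (¬ ∀ i, ∀ s < 41, 40 * (nearSet Q 𝒬 (2 ^ (s + 1)) i).card ≤ Fintype.card ι) →
      ∃ 𝒬' : Submodule ℂ (Poly n), 𝒬' ≤ Lin n * Lin n ∧
        Module.finrank ℂ 𝒬' ≤ Module.finrank ℂ 𝒬 + 1 ∧ Ψ 𝒬' + Fintype.card ι ≤ Ψ 𝒬 := by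
    intro 𝒬 h𝒬 hs
    simp only [not_forall, not_le] at hs
    obtain ⟨i, s₀, hs₀, hlt⟩ := hs
    have := finiteDimensional_of_le_quad h𝒬
    refine ⟨𝒬 ⊔ Submodule.span ℂ {Q i}, sup_le h𝒬 ?_, finrank_sup_span_singleton_le 𝒬 (Q i), ?_⟩
    · rw [Submodule.span_singleton_le_iff_mem]; exact quad_iff.1 (hQ.quad i)
    have key : ∀ s ∈ Finset.range 41, (highSet Q (𝒬 ⊔ Submodule.span ℂ {Q i}) (2 ^ (s + 1))).card +
        (if s = s₀ then (nearSet Q 𝒬 (2 ^ (s₀ + 1)) i).card else 0) ≤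
        (highSet Q 𝒬 (2 ^ (s + 1))).card := by
      intro s _
      split_ifs with h
      · subst h
        rw [← Finset.card_union_of_disjoint]
        · refine Finset.card_le_card (Finset.union_subset (highSet_anti le_sup_left le_rfl) ?_)
          intro k hk
          rw [mem_highSet]
          exact (mem_nearSet.1 hk).1
        · rw [Finset.disjoint_left]
          intro k hk hk'
          obtain ⟨-, c, -, hc⟩ := mem_nearSet.1 hk'
          refine mem_highSet.1 hk ?_
          have := (hc.mono (le_sup_left (b := Submodule.span ℂ {Q i})) le_rfl).add
            ((LowMod.of_mem (s := 0) (Submodule.mem_sup_right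
              (Submodule.mem_span_singleton_self (Q i)))).smul c)
          rwa [sub_add_cancel] at this
      · exact Finset.card_le_card (highSet_anti le_sup_left le_rfl)
    have := Finset.sum_le_sum key
    rw [Finset.sum_add_distrib, Finset.sum_ite_eq' (Finset.range 41) s₀,
      if_pos (Finset.mem_range.2 hs₀)] at this
    simp only [hΨ]
    omega
  have hstart : Ψ ⊥ ≤ 1640 * Fintype.card ι := by
    simp only [hΨ]
    have : ∑ s ∈ Finset.range 41, (highSet Q ⊥ (2 ^ (s + 1))).card ≤
        ∑ s ∈ Finset.range 41, Fintype.card ι :=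
      Finset.sum_le_sum fun s _ => Finset.card_le_univ _
    rw [Finset.sum_const, Finset.card_range, smul_eq_mul] at this
    omega
  obtain ⟨𝒬, h1, h2, h3⟩ := exists_stable (fun 𝒬 => 𝒬 ≤ Lin n * Lin n)
    (fun 𝒬 => ∀ i, ∀ s < 41, 40 * (nearSet Q 𝒬 (2 ^ (s + 1)) i).card ≤ Fintype.card ι)
    (fun 𝒬 => Module.finrank ℂ 𝒬) Ψ (· + 1) (fun a b h => Nat.add_le_add_right h 1)
    (fun r => Nat.le_succ r) hm hstep 1640 ⊥ bot_le hstart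
  refine ⟨𝒬, h1, h3.trans ?_, h2⟩
  rw [finrank_bot, Nat.succ_iterate]

/-- All members of a configuration have bounded rank modulo a space of quadratics of bounded
dimension. -/
theorem IsConfig.exists_lowMod (hQ : IsConfig Q) :
    ∃ 𝒬 ≤ Lin n * Lin n, Module.finrank ℂ 𝒬 ≤ 1653 ∧ ∀ i, LowMod 𝒬 (2 ^ 41) (Q i) := by
  classical
  have hspan : ∀ N : Finset ι,
      Submodule.span ℂ (Set.range fun i : {k // k ∈ N} => Q i) ≤ Lin n * Lin n := fun N => by
    rw [Submodule.span_le]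
    rintro _ ⟨i, rfl⟩
    exact quad_iff.1 (hQ.quad i)
  rcases Nat.lt_or_ge (Fintype.card ι) 40 with hm | hm
  · refine ⟨Submodule.span ℂ (Set.range Q), ?_, (finrank_range_le_card Q).trans (by omega),
      fun i => LowMod.of_mem (Submodule.subset_span ⟨i, rfl⟩)⟩
    rw [Submodule.span_le]
    rintro _ ⟨i, rfl⟩
    exact quad_iff.1 (hQ.quad i)
  obtain ⟨𝒬, h1, h2, h3⟩ := hQ.exists_stable_space (by omega)
  have hcl := fun s => Finset.card_le_univ (highSet Q 𝒬 (2 ^ (s + 1)))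
  obtain ⟨s, hs, hgap⟩ : ∃ s < 40, 40 * (highSet Q 𝒬 (2 ^ (s + 1))).card ≤
      40 * (highSet Q 𝒬 (2 ^ (s + 1 + 1))).card + Fintype.card ι := by
    by_contra! hcon
    have : ∀ s ≤ 40, 40 * (highSet Q 𝒬 (2 ^ (s + 1))).card + s * (Fintype.card ι + 1) ≤
        40 * (highSet Q 𝒬 (2 ^ (0 + 1))).card := by
      intro s
      induction s with
      | zero => intro _; omega
      | succ s ih =>
        intro h
        have h4 := ih (by omega)
        have h5 := hcon s (by omega)
        have h6 : (s + 1) * (Fintype.card ι + 1) = s * (Fintype.card ι + 1) +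
          (Fintype.card ι + 1) := Nat.succ_mul _ _
        omega
    have h6 := this 40 le_rfl
    have h7 := hcl 0
    omega
  set t := 2 ^ (s + 1) with ht
  have ht2 : 2 ≤ t := by rw [ht, pow_succ]; have := Nat.one_le_two_pow (n := s); omega
  have htt : 2 ^ (s + 1 + 1) = 2 * t := by rw [ht]; ring
  rw [htt] at hgap
  set N := highSet Q 𝒬 (2 * t) with hN
  have hT : 2 * t ≤ 2 ^ 41 := by
    rw [← htt]; exact Nat.pow_le_pow_right (by norm_num) (by omega)
  have hlow : ∀ i ∉ N, LowMod 𝒬 (2 ^ 41) (Q i) := fun i hi => by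
    rw [hN, mem_highSet, not_not] at hi
    exact hi.mono le_rfl hT
  have := finiteDimensional_of_le_quad h1
  have := finiteDimensional_of_le_quad (hspan N)
  refine ⟨𝒬 ⊔ Submodule.span ℂ (Set.range fun i : {k // k ∈ N} => Q i), sup_le h1 (hspan N),
    (Submodule.finrank_add_le_finrank_add_finrank _ _).trans
      ((Nat.add_le_add h2 ?_).trans (show 1640 + 13 ≤ 1653 by norm_num)), fun i => ?_⟩
  · refine robust_sylvester_gallai (fun i : {k // k ∈ N} => Q i)
      (fun i j hij => hQ.indep i j fun h => hij (Subtype.ext h)) 2 fun i => ?_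
    have hi : ¬ LowMod 𝒬 (2 * t) (Q i) := mem_highSet.1 i.2
    have c1 := hQ.card_compl_highSet_le ht2 le_rfl hi
    have c2 := hQ.card_highSet_le ht2 le_rfl i.2
    have c3 := h3 i s (by omega)
    rw [← ht] at c3
    rw [← hN] at c2
    have c4 : (highSet Q 𝒬 t)ᶜ.card + (highSet Q 𝒬 t).card = Fintype.card ι :=
      (add_comm _ _).trans (Finset.card_add_card_compl _)
    have c5 : Nᶜ.card + N.card = Fintype.card ι :=
      (add_comm _ _).trans (Finset.card_add_card_compl _)
    refine ⟨(N.filter fun j : ι => j ≠ i ∧ ∃ k ∈ N, k ≠ i ∧ k ≠ j ∧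
        Q k ∈ Submodule.span ℂ {Q i, Q j}).subtype (· ∈ N), ?_, fun j hj => ?_⟩
    · rw [Finset.card_subtype, Finset.filter_true_of_mem fun j hj => (Finset.mem_filter.1 hj).1,
        Fintype.card_coe]
      omega
    · rw [Finset.mem_subtype, Finset.mem_filter] at hj
      obtain ⟨-, h4, k, hk, h5, h6, h7⟩ := hj
      exact ⟨fun h => h4 (congrArg _ h), ⟨k, hk⟩, fun h => h5 (congrArg Subtype.val h),
        fun h => h6 (congrArg Subtype.val h), h7⟩
  · by_cases hi : i ∈ N
    · exact LowMod.of_mem (Submodule.mem_sup_right (Submodule.subset_span ⟨⟨i, hi⟩, rfl⟩))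
    · exact (hlow i hi).mono le_sup_left le_rfl

end

theorem exists_compl_of_le {V X Y : Submodule ℂ (Poly n)} (hVY : V ≤ Y)
    (h : X ⊓ Y ≤ V) :
    ∃ Y' ≤ Y, Disjoint X Y' ∧ ∀ y ∈ Y, ∃ v ∈ V, ∃ y' ∈ Y', y = v + y' := by
  obtain ⟨C, hC⟩ := exists_isCompl V
  refine ⟨C ⊓ Y, inf_le_right, ?_, fun y hy => ?_⟩
  · rw [disjoint_iff, eq_bot_iff]
    intro x hx
    have h1 : x ∈ V := h ⟨hx.1, hx.2.2⟩
    exact hC.disjoint.le_bot ⟨h1, hx.2.1⟩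
  · have : y ∈ V ⊔ C := by rw [hC.codisjoint.eq_top]; exact Submodule.mem_top
    obtain ⟨v, hv, c, hc, rfl⟩ := Submodule.mem_sup.1 this
    refine ⟨v, hv, c, ⟨hc, ?_⟩, rfl⟩
    have := Y.sub_mem hy (hVY hv)
    rwa [add_sub_cancel_left] at this

/-- A point killing `V` can be modified off `X` so as to kill `Y`, if `X` and `Y` meet in `V`. -/
theorem exists_point_kill {V X Y : Submodule ℂ (Poly n)} (hX : X ≤ Lin n) (hY : Y ≤ Lin n)
    (hVX : V ≤ X) (hVY : V ≤ Y) (h : X ⊓ Y ≤ V) {d : Fin n → ℂ} (hd : ∀ v ∈ V, eval d v = 0) :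
    ∃ d' : Fin n → ℂ, (∀ x ∈ X, eval d' x = eval d x) ∧ ∀ y ∈ Y, eval d' y = 0 := by
  obtain ⟨Y', hY', h1, h2⟩ := exists_compl_of_le hVY h
  obtain ⟨d', h3, h4⟩ := exists_point_extend hX (hY'.trans hY) h1 d
  refine ⟨d', h3, fun y hy => ?_⟩
  obtain ⟨v, hv, y', hy', rfl⟩ := h2 y hy
  rw [map_add, h3 v (hVX hv), hd v hv, h4 y' hy', add_zero]

/-- A projection onto `X` mapping `Y` into `V`, if `X` and `Y` meet in `V`. -/
theorem exists_projection_into {V X Y : Submodule ℂ (Poly n)} (hVX : V ≤ X) (hVY : V ≤ Y)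
    (h : X ⊓ Y ≤ V) : ∃ φ : Poly n →ₗ[ℂ] Poly n,
      (∀ x ∈ X, φ x = x) ∧ (∀ y ∈ Y, φ y ∈ V) ∧ ∀ x, φ x ∈ X := by
  obtain ⟨Y', hY', h1, h2⟩ := exists_compl_of_le hVY h
  obtain ⟨φ, h3, h4, h5⟩ := exists_projection h1
  refine ⟨φ, h3, fun y hy => ?_, h5⟩
  obtain ⟨v, hv, y', hy', rfl⟩ := h2 y hy
  rw [map_add, h3 v (hVX hv), h4 y' hy', add_zero]
  exact hv

theorem eval_eq_of_mem_mul {A B : Submodule ℂ (Poly n)} {d d' : Fin n → ℂ}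
    (hA : ∀ x ∈ A, eval d' x = eval d x) (hB : ∀ x ∈ B, eval d' x = eval d x) {f : Poly n}
    (hf : f ∈ A * B) : eval d' f = eval d f := by
  induction hf using Submodule.mul_induction_on' with
  | mem_mul_mem x hx y hy => rw [map_mul, map_mul, hA x hx, hB y hy]
  | add x _ y _ hx hy => rw [map_add, map_add, hx, hy]

theorem LowRank.of_mem {Y : Submodule ℂ (Poly n)} {s : ℕ} (hY : Y ≤ Lin n)
    (hs : Module.finrank ℂ Y ≤ s) {f : Poly n} (hf : f ∈ Y * Y) : LowRank s f :=
  ⟨Y, hY, hs, mul_mem_mono le_rfl hY hf⟩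

/-- A quadratic which, up to `𝒬`, is a quadratic polynomial in one form modulo `V`. -/
def Unary (V 𝒬 : Submodule ℂ (Poly n)) (f : Poly n) : Prop :=
  ∃ y ∈ Lin n, f ∈ 𝒬 ⊔ (V ⊔ Submodule.span ℂ {y}) * (V ⊔ Submodule.span ℂ {y})

/-- Every nonzero member of `𝒬` has rank greater than `R`. -/
def Regular (𝒬 : Submodule ℂ (Poly n)) (R : ℕ) : Prop := ∀ q ∈ 𝒬, LowRank R q → q = 0

theorem Regular.eq_zero {𝒬 : Submodule ℂ (Poly n)} {R s : ℕ} (h : Regular 𝒬 R) {q f : Poly n}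
    (hq : q ∈ 𝒬) (hf : LowRank s f) (hs : s ≤ R) (e : q = f) : q = 0 :=
  h q hq (e ▸ hf.mono hs)

/-- A quadratic which is neither unary nor of small rank is called generic here; the lemmas
below describe third points on edges through generic members. -/
def Generic (V 𝒬 : Submodule ℂ (Poly n)) (f : Poly n) : Prop :=
  f ∉ 𝒬 ⊔ V * Lin n ∧ ¬ Unary V 𝒬 f

namespace Generic
variable {V 𝒬 X Y Z : Submodule ℂ (Poly n)} {R s : ℕ} {f g h : Poly n}

theorem notMem_left (hf : Generic V 𝒬 f) {q p : Poly n} (hq : q ∈ 𝒬) (e : f = q + p) :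
    p ∉ V * Lin n := fun hp =>
  hf.1 (e ▸ Submodule.add_mem_sup hq hp)

theorem notMem_unary (hf : Generic V 𝒬 f) {q p y : Poly n} (hq : q ∈ 𝒬) (e : f = q + p)
    (hy : y ∈ Lin n) : p ∉ (V ⊔ Submodule.span ℂ {y}) * (V ⊔ Submodule.span ℂ {y}) := fun hp =>
  hf.2 ⟨y, hy, e ▸ Submodule.add_mem_sup hq hp⟩

theorem false_of_linear (hf : Generic V 𝒬 f) (hR : Regular 𝒬 R) (hX : X ≤ Lin n)
    (hY : Y ≤ Lin n) (hZ : Z ≤ Lin n) (hVX : V ≤ X) (hVY : V ≤ Y)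
    (hsX : Module.finrank ℂ X ≤ s) (hsY : Module.finrank ℂ Y ≤ s) (hsZ : Module.finrank ℂ Z ≤ s)
    (hs : 3 * s ≤ R) (hXY : X ⊓ Y ≤ V) (hXZ : X ⊓ Z ≤ V)
    (hfX : f ∈ 𝒬 ⊔ X * X) (hgY : g ∈ 𝒬 ⊔ Y * Y) (hhZ : h ∈ 𝒬 ⊔ Z * Z)
    {a b : ℂ} (ha : a ≠ 0) (e : h = a • f + b • g) : False := by
  obtain ⟨q, hq, p, hp, rfl⟩ := Submodule.mem_sup.1 hfX
  obtain ⟨q₁, hq₁, p₁, hp₁, rfl⟩ := Submodule.mem_sup.1 hgY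
  obtain ⟨q₂, hq₂, p₂, hp₂, rfl⟩ := Submodule.mem_sup.1 hhZ
  have h0 : q₂ - a • q - b • q₁ = 0 := by
    refine hR.eq_zero (s := s + s + s) (𝒬.sub_mem (𝒬.sub_mem hq₂ (𝒬.smul_mem a hq))
      (𝒬.smul_mem b hq₁)) (((LowRank.of_mem hX hsX hp).smul a).add
        ((LowRank.of_mem hY hsY hp₁).smul b) |>.add ((LowRank.of_mem hZ hsZ hp₂).smul (-1)))
        (by omega) ?_
    simp only [smul_add] at e
    rw [neg_one_smul]
    linear_combination e
  have e2 : p₂ = a • p + b • p₁ := by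
    simp only [smul_add] at e
    linear_combination e - h0
  refine hf.notMem_left hq rfl ?_
  have hpq : p.IsHomogeneous 2 := quad_iff.2 (mul_mem_mono hX hX hp)
  refine mem_mul_lin_of_vanish (hVX.trans hX) hpq fun d hd => ?_
  obtain ⟨d', h1, h2⟩ := exists_point_kill hX hY hVX hVY hXY hd
  have h3 : der d' p₂ = a • der d' p := by
    rw [e2, map_add, Derivation.map_smul, Derivation.map_smul, der_eq_zero hY hY h2 h2 hp₁,
      smul_zero, add_zero]
  have h4 : der d' p ∈ V := by
    have h5 := der_mem hX hX d' hp
    have h6 := der_mem hZ hZ d' hp₂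
    rw [sup_idem] at h5 h6
    refine hXZ ⟨h5, ?_⟩
    rw [h3] at h6
    have := Z.smul_mem a⁻¹ h6
    rwa [smul_smul, inv_mul_cancel₀ ha, one_smul] at this
  have h7 := eval_der_self hpq d'
  rw [h2 _ (hVY h4), eval_eq_of_mem_mul h1 h1 hp] at h7
  linear_combination (-1 / 2 : ℂ) * h7

theorem false_of_add_sq (hf : Generic V 𝒬 f) (hR : Regular 𝒬 R) (hX : X ≤ Lin n)
    (hY : Y ≤ Lin n) (hVX : V ≤ X) (hVY : V ≤ Y)
    (hsX : Module.finrank ℂ X ≤ s) (hsY : Module.finrank ℂ Y ≤ s)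
    (hs : 2 * s + 1 ≤ R) (hXY : X ⊓ Y ≤ V)
    (hfX : f ∈ 𝒬 ⊔ X * X) (hgY : g ∈ 𝒬 ⊔ Y * Y) {c : ℂ} (hc : c ≠ 0) {ℓ : Poly n}
    (hℓ : ℓ ∈ Lin n) (e : g = c • f + ℓ ^ 2) : False := by
  obtain ⟨q, hq, p, hp, rfl⟩ := Submodule.mem_sup.1 hfX
  obtain ⟨q₁, hq₁, p₁, hp₁, rfl⟩ := Submodule.mem_sup.1 hgY
  have h0 : q₁ - c • q = 0 := by
    refine hR.eq_zero (s := s + s + 1) (𝒬.sub_mem hq₁ (𝒬.smul_mem c hq))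
      ((((LowRank.of_mem hX hsX hp).smul c).add
        ((LowRank.of_mem hY hsY hp₁).smul (-1))).add (LowRank.sq hℓ)) (by omega) ?_
    simp only [smul_add] at e
    rw [neg_one_smul]
    linear_combination e
  have e2 : p₁ = c • p + ℓ ^ 2 := by
    simp only [smul_add] at e
    linear_combination e - h0
  obtain ⟨φ, h1, h2, h3⟩ := exists_projection_into hVX hVY hXY
  have e3 := congrArg (subst φ) e2
  rw [map_add, map_smul, subst_eq_self hX hX h1 h1 hp, map_pow, subst_lin φ hℓ] at e3
  refine hf.notMem_unary hq rfl (hX (h3 ℓ)) (y := φ ℓ) ?_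
  have e4 : p = c⁻¹ • (subst φ p₁ - φ ℓ * φ ℓ) := by
    rw [e3, pow_two, add_sub_cancel_right, smul_smul, inv_mul_cancel₀ hc, one_smul]
  rw [e4]
  have hm : φ ℓ ∈ V ⊔ Submodule.span ℂ {φ ℓ} :=
    Submodule.mem_sup_right (Submodule.mem_span_singleton_self _)
  exact Submodule.smul_mem _ _ (Submodule.sub_mem _
    (mul_mem_mono le_sup_left le_sup_left (subst_mem_mul hY hY h2 h2 hp₁))
    (Submodule.mul_mem_mul hm hm))

/-- An irreducible generic quadratic of low rank is a polynomial in few forms. -/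
theorem mem_mul_self_of_lowRank (hR : Regular 𝒬 R) (hX : X ≤ Lin n)
    (hsX : Module.finrank ℂ X ≤ s) {t : ℕ} (hs : s + t ≤ R) (hfX : f ∈ 𝒬 ⊔ X * X)
    (ht : LowRank t f) : f ∈ X * X := by
  obtain ⟨q, hq, p, hp, rfl⟩ := Submodule.mem_sup.1 hfX
  have h0 : q = 0 := by
    refine hR.eq_zero (s := t + s) hq (ht.add ((LowRank.of_mem hX hsX hp).smul (-1)))
      (by omega) ?_
    rw [neg_one_smul]
    ring
  rwa [h0, zero_add]

theorem mem_of_mem_span_pair (hR : Regular 𝒬 R) (hX : X ≤ Lin n)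
    (hsX : Module.finrank ℂ X ≤ s) (hs : s + 2 ≤ R) (hfX : f ∈ 𝒬 ⊔ X * X) (hf : Irreducible f)
    {v w : Poly n} (hv : v ∈ Lin n) (hw : w ∈ Lin n)
    (h : f ∈ Submodule.span ℂ {v, w} * Lin n) : v ∈ X ∧ w ∈ X := by
  have h1 := mem_mul_self_of_lowRank hR hX hsX hs hfX (LowRank.of_pair hv hw h)
  obtain ⟨a, ha, b, hb, e⟩ := mem_span_pair_mul_iff.1 h
  exact mem_of_irreducible hX hf h1 hv hw ha hb e

theorem mem_of_eq_sq (hR : Regular 𝒬 R) (hX : X ≤ Lin n)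
    (hsX : Module.finrank ℂ X ≤ s) (hs : s + 1 ≤ R) (hfX : f ∈ 𝒬 ⊔ X * X)
    {ℓ : Poly n} (hℓ : ℓ ∈ Lin n) (e : f = ℓ ^ 2) : ℓ ∈ X := by
  have h1 := mem_mul_self_of_lowRank hR hX hsX hs hfX (e ▸ LowRank.sq hℓ)
  exact lin_mem_of_sq_mem hX hℓ (e ▸ mul_mem_mono le_rfl hX h1)

theorem notMem_of_mem_span_pair (hf : Generic V 𝒬 f) {v w : Poly n}
    (h : f ∈ Submodule.span ℂ {v, w} * Lin n) : ¬ (v ∈ V ∧ w ∈ V) := fun ⟨hv, hw⟩ => by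
  have h1 : Submodule.span ℂ {v, w} ≤ V := by
    rw [Submodule.span_le]; rintro x (rfl | rfl)
    · exact hv
    · exact hw
  exact hf.1 (Submodule.mem_sup_right (mul_mem_mono h1 le_rfl h))

/-- Uniqueness of the exceptional square. -/
theorem dvd_of_exceptional (hf : Generic V 𝒬 f) (hV : V ≤ Lin n) {x a u y b v : Poly n}
    (hx : x ∈ V) (hy : y ∈ V) (hx0 : x ≠ 0) (ha : a ∈ Lin n) (hb : b ∈ Lin n) (hu : u ∈ Lin n)
    (hv : v ∈ Lin n) (e : f = x * a + u ^ 2) (e' : f = y * b + v ^ 2) : x ∣ y := by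
  by_contra hxy
  have h1 : (v - u) * (v + u) ∈ V * Lin n := by
    have : (v - u) * (v + u) = x * a - y * b := by linear_combination e - e'
    rw [this]
    exact Submodule.sub_mem _ (Submodule.mul_mem_mul hx ha) (Submodule.mul_mem_mul hy hb)
  have h2 : v ∈ V ⊔ Submodule.span ℂ {u} := by
    have hu1 : u ∈ Submodule.span ℂ {u} := Submodule.mem_span_singleton_self u
    rcases lin_mem_of_mul_mem hV ((Lin n).sub_mem hv hu) ((Lin n).add_mem hv hu) h1 with h | h
    · have := Submodule.add_mem_sup h hu1
      rwa [sub_add_cancel] at this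
    · have := Submodule.add_mem_sup h (Submodule.neg_mem _ hu1)
      rwa [add_neg_cancel_right] at this
  have hle : V ⊔ Submodule.span ℂ {u} ≤ Lin n :=
    sup_le hV (by rwa [Submodule.span_singleton_le_iff_mem])
  have hu2 : u ∈ V ⊔ Submodule.span ℂ {u} :=
    Submodule.mem_sup_right (Submodule.mem_span_singleton_self u)
  have h3 : a ∈ V ⊔ Submodule.span ℂ {u} := by
    by_contra hna
    obtain ⟨d, hd, hda⟩ := exists_point_of_notMem hle ha hna
    have e3 : der d (x * a) + der d (u * u) = der d (y * b) + der d (v * v) := by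
      rw [← map_add, ← map_add, ← pow_two, ← pow_two, ← e, ← e']
    rw [der_mul_lin d (hV hx) ha, der_mul_lin d hu hu, der_mul_lin d (hV hy) hb,
      der_mul_lin d hv hv, hd x (Submodule.mem_sup_left hx), hd y (Submodule.mem_sup_left hy),
      hd u hu2, hd v h2, hda] at e3
    simp only [zero_smul, one_smul, add_zero] at e3
    by_cases h0 : eval d b = 0
    · rw [h0, zero_smul] at e3; exact hx0 e3
    · exact hxy ⟨C (eval d b)⁻¹, by
        rw [e3, mul_comm, C_mul', smul_smul, inv_mul_cancel₀ h0, one_smul]⟩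
  refine hf.notMem_unary 𝒬.zero_mem (zero_add f).symm hu ?_
  rw [e, pow_two]
  exact Submodule.add_mem _ (Submodule.mul_mem_mul (Submodule.mem_sup_left hx) h3)
    (Submodule.mul_mem_mul hu2 hu2)

end Generic

theorem mem_span_of_det {E : Type*} [AddCommGroup E] [Module ℂ E] {x y u v : E} {α β γ δ : ℂ}
    (hxy : LinearIndependent ℂ ![x, y]) (hx : x = α • u + β • v) (hy : y = γ • u + δ • v) :
    u ∈ Submodule.span ℂ {x, y} := by
  have h0 : α * δ - β * γ ≠ 0 := by
    intro h0
    have h1 := LinearIndependent.pair_iff.1 hxy δ (-β) (by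
      rw [hx, hy]
      match_scalars
      · linear_combination h0
      · ring)
    have h2 := LinearIndependent.pair_iff.1 hxy γ (-α) (by
      rw [hx, hy]
      match_scalars
      · ring
      · linear_combination -h0)
    have hx0 : x = 0 := by
      rw [hx, neg_eq_zero.1 h1.2, neg_eq_zero.1 h2.2]; simp
    exact hxy.ne_zero 0 (by simpa using hx0)
  rw [Submodule.mem_span_pair]
  refine ⟨(α * δ - β * γ)⁻¹ * δ, -((α * δ - β * γ)⁻¹ * β), ?_⟩
  rw [hx, hy]
  match_scalars
  · field_simp
    ring
  · ring

namespace Generic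
variable {V 𝒬 X Y Z : Submodule ℂ (Poly n)} {R s : ℕ} {f g h : Poly n}

theorem false_of_add_mul (hf : Generic V 𝒬 f) (hR : Regular 𝒬 R) (hX : X ≤ Lin n)
    (hZ : Z ≤ Lin n) (hVX : V ≤ X) (hVZ : V ≤ Z)
    (hsX : Module.finrank ℂ X ≤ s) (hsZ : Module.finrank ℂ Z ≤ s)
    (hs : 2 * s + 1 ≤ R) (hXZ : X ⊓ Z ≤ V)
    (hfX : f ∈ 𝒬 ⊔ X * X) (hhZ : h ∈ 𝒬 ⊔ Z * Z) {c : ℂ} (hc : c ≠ 0) {ℓ b : Poly n}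
    (hℓ : ℓ ∈ Lin n) (hb : b ∈ Lin n) (hℓX : ℓ ∈ X → ℓ ∈ V) (e : h = c • f + ℓ * b) : False := by
  obtain ⟨q, hq, p, hp, rfl⟩ := Submodule.mem_sup.1 hfX
  obtain ⟨q₁, hq₁, p₁, hp₁, rfl⟩ := Submodule.mem_sup.1 hhZ
  have h0 : q₁ - c • q = 0 := by
    refine hR.eq_zero (s := s + s + 1) (𝒬.sub_mem hq₁ (𝒬.smul_mem c hq))
      ((((LowRank.of_mem hX hsX hp).smul c).add
        ((LowRank.of_mem hZ hsZ hp₁).smul (-1))).add (LowRank.mul hℓ hb)) (by omega) ?_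
    simp only [smul_add] at e
    rw [neg_one_smul]
    linear_combination e
  have e2 : p₁ = c • p + ℓ * b := by
    simp only [smul_add] at e
    linear_combination e - h0
  obtain ⟨φ, h1, h2, h3⟩ := exists_projection_into hVX hVZ hXZ
  have e3 := congrArg (subst φ) e2
  rw [map_add, map_smul, subst_eq_self hX hX h1 h1 hp, map_mul, subst_lin φ hℓ,
    subst_lin φ hb] at e3
  have hV : V ≤ Lin n := hVX.trans hX
  have hVV : subst φ p₁ ∈ V * V := subst_mem_mul hZ hZ h2 h2 hp₁
  have e4 : p = c⁻¹ • (subst φ p₁ - φ ℓ * φ b) := by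
    rw [e3, add_sub_cancel_right, smul_smul, inv_mul_cancel₀ hc, one_smul]
  have hℓ' : φ ℓ ∈ Lin n := hX (h3 ℓ)
  have hb' : φ b ∈ Lin n := hX (h3 b)
  have hm : ∀ {y : Poly n}, y ∈ V ⊔ Submodule.span ℂ {y} := fun {y} =>
    Submodule.mem_sup_right (Submodule.mem_span_singleton_self _)
  have hℓV : φ ℓ ∉ V := fun h => hf.notMem_left hq rfl (by
    rw [e4]
    exact Submodule.smul_mem _ _ (Submodule.sub_mem _ (mul_mem_mono le_rfl hV hVV)
      (Submodule.mul_mem_mul h hb')))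
  have hbℓ : φ b ∉ V ⊔ Submodule.span ℂ {φ ℓ} := fun h => hf.notMem_unary hq rfl hℓ' (by
    rw [e4]
    exact Submodule.smul_mem _ _ (Submodule.sub_mem _ (mul_mem_mono le_sup_left le_sup_left hVV)
      (Submodule.mul_mem_mul hm h)))
  have hℓb : φ ℓ ∉ V ⊔ Submodule.span ℂ {φ b} := fun h => hf.notMem_unary hq rfl hb' (by
    rw [e4]
    exact Submodule.smul_mem _ _ (Submodule.sub_mem _ (mul_mem_mono le_sup_left le_sup_left hVV)
      (Submodule.mul_mem_mul h hm)))
  have hder : ∀ d, (∀ z ∈ Z, eval d z = 0) →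
      eval d b • ℓ + eval d ℓ • b = eval d (φ b) • φ ℓ + eval d (φ ℓ) • φ b := by
    intro d hd
    rw [← der_mul_lin d hℓ hb, ← der_mul_lin d hℓ' hb']
    have hVd : ∀ v ∈ V, eval d v = 0 := fun v hv => hd v (hVZ hv)
    have k1 := congrArg (der d) e2
    have k2 := congrArg (der d) e3
    rw [map_add, der_eq_zero hZ hZ hd hd hp₁] at k1
    rw [map_add, der_eq_zero hV hV hVd hVd hVV] at k2
    linear_combination k2 - k1
  have hex : ∀ x y, x ∈ X → y ∈ X → x ∉ V ⊔ Submodule.span ℂ {y} →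
      ∃ d, (∀ z ∈ Z, eval d z = 0) ∧ eval d y = 0 ∧ eval d x = 1 := by
    intro x y hx hy hxy
    obtain ⟨d, hd, hd1⟩ := exists_point_of_notMem (X := Z ⊔ Submodule.span ℂ {y})
      (sup_le hZ (by rw [Submodule.span_singleton_le_iff_mem]; exact hX hy)) (hX hx) (fun h => by
        obtain ⟨z, hz, y', hy', rfl⟩ := Submodule.mem_sup.1 h
        have hy'' : y' ∈ X := by
          obtain ⟨t, rfl⟩ := Submodule.mem_span_singleton.1 hy'
          exact X.smul_mem t hy
        have : z ∈ V := hXZ ⟨by simpa using X.sub_mem hx hy'', hz⟩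
        exact hxy (Submodule.add_mem_sup this hy'))
    exact ⟨d, fun z hz => hd z (Submodule.mem_sup_left hz),
      hd y (Submodule.mem_sup_right (Submodule.mem_span_singleton_self y)), hd1⟩
  obtain ⟨d, hd, hd0, hd1⟩ := hex _ _ (h3 b) (h3 ℓ) hbℓ
  obtain ⟨d', hd', hd0', hd1'⟩ := hex _ _ (h3 ℓ) (h3 b) hℓb
  have k1 := hder d hd
  have k2 := hder d' hd'
  rw [hd0, hd1, zero_smul, one_smul, add_zero] at k1
  rw [hd0', hd1', zero_smul, one_smul, zero_add] at k2
  have hLI : LinearIndependent ℂ ![φ ℓ, φ b] := by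
    rw [linearIndependent_pair_iff_ne_smul (fun h => hℓV (by rw [h]; exact V.zero_mem))]
    rintro t ht
    exact hbℓ (Submodule.mem_sup_right (Submodule.mem_span_singleton.2 ⟨t, ht⟩))
  have hmem := mem_span_of_det hLI k1.symm k2.symm
  have hℓX' : ℓ ∈ X := by
    have : Submodule.span ℂ {φ ℓ, φ b} ≤ X := by
      rw [Submodule.span_le]; rintro x (rfl | rfl)
      · exact h3 _
      · exact h3 _
    exact this hmem
  apply hℓV
  rw [h1 ℓ hℓX']
  exact hℓX hℓX'

end Generic

theorem IsConfig.irreducible_of_generic {Q : ι → Poly n} (hQ : IsConfig Q)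
    {V 𝒬 : Submodule ℂ (Poly n)} {i : ι} (hi : Generic V 𝒬 (Q i)) : Irreducible (Q i) := by
  rcases hQ.irr_or_sq i with h | ⟨ℓ, hℓ, e⟩
  · exact h
  · have hm : ℓ ∈ V ⊔ Submodule.span ℂ {ℓ} :=
      Submodule.mem_sup_right (Submodule.mem_span_singleton_self ℓ)
    exact absurd ⟨ℓ, hℓ, Submodule.mem_sup_right (by
      rw [e, pow_two]; exact Submodule.mul_mem_mul hm hm)⟩ hi.2

/-- The spaces attached to the members of a configuration meet the space of a generic member
nontrivially for a positive fraction of the members. -/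
theorem IsConfig.card_le_of_generic [Fintype ι] {Q : ι → Poly n} (hQ : IsConfig Q)
    {V 𝒬 : Submodule ℂ (Poly n)} {Y : ι → Submodule ℂ (Poly n)} {R s : ℕ}
    (hR : Regular 𝒬 R) (hY : ∀ i, Y i ≤ Lin n) (hVY : ∀ i, V ≤ Y i)
    (hs : ∀ i, Module.finrank ℂ (Y i) ≤ s) (hsR : 3 * s + 2 ≤ R)
    (hQY : ∀ i, Q i ∈ 𝒬 ⊔ Y i * Y i) {i : ι} (hi : Generic V 𝒬 (Q i)) {N : Finset ι}
    (hN : ∀ j, j ∉ N → Y i ⊓ Y j ≤ V) : Fintype.card ι ≤ 4 * N.card + 1 := by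
  classical
  have hirr := hQ.irreducible_of_generic hi
  obtain ⟨κ, hκ⟩ := hQ.exists_third i
  have hiN : i ∈ N := by
    by_contra h
    have h1 : Y i ≤ V := le_trans (le_inf le_rfl le_rfl) (hN i h)
    refine hi.1 (?_ : Q i ∈ _)
    have h2 : Y i * Y i ≤ V * Lin n := mul_le_mul' h1 (hY i)
    exact sup_le_sup_left h2 𝒬 (hQY i)
  have hne : ∀ j, j ∉ N → i ≠ j := fun j hj h => hj (h ▸ hiN)
  set A := Nᶜ.filter fun j => ∃ a b : ℂ, a ≠ 0 ∧ b ≠ 0 ∧ Q (κ j) = a • Q i + b • Q j with hA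
  set B := Nᶜ.filter fun j => ∃ ℓ ∈ Lin n, ℓ ≠ 0 ∧ Q j = ℓ ^ 2 ∧
    ∃ c : ℂ, c ≠ 0 ∧ ∃ b ∈ Lin n, b ≠ 0 ∧ Q (κ j) = c • Q i + ℓ * b with hB
  set D := Nᶜ.filter fun j => ∃ ℓ ∈ Lin n, ℓ ≠ 0 ∧ Q j = ℓ ^ 2 ∧
    ∃ b ∈ Lin n, ∃ v ∈ Lin n, Q i = ℓ * b + v ^ 2 with hD
  have hcov : Nᶜ ⊆ A ∪ (B ∪ D) := by
    intro j hj
    have hj' : j ∉ N := Finset.mem_compl.1 hj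
    have hij := hne j hj'
    simp only [hA, hB, hD, Finset.mem_union, Finset.mem_filter, hj, true_and]
    rcases hQ.edge_cases hirr hij (hκ j hij).1 (hκ j hij).2.1 (hκ j hij).2.2 with
      ⟨hjr, h | ⟨c, hc, ℓ, hℓ, e⟩ | ⟨v, hv, w, hw, h1, h2⟩⟩ |
        ⟨ℓ, hℓ, h0, e, ⟨c, hc, b, hb, hb0, e'⟩ | ⟨b, hb, v, hv, e'⟩⟩
    · exact Or.inl h
    · exact (hi.false_of_add_sq hR (hY i) (hY j) (hVY i) (hVY j) (hs i) (hs j) (by omega)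
        (hN j hj') (hQY i) (hQY j) hc hℓ e).elim
    · have h3 := Generic.mem_of_mem_span_pair hR (hY i) (hs i) (by omega) (hQY i) hirr hv hw h1
      have h4 := Generic.mem_of_mem_span_pair hR (hY j) (hs j) (by omega) (hQY j) hjr hv hw h2
      exact (hi.notMem_of_mem_span_pair h1 ⟨hN j hj' ⟨h3.1, h4.1⟩, hN j hj' ⟨h3.2, h4.2⟩⟩).elim
    · exact Or.inr (Or.inl ⟨ℓ, hℓ, h0, e, c, hc, b, hb, hb0, e'⟩)
    · exact Or.inr (Or.inr ⟨ℓ, hℓ, h0, e, b, hb, v, hv, e'⟩)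
  have hsq : ∀ j, j ∉ N → ∀ ℓ ∈ Lin n, Q j = ℓ ^ 2 → ℓ ∈ Y i → ℓ ∈ V := fun j hj ℓ hℓ e h =>
    hN j hj ⟨h, Generic.mem_of_eq_sq hR (hY j) (hs j) (by omega) (hQY j) hℓ e⟩
  have hcA : A.card ≤ N.card := by
    refine Finset.card_le_card_of_injOn κ ?_ ?_
    · intro j hj
      obtain ⟨hj1, a, b, ha, hb, e⟩ := Finset.mem_filter.1 (Finset.mem_coe.1 hj)
      by_contra hk
      exact hi.false_of_linear hR (hY i) (hY j) (hY (κ j)) (hVY i) (hVY j) (hs i) (hs j)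
        (hs (κ j)) (by omega) (hN j (Finset.mem_compl.1 hj1)) (hN _ hk) (hQY i) (hQY j)
        (hQY (κ j)) ha e
    · intro j hj j' hj' hjj
      obtain ⟨hj1, a, b, ha, hb, e⟩ := Finset.mem_filter.1 (Finset.mem_coe.1 hj)
      obtain ⟨hj1', a', b', ha', hb', e'⟩ := Finset.mem_filter.1 (Finset.mem_coe.1 hj')
      by_contra hjne
      rw [← hjj, e] at e'
      have e2 : Q j' = (b'⁻¹ * (a - a')) • Q i + (b'⁻¹ * b) • Q j := by
        have : b' • Q j' = (a - a') • Q i + b • Q j := by rw [sub_smul]; linear_combination -e'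
        rw [mul_smul, mul_smul, ← smul_add, ← this, smul_smul, inv_mul_cancel₀ hb', one_smul]
      by_cases haa : a = a'
      · rw [haa, sub_self, mul_zero, zero_smul, zero_add] at e2
        exact hQ.ne_smul hjne _ e2
      · exact hi.false_of_linear hR (hY i) (hY j) (hY j') (hVY i) (hVY j) (hs i) (hs j)
          (hs j') (by omega) (hN j (Finset.mem_compl.1 hj1)) (hN j' (Finset.mem_compl.1 hj1'))
          (hQY i) (hQY j) (hQY j') (mul_ne_zero (inv_ne_zero hb') (sub_ne_zero.2 haa)) e2
  have hcB : B.card ≤ 2 * N.card := by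
    refine Finset.card_le_mul_card_image_of_maps_to (f := κ) ?_ 2 ?_
    · intro j hj
      obtain ⟨hj1, ℓ, hℓ, h0, e, c, hc, b, hb, hb0, e'⟩ := Finset.mem_filter.1 hj
      by_contra hk
      exact hi.false_of_add_mul hR (hY i) (hY (κ j)) (hVY i) (hVY (κ j)) (hs i) (hs (κ j))
        (by omega) (hN _ hk) (hQY i) (hQY (κ j)) hc hℓ hb
        (hsq j (Finset.mem_compl.1 hj1) ℓ hℓ e) e'
    · intro k hk
      rcases (B.filter fun j => κ j = k).eq_empty_or_nonempty with h | ⟨j₀, hj₀⟩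
      · rw [h]; simp
      obtain ⟨hj₀B, rfl⟩ := Finset.mem_filter.1 hj₀
      obtain ⟨hj1, ℓ, hℓ, h0, e, c, hc, b, hb, hb0, e'⟩ := Finset.mem_filter.1 hj₀B
      have hg : Q (κ j₀) - c • Q i = ℓ * b := by rw [e']; ring
      refine hQ.card_le_two_of_dvd (g := Q (κ j₀) - c • Q i) (hg ▸ mul_quad hℓ hb)
        (hg ▸ mul_ne_zero h0 hb0) fun j hj => ?_
      obtain ⟨hjB, hjk⟩ := Finset.mem_filter.1 hj
      obtain ⟨hj1', ℓ', hℓ', h0', f, c', hc', b', hb', hb0', f'⟩ := Finset.mem_filter.1 hjB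
      refine ⟨ℓ', hℓ', h0', f, b', ?_⟩
      rw [hjk, e'] at f'
      have hcc : c = c' := by
        by_contra hcc
        have h1 : Q i ∈ Submodule.span ℂ {ℓ, ℓ'} * Lin n := by
          have h2 : Q i = (c - c')⁻¹ • (ℓ' * b' - ℓ * b) := by
            have h3 : (c - c') • Q i = ℓ' * b' - ℓ * b := by
              rw [sub_smul]; linear_combination f'
            rw [← h3, smul_smul, inv_mul_cancel₀ (sub_ne_zero.2 hcc), one_smul]
          rw [h2]
          exact Submodule.smul_mem _ _ (Submodule.sub_mem _
            (Submodule.mul_mem_mul (Submodule.subset_span (by simp)) hb')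
            (Submodule.mul_mem_mul (Submodule.subset_span (by simp)) hb))
        have h3 := Generic.mem_of_mem_span_pair hR (hY i) (hs i) (by omega) (hQY i) hirr hℓ hℓ' h1
        exact hi.notMem_of_mem_span_pair h1 ⟨hsq j₀ (Finset.mem_compl.1 hj1) ℓ hℓ e h3.1,
          hsq j (Finset.mem_compl.1 hj1') ℓ' hℓ' f h3.2⟩
      rw [e', f', hcc]
      ring
  have hcD : D.card ≤ 1 := by
    rw [Finset.card_le_one]
    have hmem : ∀ j, j ∉ N → ∀ ℓ ∈ Lin n, Q j = ℓ ^ 2 → ∀ b ∈ Lin n, ∀ v ∈ Lin n,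
        Q i = ℓ * b + v ^ 2 → ℓ ∈ V := fun j hj ℓ hℓ e b hb v hv e' =>
      hsq j hj ℓ hℓ e (Generic.mem_of_mem_span_pair hR (hY i) (hs i) (by omega) (hQY i) hirr hℓ hv
        (mem_span_pair_mul_iff.2 ⟨b, hb, v, hv, by rw [e', pow_two]⟩)).1
    intro j hj j' hj'
    obtain ⟨hj1, ℓ, hℓ, h0, e, b, hb, v, hv, e2⟩ := Finset.mem_filter.1 hj
    obtain ⟨hj1', ℓ', hℓ', h0', e', b', hb', v', hv', e2'⟩ := Finset.mem_filter.1 hj'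
    have hV : V ≤ Lin n := (hVY i).trans (hY i)
    exact hQ.eq_of_dvd hℓ hℓ' e e' (hi.dvd_of_exceptional hV
      (hmem j (Finset.mem_compl.1 hj1) ℓ hℓ e b hb v hv e2)
      (hmem j' (Finset.mem_compl.1 hj1') ℓ' hℓ' e' b' hb' v' hv' e2')
      h0 hb hb' hv hv' e2 e2') h0
  have h1 := Finset.card_le_card hcov
  have h2 := Finset.card_union_le A (B ∪ D)
  have h3 := Finset.card_union_le B D
  have h4 : Nᶜ.card + N.card = Fintype.card ι :=
    (add_comm _ _).trans (Finset.card_add_card_compl _)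
  omega

/-- A finite-dimensional space loses one dimension when one of its nonzero members is split off. -/
theorem exists_compl_singleton {E : Type*} [AddCommGroup E] [Module ℂ E] {A : Submodule ℂ E}
    [FiniteDimensional ℂ A] {q : E} (hq : q ∈ A) (h0 : q ≠ 0) :
    ∃ A' ≤ A, Module.finrank ℂ A' + 1 ≤ Module.finrank ℂ A ∧ A ≤ A' ⊔ Submodule.span ℂ {q} := by
  obtain ⟨C, hC⟩ := exists_isCompl (Submodule.span ℂ {q})
  have hqs := Submodule.mem_span_singleton_self (R := ℂ) q
  refine ⟨C ⊓ A, inf_le_right, ?_, fun x hx => ?_⟩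
  · refine Submodule.finrank_lt_finrank_of_lt (lt_of_le_of_ne inf_le_right fun h => h0 ?_)
    rw [← h] at hq
    exact hC.disjoint.le_bot ⟨hqs, hq.1⟩
  · have : x ∈ Submodule.span ℂ {q} ⊔ C := by
      rw [hC.codisjoint.eq_top]; exact Submodule.mem_top
    obtain ⟨y, hy, c, hc, rfl⟩ := Submodule.mem_sup.1 this
    obtain ⟨t, rfl⟩ := Submodule.mem_span_singleton.1 hy
    rw [add_comm]
    refine Submodule.add_mem_sup ⟨hc, ?_⟩ hy
    simpa using A.sub_mem hx (A.smul_mem t hq)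

/-- The regularity required of the space of quadratics, depending on the number of linear forms. -/
def regBound (T r : ℕ) : ℕ := 6 * r + 6 * T + 20

/-- Bound for the number of linear forms in `IsConfig.exists_core`. -/
def coreBound (T D : ℕ) : ℕ := (fun r => r + 2 * regBound T r + 2 * T)^[16 * T + D] 0

/-- All members of a configuration are, up to a regular space of quadratics of bounded dimension,
either in the ideal of a bounded number of linear forms or unary over them. -/
theorem IsConfig.exists_core [Fintype ι] {Q : ι → Poly n} (hQ : IsConfig Q)
    (hm : 2 ≤ Fintype.card ι) {𝒬₀ : Submodule ℂ (Poly n)} (h𝒬₀ : 𝒬₀ ≤ Lin n * Lin n) {T D : ℕ}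
    (hD : Module.finrank ℂ 𝒬₀ ≤ D) (hT : ∀ i, LowMod 𝒬₀ T (Q i)) :
    ∃ V ≤ Lin n, ∃ 𝒬 ≤ Lin n * Lin n, Module.finrank ℂ V ≤ coreBound T D ∧
      Module.finrank ℂ 𝒬 ≤ D ∧ Regular 𝒬 (regBound T (Module.finrank ℂ V)) ∧
      ∀ i, Q i ∈ 𝒬 ⊔ V * Lin n ∨ Unary V 𝒬 (Q i) := by
  classical
  have hW : ∀ i, ∃ W ≤ Lin n, Module.finrank ℂ W ≤ 2 * T ∧ Q i ∈ 𝒬₀ ⊔ W * W := fun i => by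
    obtain ⟨q, hq, X, hX, hXT, hm⟩ := hT i
    obtain ⟨W, -, h2, h3, h4⟩ := exists_mem_mul_self hX hm
    refine ⟨W, h2, h3.trans (by omega), ?_⟩
    have := Submodule.add_mem_sup hq h4
    rwa [add_sub_cancel] at this
  choose W hWL hWT hQW using hW
  have hfd : ∀ {A : Submodule ℂ (Poly n)}, A ≤ Lin n → FiniteDimensional ℂ A :=
    fun h => finiteDimensional_of_le h
  have hfi : ∀ (A : Submodule ℂ (Poly n)) (j : ι), FiniteDimensional ℂ ↥(A ⊓ W j) :=
    fun A j => hfd (inf_le_right.trans (hWL j))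
  set Ψ : Submodule ℂ (Poly n) × Submodule ℂ (Poly n) → ℕ := fun x =>
    8 * ∑ j, (2 * T - Module.finrank ℂ ↥(x.1 ⊓ W j)) + Module.finrank ℂ x.2 * Fintype.card ι
    with hΨ
  set Inv : Submodule ℂ (Poly n) × Submodule ℂ (Poly n) → Prop := fun x =>
    x.1 ≤ Lin n ∧ x.2 ≤ Lin n * Lin n ∧ Module.finrank ℂ x.2 ≤ D ∧
      ∀ i, Q i ∈ x.2 ⊔ (x.1 ⊔ W i) * (x.1 ⊔ W i) with hInv
  set Stable : Submodule ℂ (Poly n) × Submodule ℂ (Poly n) → Prop := fun x =>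
    Regular x.2 (regBound T (Module.finrank ℂ x.1)) ∧ ∀ i, ¬ Generic x.1 x.2 (Q i) with hStable
  set g : ℕ → ℕ := fun r => r + 2 * regBound T r + 2 * T with hg
  have hmono : ∀ {V V' : Submodule ℂ (Poly n)}, V ≤ V' → ∀ j,
      2 * T - Module.finrank ℂ ↥(V' ⊓ W j) ≤ 2 * T - Module.finrank ℂ ↥(V ⊓ W j) :=
    fun {V V'} h j => by
      have := hfi V' j
      exact Nat.sub_le_sub_left (Submodule.finrank_mono (inf_le_inf_right _ h)) _
  have step : ∀ x, Inv x → ¬ Stable x → ∃ x', Inv x' ∧ Module.finrank ℂ x'.1 ≤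
      g (Module.finrank ℂ x.1) ∧ Ψ x' + Fintype.card ι ≤ Ψ x := by
    rintro ⟨V, 𝒬⟩ ⟨hV, h𝒬, h𝒬D, hVQ⟩ hns
    dsimp only at hV h𝒬 h𝒬D hVQ
    have := hfd hV
    have := finiteDimensional_of_le_quad h𝒬
    by_cases hreg : Regular 𝒬 (regBound T (Module.finrank ℂ V))
    · obtain ⟨i, hi⟩ : ∃ i, Generic V 𝒬 (Q i) := by
        by_contra! h
        exact hns ⟨hreg, h⟩
      have (j : ι) : FiniteDimensional ℂ ↥(W j) := hfd (hWL j)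
      have hfr : ∀ j, Module.finrank ℂ ↥(V ⊔ W j) ≤ Module.finrank ℂ V + 2 * T := fun j =>
        (Submodule.finrank_add_le_finrank_add_finrank _ _).trans (Nat.add_le_add_left (hWT j) _)
      set N := Finset.univ.filter fun j => ¬ (V ⊔ W i) ⊓ (V ⊔ W j) ≤ V with hN
      have hcard := hQ.card_le_of_generic (Y := fun j => V ⊔ W j) hreg
        (fun j => sup_le hV (hWL j)) (fun j => le_sup_left) hfr (by unfold regBound; omega) hVQ hi
        (N := N) fun j hj => by simpa [hN] using hj
      refine ⟨(V ⊔ W i, 𝒬), ⟨sup_le hV (hWL i), h𝒬, h𝒬D, fun j => ?_⟩, ?_, ?_⟩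
      · have hle : V ⊔ W j ≤ V ⊔ W i ⊔ W j := sup_le_sup_right le_sup_left _
        exact sup_le_sup_left (mul_le_mul' hle hle) 𝒬 (hVQ j)
      · exact (hfr i).trans (by simp only [hg]; omega)
      · have key : ∀ j ∈ Finset.univ, 2 * T - Module.finrank ℂ ↥((V ⊔ W i) ⊓ W j) +
            (if j ∈ N then 1 else 0) ≤ 2 * T - Module.finrank ℂ ↥(V ⊓ W j) := by
          intro j _
          split_ifs with hj
          · have := hfi (V ⊔ W i) j
            have h1 : Module.finrank ℂ ↥((V ⊔ W i) ⊓ W j) ≤ 2 * T :=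
              (Submodule.finrank_mono inf_le_right).trans (hWT j)
            have h2 : Module.finrank ℂ ↥(V ⊓ W j) < Module.finrank ℂ ↥((V ⊔ W i) ⊓ W j) := by
              refine Submodule.finrank_lt_finrank_of_lt
                (lt_of_le_of_ne (inf_le_inf_right _ le_sup_left) fun h => ?_)
              refine (Finset.mem_filter.1 hj).2 fun x hx => ?_
              obtain ⟨v, hv, w, hw, rfl⟩ := Submodule.mem_sup.1 hx.2
              have h3 : w ∈ (V ⊔ W i) ⊓ W j := by
                refine ⟨?_, hw⟩
                simpa using Submodule.sub_mem _ hx.1 (Submodule.mem_sup_left hv)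
              rw [← h] at h3
              exact V.add_mem hv h3.1
            omega
          · exact hmono le_sup_left j
        have hsum := Finset.sum_le_sum key
        rw [Finset.sum_add_distrib, Finset.sum_boole, Finset.filter_mem_eq_inter,
          Finset.univ_inter, Nat.cast_id] at hsum
        simp only [hΨ]
        omega
    · obtain ⟨q, hq, ⟨X, hX, hXr, hqX⟩, hq0⟩ : ∃ q ∈ 𝒬,
          LowRank (regBound T (Module.finrank ℂ V)) q ∧ q ≠ 0 := by
        simpa [Regular] using hreg
      obtain ⟨X', -, hX', hXr', hqX'⟩ := exists_mem_mul_self hX hqX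
      have := hfd hX'
      obtain ⟨𝒬', h1, h2, h3⟩ := exists_compl_singleton hq hq0
      refine ⟨(V ⊔ X', 𝒬'), ⟨sup_le hV hX', h1.trans h𝒬, by dsimp only; omega, fun j => ?_⟩, ?_, ?_⟩
      · have hle : V ⊔ W j ≤ V ⊔ X' ⊔ W j := sup_le_sup_right le_sup_left _
        have hX2 : X' ≤ V ⊔ X' ⊔ W j := le_sup_right.trans le_sup_left
        refine (sup_le (h3.trans (sup_le le_sup_left ?_))
          ((mul_le_mul' hle hle).trans le_sup_right)) (hVQ j)
        rw [Submodule.span_singleton_le_iff_mem]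
        exact Submodule.mem_sup_right (mul_mem_mono hX2 hX2 hqX')
      · refine (Submodule.finrank_add_le_finrank_add_finrank _ _).trans ?_
        simp only [hg]
        omega
      · have hsum := Finset.sum_le_sum fun j (_ : j ∈ Finset.univ) =>
          hmono (le_sup_left : V ≤ V ⊔ X') j
        have h4 := Nat.mul_le_mul_right (Fintype.card ι) h2
        rw [add_mul, one_mul] at h4
        simp only [hΨ]
        omega
  have hstart : Ψ (⊥, 𝒬₀) ≤ (16 * T + D) * Fintype.card ι := by
    have h1 : ∑ j, (2 * T - Module.finrank ℂ ↥(⊥ ⊓ W j)) ≤ ∑ j : ι, 2 * T :=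
      Finset.sum_le_sum fun j _ => Nat.sub_le _ _
    rw [Finset.sum_const, Finset.card_univ, smul_eq_mul] at h1
    have h2 := Nat.mul_le_mul_right (Fintype.card ι) hD
    simp only [hΨ]
    nlinarith
  obtain ⟨⟨V, 𝒬⟩, ⟨h1, h2, h3, -⟩, ⟨h5, h6⟩, h7⟩ := exists_stable Inv Stable
    (fun x => Module.finrank ℂ x.1) Ψ g (fun a b h => by simp only [hg, regBound]; omega)
    (fun r => by simp only [hg]; omega) (by omega) step (16 * T + D) (⊥, 𝒬₀)
    ⟨bot_le, h𝒬₀, hD, fun i => by simpa using hQW i⟩ hstart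
  dsimp only at h1 h2 h3 h5 h6 h7
  rw [finrank_bot] at h7
  exact ⟨V, h1, 𝒬, h2, h7, h3, h5, fun i => by
    have := h6 i
    unfold Generic at this
    tauto⟩

/-- Modulo `V`, the quadratic `p` is a multiple of the square of its derivative at `ζ`. -/
def RankOneAt (V : Submodule ℂ (Poly n)) (p : Poly n) (ζ : Fin n → ℂ) : Prop :=
  ∃ α : ℂ, p - α • der ζ p ^ 2 ∈ V * Lin n

theorem exists_eq_of_mem_sup_mul_self {V : Submodule ℂ (Poly n)} {y p : Poly n}
    (hp : p ∈ (V ⊔ Submodule.span ℂ {y}) * (V ⊔ Submodule.span ℂ {y})) :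
    ∃ α : ℂ, ∃ v ∈ V, ∃ w ∈ V * V, p = α • (y * y) + y * v + w := by
  induction hp using Submodule.mul_induction_on' with
  | mem_mul_mem x hx z hz =>
    obtain ⟨v, hv, a', ha', rfl⟩ := Submodule.mem_sup.1 hx
    obtain ⟨v', hv', b', hb', rfl⟩ := Submodule.mem_sup.1 hz
    obtain ⟨a, rfl⟩ := Submodule.mem_span_singleton.1 ha'
    obtain ⟨b, rfl⟩ := Submodule.mem_span_singleton.1 hb'
    refine ⟨a * b, a • v' + b • v, V.add_mem (V.smul_mem a hv') (V.smul_mem b hv), v * v',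
      Submodule.mul_mem_mul hv hv', ?_⟩
    simp only [smul_eq_C_mul, C_mul]
    ring
  | add x _ z _ hx hz =>
    obtain ⟨α, v, hv, w, hw, rfl⟩ := hx
    obtain ⟨α', v', hv', w', hw', rfl⟩ := hz
    refine ⟨α + α', v + v', V.add_mem hv hv', w + w', Submodule.add_mem _ hw hw', ?_⟩
    rw [add_smul]
    ring

theorem exists_rankOneAt {V : Submodule ℂ (Poly n)} (hV : V ≤ Lin n) {p : Poly n}
    (hp : p ∈ V * Lin n ∨
      ∃ y ∈ Lin n, p ∈ (V ⊔ Submodule.span ℂ {y}) * (V ⊔ Submodule.span ℂ {y})) :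
    ∃ Δ : Poly n, Δ ≠ 0 ∧ ∀ ζ, eval ζ Δ ≠ 0 → RankOneAt V p ζ := by
  by_cases hpV : p ∈ V * Lin n
  · exact ⟨1, one_ne_zero, fun ζ _ => ⟨0, by rwa [zero_smul, sub_zero]⟩⟩
  obtain ⟨y, hy, h⟩ := hp.resolve_left hpV
  obtain ⟨α, v, hv, w, hw, rfl⟩ := exists_eq_of_mem_sup_mul_self h
  have hwV : w ∈ V * Lin n := mul_mem_mono le_rfl hV hw
  have hyv : y * v ∈ V * Lin n := by rw [mul_comm y v]; exact Submodule.mul_mem_mul hv hy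
  refine ⟨(2 * α) • y + v, fun h0 => hpV ?_, fun ζ hζ => ?_⟩
  · refine Submodule.add_mem _ (Submodule.add_mem _ ?_ hyv) hwV
    have : α • (y * y) = (-(2 : ℂ)⁻¹) • (v * y) := by
      have h1 : v = -((2 * α) • y) := by linear_combination h0
      rw [h1, neg_mul, smul_mul_assoc, ← neg_smul, smul_smul]
      congr 1
      ring
    rw [this]
    exact Submodule.smul_mem _ _ (Submodule.mul_mem_mul hv hy)
  · set μ := eval ζ ((2 * α) • y + v) with hμ
    set u := der ζ w + eval ζ y • v with hu
    have huV : u ∈ V := V.add_mem (by simpa using der_mem hV hV ζ hw) (V.smul_mem _ hv)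
    have hd : der ζ (α • (y * y) + y * v + w) = μ • y + u := by
      rw [map_add, map_add, Derivation.map_smul, der_mul_lin ζ hy hy, der_mul_lin ζ hy (hV hv),
        hu, hμ, map_add, smul_eval]
      module
    refine ⟨α * (μ ^ 2)⁻¹, ?_⟩
    have : α • (y * y) + y * v + w - (α * (μ ^ 2)⁻¹) • der ζ (α • (y * y) + y * v + w) ^ 2 =
        y * v + w - (α * (μ ^ 2)⁻¹) • (u * ((2 * μ) • y + u)) := by
      rw [hd, add_pow_two, smul_add, smul_add, smul_pow, smul_smul, mul_assoc α,
        inv_mul_cancel₀ (pow_ne_zero 2 hζ), mul_one]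
      simp only [smul_eq_C_mul, C_mul, map_ofNat]
      ring
    rw [this]
    exact Submodule.sub_mem _ (Submodule.add_mem _ hyv hwV) (Submodule.smul_mem _ _
      (Submodule.mul_mem_mul huV ((Lin n).add_mem ((Lin n).smul_mem _ hy) (hV huV))))

theorem RankOneAt.exists_eval {V : Submodule ℂ (Poly n)} (hV : V ≤ Lin n) {p : Poly n}
    (hp : p.IsHomogeneous 2) {ζ : Fin n → ℂ} (h : RankOneAt V p ζ) :
    ∃ α : ℂ, ∀ e, (∀ v ∈ V, eval e v = 0) →
      eval (ζ + e) p = eval ζ p + eval e (der ζ p) + α * eval e (der ζ p) ^ 2 ∧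
      der e p - (2 * α * eval e (der ζ p)) • der ζ p ∈ V := by
  obtain ⟨α, hα⟩ := h
  have hL := der_quad ζ hp
  refine ⟨α, fun e he => ⟨?_, ?_⟩⟩
  · have h1 := eval_mul_eq_zero he hα
    rw [map_sub, smul_eval, map_pow] at h1
    rw [eval_add_quad hp, eval_der_comm hp]
    linear_combination h1
  · have h1 := der_mem_left hV le_rfl he hα
    rw [map_sub, Derivation.map_smul, pow_two, der_mul_lin e hL hL, ← add_smul, smul_smul] at h1
    convert h1 using 3
    ring

/-- Eliminating along the direction `e` from two members of a configuration. -/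
theorem IsConfig.exists_eliminant {Q : ι → Poly n} (hQ : IsConfig Q) {i k : ι} (hik : i ≠ k)
    {e : Fin n → ℂ} (he : der e (Q i) ≠ 0) : ∃ Δ : Poly n, Δ ≠ 0 ∧
      ∀ (ζ : Fin n → ℂ) (t : ℂ), eval (ζ + t • e) (Q i) = 0 →
        eval (ζ + t • e) (Q k) = 0 → eval ζ Δ = 0 := by
  have hf := hQ.quad i
  have hg := hQ.quad k
  have hne := hQ.ne_smul hik
  have hb := der_quad e hf
  have hsmul : ∀ {h : Poly n}, h.IsHomogeneous 2 → Q i ∣ h → ∃ c : ℂ, h = c • Q i :=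
    fun hh hd => exists_smul_of_dvd hf hh (hQ.ne_zero hik.symm) hd
  have hprime : Irreducible (Q i) → Prime (Q i) := UniqueFactorizationMonoid.irreducible_iff_prime.1
  have hgen := fun (ζ : Fin n → ℂ) (t : ℂ) =>
    And.intro (eval_add_smul_quad hf ζ e t) (eval_add_smul_quad hg ζ e t)
  by_cases hc : eval e (Q i) = 0
  · refine ⟨C (eval e (Q k)) * Q i ^ 2 - Q i * der e (Q i) * der e (Q k) + der e (Q i) ^ 2 * Q k,
      fun h0 => ?_, fun ζ t h1 h2 => ?_⟩
    · rcases hQ.irr_or_sq i with hi | ⟨ℓ, hℓ, ei⟩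
      · have hd : Q i ∣ der e (Q i) ^ 2 * Q k :=
          ⟨der e (Q i) * der e (Q k) - C (eval e (Q k)) * Q i, by linear_combination h0⟩
        rcases (hprime hi).dvd_or_dvd hd with h | h
        · obtain ⟨c, hc⟩ := hsmul (pow_two (der e (Q i)) ▸ mul_quad hb hb) h
          have hc0 : c ≠ 0 := by
            rintro rfl
            rw [zero_smul] at hc
            exact he (pow_eq_zero_iff two_ne_zero |>.1 hc)
          refine not_irreducible_mul_lin ((Lin n).smul_mem c⁻¹ hb) hb ?_
          rwa [smul_mul_assoc, ← pow_two, hc, smul_smul, inv_mul_cancel₀ hc0, one_smul]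
        · obtain ⟨c, hc⟩ := hsmul hg h
          exact hne c hc
      · rw [ei, map_pow] at hc
        apply he
        rw [ei, pow_two, der_mul_lin e hℓ hℓ, pow_eq_zero_iff two_ne_zero |>.1 hc, zero_smul,
          add_zero]
    · rw [(hgen ζ t).1, hc] at h1
      rw [(hgen ζ t).2] at h2
      simp only [map_add, map_sub, map_mul, map_pow, eval_C]
      linear_combination (eval e (Q k) * (eval ζ (Q i) - t * eval ζ (der e (Q i))) -
        eval ζ (der e (Q i)) * eval ζ (der e (Q k))) * h1 + eval ζ (der e (Q i)) ^ 2 * h2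
  · set c := eval e (Q i) with hc'
    set r := eval e (Q k) * c⁻¹ with hr
    set h := Q k - r • Q i with hh
    have hhq : h.IsHomogeneous 2 := hg.sub (smul_quad r hf)
    have hβ := der_quad e hhq
    have hhe : eval e h = 0 := by
      rw [hh, map_sub, smul_eval, ← hc', hr, mul_assoc, inv_mul_cancel₀ hc]; ring
    have hhne : ∀ κ : ℂ, h ≠ κ • Q i := fun κ e' => hne (κ + r) (by
      rw [add_smul, ← e', hh, sub_add_cancel])
    refine ⟨C c * h ^ 2 - der e (Q i) * der e h * h + der e h ^ 2 * Q i, fun h0 => ?_,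
      fun ζ t h1 h2 => ?_⟩
    · rcases hQ.irr_or_sq i with hi | ⟨ℓ, hℓ, ei⟩
      · have hd : Q i ∣ h * (C c * h - der e (Q i) * der e h) :=
          ⟨-der e h ^ 2, by linear_combination h0⟩
        rcases (hprime hi).dvd_or_dvd hd with h1 | h1
        · obtain ⟨κ, hκ⟩ := hsmul hhq h1
          exact hhne κ hκ
        · have hq : (C c * h - der e (Q i) * der e h).IsHomogeneous 2 := by
            rw [C_mul']; exact (smul_quad c hhq).sub (mul_quad hb hβ)
          obtain ⟨κ, hκ⟩ := hsmul hq h1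
          have e1 : C κ * (der e (Q i) * der e h + C κ * Q i) = -(C c * der e h ^ 2) := by
            refine mul_right_cancel₀ hi.ne_zero ?_
            rw [smul_eq_C_mul] at hκ
            linear_combination C c * h0 - (C c * h + C κ * Q i) * hκ
          rcases eq_or_ne κ 0 with rfl | hκ0
          · rw [C_0, zero_mul, zero_eq_neg, mul_eq_zero, pow_eq_zero_iff two_ne_zero,
              C_eq_zero] at e1
            rw [e1.resolve_left hc, mul_zero, sub_zero, zero_smul, mul_eq_zero, C_eq_zero] at hκ
            exact hhne 0 (by rw [hκ.resolve_left hc, zero_smul])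
          · refine not_irreducible_mul_lin ((Lin n).smul_mem (-(κ ^ 2)⁻¹) hβ)
              ((Lin n).add_mem ((Lin n).smul_mem c hβ) ((Lin n).smul_mem κ hb)) ?_
            convert hi using 1
            have e2 : Q i = (κ ^ 2)⁻¹ • (κ ^ 2) • Q i := by
              rw [smul_smul, inv_mul_cancel₀ (pow_ne_zero 2 hκ0), one_smul]
            refine Eq.trans ?_ e2.symm
            simp only [smul_eq_C_mul, C_neg, C_pow]
            linear_combination -(C (κ ^ 2)⁻¹) * e1
      · have e1 : der e (Q i) = (2 * eval e ℓ) • ℓ := by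
          rw [ei, pow_two, der_mul_lin e hℓ hℓ, ← add_smul, two_mul]
        have e2 : c = eval e ℓ ^ 2 := by rw [hc', ei, map_pow]
        have hs : eval e ℓ ≠ 0 := fun h => hc (by rw [e2, h]; ring)
        have e3 : (C (eval e ℓ) * h - der e h * ℓ) ^ 2 = 0 := by
          rw [e1, e2, ei, smul_eq_C_mul, C_mul, C_pow, map_ofNat] at h0
          linear_combination h0
        have e4 : C (eval e ℓ) * h = der e h * ℓ := by
          linear_combination (pow_eq_zero_iff two_ne_zero).1 e3
        have e5 : h = (eval e ℓ)⁻¹ • (der e h * ℓ) := by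
          rw [← e4, C_mul', smul_smul, inv_mul_cancel₀ hs, one_smul]
        refine hQ.ne_mul_of_sq hik.symm hℓ (b := r • ℓ + (eval e ℓ)⁻¹ • der e h)
          ((Lin n).add_mem ((Lin n).smul_mem _ hℓ) ((Lin n).smul_mem _ hβ)) ei ?_
        calc Q k = h + r • Q i := by rw [hh, sub_add_cancel]
          _ = (eval e ℓ)⁻¹ • (der e h * ℓ) + r • ℓ ^ 2 := by rw [← e5, ei]
          _ = _ := by simp only [smul_eq_C_mul]; ring
    · have h3 := eval_add_smul_quad hhq ζ e t
      rw [hhe, hh, map_sub, smul_eval, h1, h2, ← hh] at h3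
      rw [(hgen ζ t).1] at h1
      simp only [map_add, map_sub, map_mul, map_pow, eval_C]
      linear_combination eval ζ (der e h) ^ 2 * h1 - (c * (eval ζ h - t * eval ζ (der e h)) -
        eval ζ (der e (Q i)) * eval ζ (der e h)) * h3

section Quotient
variable {V : Submodule ℂ (Poly n)} {x y z : Poly n} {e : Fin n → ℂ}

theorem eval_of_mkQ_eq (he : ∀ v ∈ V, eval e v = 0) {a b : ℂ}
    (h : V.mkQ z = a • V.mkQ x + b • V.mkQ y) : eval e z = a * eval e x + b * eval e y := by
  have h1 : z - (a • x + b • y) ∈ V := by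
    rw [← Submodule.ker_mkQ V, LinearMap.mem_ker, map_sub, map_add, map_smul, map_smul, h, sub_self]
  have h2 := he _ h1
  rw [map_sub, map_add, smul_eval, smul_eval] at h2
  linear_combination h2

theorem exists_mkQ_eq_of_mem (h : z ∈ V ⊔ Submodule.span ℂ {x, y}) :
    ∃ a b : ℂ, V.mkQ z = a • V.mkQ x + b • V.mkQ y := by
  obtain ⟨v, hv, w, hw, rfl⟩ := Submodule.mem_sup.1 h
  obtain ⟨a, b, rfl⟩ := Submodule.mem_span_pair.1 hw
  have hv0 : V.mkQ v = 0 := by rwa [← LinearMap.mem_ker, Submodule.ker_mkQ]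
  exact ⟨a, b, by rw [map_add, hv0, zero_add, map_add, map_smul, map_smul]⟩

theorem sup_span_pair_le (hV : V ≤ Lin n) (hx : x ∈ Lin n) (hy : y ∈ Lin n) :
    V ⊔ Submodule.span ℂ {x, y} ≤ Lin n := by
  refine sup_le hV (Submodule.span_le.2 ?_)
  rintro _ (rfl | rfl)
  exacts [hx, hy]

theorem exists_point_one_zero (hV : V ≤ Lin n) (hx : x ∈ Lin n) (hy : y ∈ Lin n)
    (h : LinearIndependent ℂ ![V.mkQ x, V.mkQ y]) :
    ∃ e : Fin n → ℂ, (∀ v ∈ V, eval e v = 0) ∧ eval e x = 1 ∧ eval e y = 0 := by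
  rw [LinearIndependent.pair_iff] at h
  obtain ⟨e, h1, h2⟩ := exists_point_of_notMem (sup_span_pair_le hV hy hy) hx fun hm => by
    obtain ⟨a, b, hab⟩ := exists_mkQ_eq_of_mem hm
    have := (h 1 (-(a + b)) (by rw [hab]; module)).1
    exact one_ne_zero this
  exact ⟨e, fun v hv => h1 v (Submodule.mem_sup_left hv), h2,
    h1 y (Submodule.mem_sup_right (Submodule.subset_span (Set.mem_insert _ _)))⟩

theorem exists_point_pair (hV : V ≤ Lin n) (hx : x ∈ Lin n) (hy : y ∈ Lin n)
    (h : LinearIndependent ℂ ![V.mkQ x, V.mkQ y]) (a b : ℂ) :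
    ∃ e : Fin n → ℂ, (∀ v ∈ V, eval e v = 0) ∧ eval e x = a ∧ eval e y = b := by
  obtain ⟨d, hd, hdx, hdy⟩ := exists_point_one_zero hV hx hy h
  obtain ⟨d', hd', hdy', hdx'⟩ :=
    exists_point_one_zero hV hy hx (LinearIndependent.pair_symm_iff.1 h)
  have key : ∀ {w : Poly n}, w ∈ Lin n →
      eval (a • d + b • d') w = a * eval d w + b * eval d' w := fun hw => by
    rw [eval_add_lin hw, eval_smul_lin hw, eval_smul_lin hw]
  refine ⟨a • d + b • d', fun v hv => ?_, ?_, ?_⟩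
  · rw [key (hV hv), hd v hv, hd' v hv]; ring
  · rw [key hx, hdx, hdx']; ring
  · rw [key hy, hdy, hdy']; ring

end Quotient

/-- Two members of a configuration have no common zero on a generic fibre of `V` on which they
depend on the same form. -/
theorem IsConfig.exists_fibre_coprime {Q : ι → Poly n} (hQ : IsConfig Q) {i k : ι} (hik : i ≠ k)
    {V : Submodule ℂ (Poly n)} (hV : V ≤ Lin n) : ∃ Δ : Poly n, Δ ≠ 0 ∧
      ∀ ζ, eval ζ Δ ≠ 0 → RankOneAt V (Q i) ζ → RankOneAt V (Q k) ζ → der ζ (Q i) ∉ V →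
        ∀ c : ℂ, V.mkQ (der ζ (Q k)) = c • V.mkQ (der ζ (Q i)) →
        ∀ e, (∀ v ∈ V, eval e v = 0) → eval (ζ + e) (Q i) = 0 → eval (ζ + e) (Q k) ≠ 0 := by
  by_cases h : ∀ ζ, der ζ (Q i) ∈ V
  · exact ⟨1, one_ne_zero, fun ζ _ _ _ hi => absurd (h ζ) hi⟩
  push Not at h
  obtain ⟨ζ₀, h⟩ := h
  obtain ⟨d, hd, hd1⟩ := exists_point_of_notMem hV (der_quad ζ₀ (hQ.quad i)) h
  have hne : der d (Q i) ≠ 0 := fun h0 => by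
    rw [← eval_der_comm (hQ.quad i), h0, map_zero] at hd1
    exact zero_ne_one hd1
  obtain ⟨Δ, hΔ, hΔ'⟩ := hQ.exists_eliminant hik hne
  refine ⟨Δ * der d (Q i), mul_ne_zero hΔ hne, fun ζ hζ hi hk _ c hc e he h1 h2 => ?_⟩
  rw [map_mul, eval_der_comm (hQ.quad i)] at hζ
  have hβ := right_ne_zero_of_mul hζ
  obtain ⟨α, hα⟩ := hi.exists_eval hV (hQ.quad i)
  obtain ⟨γ, hγ⟩ := hk.exists_eval hV (hQ.quad k)
  have hc' : ∀ e', (∀ v ∈ V, eval e' v = 0) →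
      eval e' (der ζ (Q k)) = c * eval e' (der ζ (Q i)) := fun e' he' => by
    have := eval_of_mkQ_eq (x := der ζ (Q i)) (y := 0) (b := 0) he' (by simpa using hc)
    simpa using this
  set t := eval e (der ζ (Q i)) / eval d (der ζ (Q i)) with ht
  have htd : ∀ v ∈ V, eval (t • d) v = 0 := fun v hv => by
    rw [eval_smul_lin (hV hv), hd v hv, mul_zero]
  have hte : eval (t • d) (der ζ (Q i)) = eval e (der ζ (Q i)) := by
    rw [eval_smul_lin (der_quad ζ (hQ.quad i)), ht, div_mul_cancel₀ _ hβ]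
  refine left_ne_zero_of_mul hζ (hΔ' ζ t ?_ ?_)
  · rw [← h1, (hα _ htd).1, (hα e he).1, hte]
  · rw [← h2, (hγ _ htd).1, (hγ e he).1, hc' _ htd, hc' e he, hte]

theorem exists_root_add_sq (c α : ℂ) : ∃ t : ℂ, c + t + α * t ^ 2 = 0 := by
  rcases eq_or_ne α 0 with rfl | hα
  · exact ⟨-c, by ring⟩
  · obtain ⟨s, hs⟩ := IsAlgClosed.exists_pow_nat_eq (1 - 4 * α * c) (n := 2) two_pos
    refine ⟨(s - 1) / (2 * α), ?_⟩
    field_simp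
    linear_combination hs

theorem exists_notRoot_add_sq (c α : ℂ) : ∃ t : ℂ, c + t + α * t ^ 2 ≠ 0 := by
  by_contra! h
  have h0 := h 0
  have h1 := h 1
  have h2 := h (-1)
  have : (2 : ℂ) = 0 := by linear_combination h1 - h2
  exact two_ne_zero this

/-- If `Q i` and `Q j` depend on independent forms on a generic fibre of `V`, a third
member vanishing on their common zeros depends on a proper combination of these forms. -/
theorem IsConfig.exists_relation {Q : ι → Poly n} (hQ : IsConfig Q) {i j k : ι}
    (hki : k ≠ i) (hkj : k ≠ j)
    (hv : ∀ a, eval a (Q i) = 0 → eval a (Q j) = 0 → eval a (Q k) = 0)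
    {V : Submodule ℂ (Poly n)} (hV : V ≤ Lin n) : ∃ Δ : Poly n, Δ ≠ 0 ∧
      ∀ ζ, eval ζ Δ ≠ 0 → RankOneAt V (Q i) ζ → RankOneAt V (Q j) ζ → RankOneAt V (Q k) ζ →
        LinearIndependent ℂ ![V.mkQ (der ζ (Q i)), V.mkQ (der ζ (Q j))] →
        ∃ a b : ℂ, a ≠ 0 ∧ b ≠ 0 ∧
          V.mkQ (der ζ (Q k)) = a • V.mkQ (der ζ (Q i)) + b • V.mkQ (der ζ (Q j)) := by
  obtain ⟨Δ, hΔ, h1⟩ := hQ.exists_fibre_coprime hki.symm hV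
  obtain ⟨Δ', hΔ', h2⟩ := hQ.exists_fibre_coprime hkj.symm hV
  refine ⟨Δ * Δ', mul_ne_zero hΔ hΔ', fun ζ hζ hi hj hk hij => ?_⟩
  rw [map_mul] at hζ
  obtain ⟨α, hα⟩ := hi.exists_eval hV (hQ.quad i)
  obtain ⟨β, hβ⟩ := hj.exists_eval hV (hQ.quad j)
  obtain ⟨γ, hγ⟩ := hk.exists_eval hV (hQ.quad k)
  have hiL := der_quad ζ (hQ.quad i)
  have hjL := der_quad ζ (hQ.quad j)
  have hkL := der_quad ζ (hQ.quad k)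
  obtain ⟨s, hs⟩ := exists_root_add_sq (eval ζ (Q i)) α
  obtain ⟨t, ht⟩ := exists_root_add_sq (eval ζ (Q j)) β
  obtain ⟨e, he, hes, het⟩ := exists_point_pair hV hiL hjL hij s t
  have hei : eval (ζ + e) (Q i) = 0 := by rw [(hα e he).1, hes, hs]
  have hej : eval (ζ + e) (Q j) = 0 := by rw [(hβ e he).1, het, ht]
  by_cases hm : der ζ (Q k) ∈ V ⊔ Submodule.span ℂ {der ζ (Q i), der ζ (Q j)}
  · obtain ⟨a, b, hab⟩ := exists_mkQ_eq_of_mem hm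
    have hne : ∀ {f : Poly n}, V.mkQ f ≠ 0 → f ∉ V := fun h hf => h (by
      rwa [← LinearMap.mem_ker, Submodule.ker_mkQ])
    refine ⟨a, b, ?_, ?_, hab⟩
    · rintro rfl
      exact h2 ζ (right_ne_zero_of_mul hζ) hj hk (hne (hij.ne_zero 1)) b
        (by rw [hab, zero_smul, zero_add]) e he hej (hv _ hei hej)
    · rintro rfl
      exact h1 ζ (left_ne_zero_of_mul hζ) hi hk (hne (hij.ne_zero 0)) a
        (by rw [hab, zero_smul, add_zero]) e he hei (hv _ hei hej)
  · obtain ⟨d, hd, hdk⟩ := exists_point_of_notMem (sup_span_pair_le hV hiL hjL) hkL hm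
    have hdV : ∀ v ∈ V, eval d v = 0 := fun v hv => hd v (Submodule.mem_sup_left hv)
    obtain ⟨u, hu⟩ := exists_notRoot_add_sq (eval ζ (Q k)) γ
    have hdi := hd _ (Submodule.mem_sup_right (Submodule.subset_span (Set.mem_insert _ _)))
    have hdj := hd _ (Submodule.mem_sup_right
      (Submodule.subset_span (Set.mem_insert_of_mem _ (Set.mem_singleton _))))
    set w := e + (u - eval e (der ζ (Q k))) • d with hw
    have key : ∀ {f : Poly n}, f ∈ Lin n →
        eval w f = eval e f + (u - eval e (der ζ (Q k))) * eval d f := fun hf => by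
      rw [hw, eval_add_lin hf, eval_smul_lin hf]
    have hwV : ∀ v ∈ V, eval w v = 0 := fun v hv => by
      rw [key (hV hv), he v hv, hdV v hv, mul_zero, add_zero]
    refine absurd (hv (ζ + w) ?_ ?_) ?_
    · rw [(hα w hwV).1, key hiL, hdi, hes, mul_zero, add_zero, hs]
    · rw [(hβ w hwV).1, key hjL, hdj, het, mul_zero, add_zero, ht]
    · rw [(hγ w hwV).1, key hkL, hdk, mul_one, add_sub_cancel]
      exact hu

/-- A decomposition of the quadratics `Q i` into members of a regular space `𝒬` and quadratics
that depend on one form modulo `V`. -/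
structure Splitting (V 𝒬 : Submodule ℂ (Poly n)) (s : ℕ) (Q q p : ι → Poly n) : Prop where
  le : V ≤ Lin n
  regular : Regular 𝒬 (3 * s + 3)
  mem : ∀ i, q i ∈ 𝒬
  eq_add : ∀ i, Q i = q i + p i
  quad : ∀ i, (p i).IsHomogeneous 2
  low : ∀ i, LowRank s (p i)
  form : ∀ i, p i ∈ V * Lin n ∨
    ∃ y ∈ Lin n, p i ∈ (V ⊔ Submodule.span ℂ {y}) * (V ⊔ Submodule.span ℂ {y})

namespace Splitting
variable {V 𝒬 : Submodule ℂ (Poly n)} {s : ℕ} {Q q p : ι → Poly n}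

theorem eq_zero_of_lowRank (h : Splitting V 𝒬 s Q q p) {i : ι} {t : ℕ} (hi : LowRank t (Q i))
    (ht : t ≤ 2 * s + 3) : q i = 0 :=
  h.regular.eq_zero (h.mem i) (hi.add ((h.low i).smul (-1))) (by omega)
    (by rw [h.eq_add i]; module)

theorem irreducible_of_ne (h : Splitting V 𝒬 s Q q p) (hQ : IsConfig Q) {i : ι} (hi : q i ≠ 0) :
    Irreducible (Q i) :=
  (hQ.irr_or_sq i).resolve_right fun ⟨_, hℓ, e⟩ =>
    hi (h.eq_zero_of_lowRank (e ▸ LowRank.sq hℓ) (by omega))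

theorem eq_add_of_eq_add (h : Splitting V 𝒬 s Q q p) {i j k : ι} {a b : ℂ} {f : Poly n}
    (hf : LowRank 1 f) (e : Q k = a • Q i + b • Q j + f) : p k = a • p i + b • p j + f := by
  have h1 : q k - a • q i - b • q j = 0 := by
    refine h.regular.eq_zero (𝒬.sub_mem (𝒬.sub_mem (h.mem k) (𝒬.smul_mem a (h.mem i)))
      (𝒬.smul_mem b (h.mem j))) ((((h.low i).smul a).add ((h.low j).smul b)).add
      (((h.low k).smul (-1)).add hf)) (by omega) ?_
    rw [h.eq_add i, h.eq_add j, h.eq_add k] at e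
    linear_combination (norm := module) e
  rw [h.eq_add i, h.eq_add j, h.eq_add k] at e
  linear_combination (norm := module) e - h1

theorem exists_relation_of_eq_zero (h : Splitting V 𝒬 s Q q p) (hQ : IsConfig Q) {i j k : ι}
    (hki : k ≠ i) (hkj : k ≠ j)
    (hv : ∀ a, eval a (Q i) = 0 → eval a (Q j) = 0 → eval a (Q k) = 0)
    (hi : q i = 0) (hj : q j = 0) : ∃ Δ : Poly n, Δ ≠ 0 ∧
      ∀ ζ, eval ζ Δ ≠ 0 → RankOneAt V (p i) ζ → RankOneAt V (p j) ζ → RankOneAt V (p k) ζ →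
        LinearIndependent ℂ ![V.mkQ (der ζ (p i)), V.mkQ (der ζ (p j))] →
        ∃ a b : ℂ, a ≠ 0 ∧ b ≠ 0 ∧
          V.mkQ (der ζ (p k)) = a • V.mkQ (der ζ (p i)) + b • V.mkQ (der ζ (p j)) := by
  have hk : q k = 0 := by
    obtain ⟨X, hX, hXs, hXi⟩ := h.low i
    obtain ⟨Y, hY, hYs, hYj⟩ := h.low j
    have := finiteDimensional_of_le hX
    have := finiteDimensional_of_le hY
    refine h.eq_zero_of_lowRank (t := 2 * s) ⟨X ⊔ Y, sup_le hX hY, ?_, ?_⟩ (by omega)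
    · have := Submodule.finrank_add_le_finrank_add_finrank X Y
      omega
    · refine mem_mul_lin_of_vanish (sup_le hX hY) (hQ.quad k) fun d hd => hv d ?_ ?_
      · rw [h.eq_add i, hi, zero_add]
        exact eval_mul_eq_zero (fun x hx => hd x (Submodule.mem_sup_left hx)) hXi
      · rw [h.eq_add j, hj, zero_add]
        exact eval_mul_eq_zero (fun x hx => hd x (Submodule.mem_sup_right hx)) hYj
  have e : ∀ {l : ι}, q l = 0 → p l = Q l := fun {l} hl => by rw [h.eq_add l, hl, zero_add]
  rw [e hi, e hj, e hk]
  exact hQ.exists_relation hki hkj hv h.le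

end Splitting

section Fibre
variable {V : Submodule ℂ (Poly n)} {f g ℓ : Poly n} {ζ : Fin n → ℂ}

theorem RankOneAt.exists_der (hV : V ≤ Lin n) (hf : f.IsHomogeneous 2) (h : RankOneAt V f ζ) :
    ∃ α : ℂ, ∀ e, (∀ v ∈ V, eval e v = 0) →
      V.mkQ (der e f) = (α * eval e (der ζ f)) • V.mkQ (der ζ f) := by
  obtain ⟨α, hα⟩ := h.exists_eval hV hf
  refine ⟨2 * α, fun e he => ?_⟩
  rw [← sub_eq_zero, ← map_smul, ← map_sub, ← LinearMap.mem_ker, Submodule.ker_mkQ]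
  exact (hα e he).2

theorem not_linearIndependent_of_add_sq (hV : V ≤ Lin n) (hf : f.IsHomogeneous 2)
    (hℓ : ℓ ∈ Lin n) {c : ℂ} (hc : c ≠ 0) (hg : g = c • f + ℓ ^ 2) (h1 : RankOneAt V f ζ)
    (h2 : RankOneAt V g ζ) : ¬ LinearIndependent ℂ ![V.mkQ (der ζ f), V.mkQ (der ζ g)] := by
  intro hI
  have hgq : g.IsHomogeneous 2 := hg ▸ (smul_quad c hf).add (sq_quad hℓ)
  have hd : ∀ e, V.mkQ (der e g) = c • V.mkQ (der e f) + (2 * eval e ℓ) • V.mkQ ℓ := fun e => by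
    rw [hg, map_add, Derivation.map_smul, pow_two, der_mul_lin e hℓ hℓ, map_add, map_add, map_smul,
      map_smul, ← add_smul, two_mul]
  have hp := LinearIndependent.pair_iff.1 hI
  obtain ⟨α, hα⟩ := h1.exists_der hV hf
  obtain ⟨β, hβ⟩ := h2.exists_der hV hgq
  by_cases hℓV : ℓ ∈ V
  · have h0 : V.mkQ ℓ = 0 := by rwa [← LinearMap.mem_ker, Submodule.ker_mkQ]
    have := (hp c (-1) (by rw [hd ζ, h0]; module)).2
    exact neg_ne_zero.2 one_ne_zero this
  obtain ⟨d, hdV, hdℓ⟩ := exists_point_of_notMem hV hℓ hℓV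
  obtain ⟨s, t, hst⟩ : ∃ s t : ℂ, V.mkQ ℓ = s • V.mkQ (der ζ f) + t • V.mkQ (der ζ g) := by
    have := hd d
    rw [hα d hdV, hβ d hdV, hdℓ] at this
    refine ⟨-((2 : ℂ)⁻¹ * c * (α * eval d (der ζ f))), (2 : ℂ)⁻¹ * (β * eval d (der ζ g)), ?_⟩
    linear_combination (norm := module) (-(2 : ℂ)⁻¹) • this
  obtain ⟨e, he, hef, heg⟩ := exists_point_pair hV (der_quad ζ hf) (der_quad ζ hgq) hI 1 0
  have heℓ : eval e ℓ = s := by rw [eval_of_mkQ_eq he hst, hef, heg]; ring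
  have h3 := hd e
  rw [hα e he, hβ e he, hef, heg, heℓ, hst] at h3
  have h4 := (hp (c * α + 2 * s * s) (2 * s * t) (by
    linear_combination (norm := module) -h3)).2
  have h5 := hd ζ
  rw [hst] at h5
  have h6 := hp (c + 2 * eval ζ ℓ * s) (2 * eval ζ ℓ * t - 1) (by
    linear_combination (norm := module) -h5)
  rcases mul_eq_zero.1 h4 with h4 | rfl
  · have hs : s = 0 := by simpa using h4
    rw [hs, mul_zero, add_zero] at h6
    exact hc h6.1
  · have := h6.2
    rw [mul_zero, zero_sub] at this
    exact neg_ne_zero.2 one_ne_zero this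

theorem exists_relation_of_add_mul (hV : V ≤ Lin n) (hf : f.IsHomogeneous 2) (hℓ : ℓ ∈ Lin n)
    {b : Poly n} (hb : b ∈ Lin n) {c : ℂ} (hc : c ≠ 0) (hg : g = c • f + ℓ * b)
    (hζ : eval ζ b ≠ 0) (h1 : RankOneAt V f ζ) (h2 : RankOneAt V g ζ)
    (hI : LinearIndependent ℂ ![V.mkQ (der ζ f), V.mkQ ℓ]) :
    ∃ x y : ℂ, x ≠ 0 ∧ y ≠ 0 ∧ V.mkQ (der ζ g) = x • V.mkQ (der ζ f) + y • V.mkQ ℓ := by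
  have hgq : g.IsHomogeneous 2 := hg ▸ (smul_quad c hf).add (mul_quad hℓ hb)
  have hd : ∀ e, V.mkQ (der e g) =
      c • V.mkQ (der e f) + eval e ℓ • V.mkQ b + eval e b • V.mkQ ℓ := fun e => by
    rw [hg, map_add, Derivation.map_smul, der_mul_lin e hℓ hb, map_add, map_add, map_smul,
      map_smul, map_smul]
    module
  have hp := LinearIndependent.pair_iff.1 hI
  have hfL := der_quad ζ hf
  obtain ⟨α, hα⟩ := h1.exists_der hV hf
  obtain ⟨β, hβ⟩ := h2.exists_der hV hgq
  have hdg : ∀ e, (∀ v ∈ V, eval e v = 0) → eval e (der ζ g) =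
      c * eval e (der ζ f) + eval ζ ℓ * eval e b + eval ζ b * eval e ℓ := fun e he => by
    have : V.mkQ (der ζ g) = (1 : ℂ) • V.mkQ (c • der ζ f + eval ζ ℓ • b) + eval ζ b • V.mkQ ℓ := by
      rw [hd ζ, one_smul, map_add, map_smul, map_smul]
    rw [eval_of_mkQ_eq he this, map_add, smul_eval, smul_eval, one_mul]
  obtain ⟨s, t, hst⟩ : ∃ s t : ℂ, V.mkQ b = s • V.mkQ (der ζ f) + t • V.mkQ ℓ := by
    by_cases hm : b ∈ V ⊔ Submodule.span ℂ {der ζ f, ℓ}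
    · exact exists_mkQ_eq_of_mem hm
    obtain ⟨d, hdV, hdf, hdℓ⟩ := exists_point_pair hV hfL hℓ hI 0 1
    obtain ⟨d', hd', hdb'⟩ := exists_point_of_notMem (sup_span_pair_le hV hfL hℓ) hb hm
    have hd'f := hd' _ (Submodule.mem_sup_right (Submodule.subset_span (Set.mem_insert _ _)))
    have hd'ℓ := hd' _ (Submodule.mem_sup_right
      (Submodule.subset_span (Set.mem_insert_of_mem _ (Set.mem_singleton _))))
    have key : ∀ {w : Poly n}, w ∈ Lin n →
        eval (d + (-eval d b) • d') w = eval d w - eval d b * eval d' w := fun hw => by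
      rw [eval_add_lin hw, eval_smul_lin hw]; ring
    set e := d + (-eval d b) • d' with he
    have heV : ∀ v ∈ V, eval e v = 0 := fun v hv => by
      rw [key (hV hv), hdV v hv, hd' v (Submodule.mem_sup_left hv)]; ring
    have hef : eval e (der ζ f) = 0 := by rw [key hfL, hdf, hd'f]; ring
    have heℓ : eval e ℓ = 1 := by rw [key hℓ, hdℓ, hd'ℓ]; ring
    have heb : eval e b = 0 := by rw [key hb, hdb']; ring
    have h3 := hd e
    rw [hα e heV, hβ e heV, hdg e heV, hef, heℓ, heb, hd ζ] at h3
    by_cases h4 : 1 - β * eval ζ b * eval ζ ℓ = 0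
    · have h5 := (hp (β * eval ζ b * c) (β * eval ζ b * eval ζ b) (by
        have : (1 - β * eval ζ b * eval ζ ℓ) • V.mkQ b = 0 := by rw [h4, zero_smul]
        linear_combination (norm := module) h3 + this)).2
      have h6 : β * eval ζ b = 0 := (mul_eq_zero.1 h5).resolve_right hζ
      rw [h6, zero_mul, sub_zero] at h4
      exact absurd h4 one_ne_zero
    · refine ⟨(1 - β * eval ζ b * eval ζ ℓ)⁻¹ * (β * eval ζ b * c),
        (1 - β * eval ζ b * eval ζ ℓ)⁻¹ * (β * eval ζ b * eval ζ b), ?_⟩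
      have h5 : (1 - β * eval ζ b * eval ζ ℓ) • V.mkQ b =
          (β * eval ζ b * c) • V.mkQ (der ζ f) + (β * eval ζ b * eval ζ b) • V.mkQ ℓ := by
        linear_combination (norm := module) -h3
      exact (inv_smul_smul₀ h4 _).symm.trans (by rw [h5, smul_add, smul_smul, smul_smul])
  set L := eval ζ ℓ with hL
  have hx : V.mkQ (der ζ g) = (c + s * L) • V.mkQ (der ζ f) + (eval ζ b + t * L) • V.mkQ ℓ := by
    rw [hd ζ, hst]; module
  have hrel : ∀ e, (∀ v ∈ V, eval e v = 0) → ∀ A B : ℂ, eval e (der ζ f) = A → eval e ℓ = B →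
      c * α * A + B * s = β * ((c + s * L) * A + (eval ζ b + t * L) * B) * (c + s * L) ∧
      2 * t * B + s * A = β * ((c + s * L) * A + (eval ζ b + t * L) * B) * (eval ζ b + t * L) := by
    intro e he A B hA hB
    have h3 := hd e
    rw [hα e he, hβ e he, eval_of_mkQ_eq he hx, eval_of_mkQ_eq he hst, hA, hB, hst, hx] at h3
    have h4 := hp
      (c * α * A + B * s - β * ((c + s * L) * A + (eval ζ b + t * L) * B) * (c + s * L))
      (2 * t * B + s * A - β * ((c + s * L) * A + (eval ζ b + t * L) * B) * (eval ζ b + t * L))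
      (by linear_combination (norm := module) -h3)
    exact ⟨sub_eq_zero.1 h4.1, sub_eq_zero.1 h4.2⟩
  obtain ⟨e, he, hef, heℓ⟩ := exists_point_pair hV hfL hℓ hI 1 0
  obtain ⟨d, hdV, hdf, hdℓ⟩ := exists_point_pair hV hfL hℓ hI 0 1
  have r1 := (hrel e he 1 0 hef heℓ).2
  have r2 := (hrel d hdV 0 1 hdf hdℓ).2
  refine ⟨c + s * L, eval ζ b + t * L, fun h0 => ?_, fun h0 => ?_, hx⟩
  · rw [h0] at r1
    have : s = 0 := by linear_combination r1
    rw [this, zero_mul, add_zero] at h0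
    exact hc h0
  · rw [h0] at r2
    have : t = 0 := by linear_combination r2 / 2
    rw [this, zero_mul, add_zero] at h0
    exact hζ h0

end Fibre

namespace Splitting
variable {V 𝒬 : Submodule ℂ (Poly n)} {s : ℕ} {Q q p : ι → Poly n}

theorem exists_relation_of_ne (h : Splitting V 𝒬 s Q q p) (hQ : IsConfig Q) {i j k : ι}
    (hij : i ≠ j) (hki : k ≠ i) (hkj : k ≠ j)
    (hv : ∀ a, eval a (Q i) = 0 → eval a (Q j) = 0 → eval a (Q k) = 0)
    (hi : q i ≠ 0) : ∃ Δ : Poly n, Δ ≠ 0 ∧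
      ∀ ζ, eval ζ Δ ≠ 0 → RankOneAt V (p i) ζ → RankOneAt V (p j) ζ → RankOneAt V (p k) ζ →
        LinearIndependent ℂ ![V.mkQ (der ζ (p i)), V.mkQ (der ζ (p j))] →
        ∃ a b : ℂ, a ≠ 0 ∧ b ≠ 0 ∧
          V.mkQ (der ζ (p k)) = a • V.mkQ (der ζ (p i)) + b • V.mkQ (der ζ (p j)) := by
  have hlow : ∀ {t : ℕ}, LowRank t (Q i) → 2 * s + 3 < t := fun ht => by
    by_contra! hle
    exact hi (h.eq_zero_of_lowRank ht hle)
  rcases hQ.edge_cases (h.irreducible_of_ne hQ hi) hij hki hkj hv with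
    ⟨-, ⟨a, b, ha, hb, e⟩ | ⟨c, hc, ℓ, hℓ, e⟩ | ⟨v, hv, w, hw, hm, -⟩⟩ |
    ⟨ℓ, hℓ, -, ej, ⟨c, hc, b, hb, hb0, ek⟩ | ⟨b, hb, v, hv, e⟩⟩
  · have hp : p k = a • p i + b • p j := by
      have := h.eq_add_of_eq_add (i := i) (j := j) (k := k) (a := a) (b := b)
        (LowRank.zero.mono zero_le_one) (by rw [e, add_zero])
      rwa [add_zero] at this
    refine ⟨1, one_ne_zero, fun ζ _ _ _ _ _ => ⟨a, b, ha, hb, ?_⟩⟩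
    rw [hp, map_add, Derivation.map_smul, Derivation.map_smul, map_add, map_smul, map_smul]
  · have hp : p j = c • p i + ℓ ^ 2 := by
      have := h.eq_add_of_eq_add (i := i) (j := i) (k := j) (a := c) (b := 0)
        (LowRank.sq hℓ) (by rw [e, zero_smul, add_zero])
      rwa [zero_smul, add_zero] at this
    exact ⟨1, one_ne_zero, fun ζ _ h1 h2 _ hI =>
      absurd hI (not_linearIndependent_of_add_sq h.le (h.quad i) hℓ hc hp h1 h2)⟩
  · exact absurd (hlow (LowRank.of_pair hv hw hm)) (by omega)
  · have hj : p j = ℓ ^ 2 := by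
      have := h.eq_zero_of_lowRank (i := j) (ej ▸ LowRank.sq hℓ) (by omega)
      rw [← ej, h.eq_add j, this, zero_add]
    have hk : p k = c • p i + ℓ * b := by
      have := h.eq_add_of_eq_add (i := i) (j := i) (k := k) (a := c) (b := 0)
        (LowRank.mul hℓ hb) (by rw [ek, zero_smul, add_zero])
      rwa [zero_smul, add_zero] at this
    refine ⟨b, hb0, fun ζ hζ h1 _ h2 hI => ?_⟩
    have hd : V.mkQ (der ζ (p j)) = (2 * eval ζ ℓ) • V.mkQ ℓ := by
      rw [hj, pow_two, der_mul_lin ζ hℓ hℓ, ← add_smul, map_smul, two_mul]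
    have hp := LinearIndependent.pair_iff.1 hI
    have h0 : 2 * eval ζ ℓ ≠ 0 := fun h0 => by
      rw [h0, zero_smul] at hd
      exact one_ne_zero (hp 0 1 (by rw [hd, smul_zero, zero_smul, add_zero])).2
    have hℓd : V.mkQ ℓ = (2 * eval ζ ℓ)⁻¹ • V.mkQ (der ζ (p j)) := by
      rw [hd, inv_smul_smul₀ h0]
    obtain ⟨x, y, hx, hy, hxy⟩ := exists_relation_of_add_mul h.le (h.quad i) hℓ hb hc hk hζ h1 h2
      (LinearIndependent.pair_iff.2 fun x y hxy => by
        have := hp x (y * (2 * eval ζ ℓ)⁻¹) (by rw [mul_smul, ← hℓd, hxy])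
        exact ⟨this.1, (mul_eq_zero.1 this.2).resolve_right (inv_ne_zero h0)⟩)
    exact ⟨x, y * (2 * eval ζ ℓ)⁻¹, hx, mul_ne_zero hy (inv_ne_zero h0),
      by rw [mul_smul, ← hℓd, hxy]⟩
  · refine absurd (hlow (t := 2) ?_) (by omega)
    rw [e]
    exact (LowRank.mul hℓ hb).add (LowRank.sq hv)

theorem exists_relation (h : Splitting V 𝒬 s Q q p) (hQ : IsConfig Q) {i j k : ι}
    (hij : i ≠ j) (hki : k ≠ i) (hkj : k ≠ j)
    (hv : ∀ a, eval a (Q i) = 0 → eval a (Q j) = 0 → eval a (Q k) = 0) :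
    ∃ Δ : Poly n, Δ ≠ 0 ∧
      ∀ ζ, eval ζ Δ ≠ 0 → RankOneAt V (p i) ζ → RankOneAt V (p j) ζ → RankOneAt V (p k) ζ →
        LinearIndependent ℂ ![V.mkQ (der ζ (p i)), V.mkQ (der ζ (p j))] →
        ∃ a b : ℂ, a ≠ 0 ∧ b ≠ 0 ∧
          V.mkQ (der ζ (p k)) = a • V.mkQ (der ζ (p i)) + b • V.mkQ (der ζ (p j)) := by
  by_cases hi : q i = 0
  · by_cases hj : q j = 0
    · exact h.exists_relation_of_eq_zero hQ hki hkj hv hi hj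
    · obtain ⟨Δ, hΔ, h1⟩ := h.exists_relation_of_ne hQ hij.symm hkj hki
        (fun a h1 h2 => hv a h2 h1) hj
      refine ⟨Δ, hΔ, fun ζ hζ h2 h3 h4 hI => ?_⟩
      obtain ⟨a, b, ha, hb, e⟩ := h1 ζ hζ h3 h2 h4 (LinearIndependent.pair_symm_iff.1 hI)
      exact ⟨b, a, hb, ha, by rw [e, add_comm]⟩
  · exact h.exists_relation_of_ne hQ hij hki hkj hv hi

/-- At a generic point the forms on which the members depend span a space of bounded
dimension modulo `V`. -/
theorem exists_generic [Fintype ι] (h : Splitting V 𝒬 s Q q p) (hQ : IsConfig Q) :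
    ∃ Δ : Poly n, Δ ≠ 0 ∧ ∀ ζ, eval ζ Δ ≠ 0 → (∀ i, RankOneAt V (p i) ζ) ∧
      Module.finrank ℂ (Submodule.span ℂ (Set.range fun i => V.mkQ (der ζ (p i)))) ≤ 13 := by
  have hpair : ∀ x : ι × ι, ∃ Δ : Poly n, Δ ≠ 0 ∧ ∀ ζ, eval ζ Δ ≠ 0 →
      (∀ i, RankOneAt V (p i) ζ) →
      LinearIndependent ℂ ![V.mkQ (der ζ (p x.1)), V.mkQ (der ζ (p x.2))] →
      ∃ k, ∃ a b : ℂ, a ≠ 0 ∧ b ≠ 0 ∧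
        V.mkQ (der ζ (p k)) = a • V.mkQ (der ζ (p x.1)) + b • V.mkQ (der ζ (p x.2)) := by
    rintro ⟨i, j⟩
    rcases eq_or_ne i j with rfl | hij
    · refine ⟨1, one_ne_zero, fun ζ _ _ hI => ?_⟩
      have := (LinearIndependent.pair_iff.1 hI 1 (-1) (by module)).1
      exact absurd this one_ne_zero
    · obtain ⟨k, hki, hkj, hv⟩ := hQ.third i j hij
      obtain ⟨Δ, hΔ, h1⟩ := h.exists_relation hQ hij hki hkj hv
      exact ⟨Δ, hΔ, fun ζ hζ h2 hI => ⟨k, h1 ζ hζ (h2 i) (h2 j) (h2 k) hI⟩⟩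
  choose Δ hΔ h1 using hpair
  choose Γ hΓ h2 using fun i => exists_rankOneAt h.le (h.form i)
  refine ⟨(∏ i, Γ i) * ∏ x, Δ x, mul_ne_zero (Finset.prod_ne_zero_iff.2 fun i _ => hΓ i)
    (Finset.prod_ne_zero_iff.2 fun x _ => hΔ x), fun ζ hζ => ?_⟩
  rw [map_mul, map_prod, map_prod, mul_ne_zero_iff, Finset.prod_ne_zero_iff,
    Finset.prod_ne_zero_iff] at hζ
  have h3 := fun i => h2 i ζ (hζ.1 i (Finset.mem_univ i))
  refine ⟨h3, sylvester_gallai_of_linearIndependent _ fun i j hI => ?_⟩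
  obtain ⟨k, a, b, ha, hb, e⟩ := h1 (i, j) ζ (hζ.2 _ (Finset.mem_univ _)) h3 hI
  have hp := LinearIndependent.pair_iff.1 hI
  refine ⟨k, Submodule.mem_span_pair.2 ⟨a, b, e.symm⟩, ?_, ?_⟩
  · refine LinearIndependent.pair_iff.2 fun x y hxy => ?_
    have := hp (x + y * a) (y * b) (by
      simp only [e] at hxy
      linear_combination (norm := module) hxy)
    have hy : y = 0 := (mul_eq_zero.1 this.2).resolve_right hb
    rw [hy, zero_mul, add_zero] at this
    exact ⟨this.1, hy⟩
  · refine LinearIndependent.pair_iff.2 fun x y hxy => ?_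
    have := hp (y * a) (x + y * b) (by
      simp only [e] at hxy
      linear_combination (norm := module) hxy)
    have hy : y = 0 := (mul_eq_zero.1 this.1).resolve_right ha
    rw [hy, zero_mul, zero_mul, add_zero] at this
    exact ⟨this.2, hy⟩

end Splitting

theorem finrank_finset_sup_le {α E : Type*} [AddCommGroup E] [Module ℂ E] (S : Finset α)
    (A : α → Submodule ℂ E) [∀ a, FiniteDimensional ℂ (A a)] {c : ℕ}
    (h : ∀ a ∈ S, Module.finrank ℂ (A a) ≤ c) : Module.finrank ℂ ↥(S.sup A) ≤ S.card * c := by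
  classical
  induction S using Finset.induction_on with
  | empty => simp
  | insert a S ha ih =>
    rw [Finset.sup_insert, Finset.card_insert_of_notMem ha, add_mul, one_mul, add_comm]
    have := Submodule.finiteDimensional_finset_sup S A
    exact (Submodule.finrank_add_le_finrank_add_finrank _ _).trans
      (Nat.add_le_add (h a (Finset.mem_insert_self _ _))
        (ih fun b hb => h b (Finset.mem_insert_of_mem hb)))

theorem finrank_sup_le_finrank_map_mkQ {E : Type*} [AddCommGroup E] [Module ℂ E]
    (V A : Submodule ℂ E) [FiniteDimensional ℂ V] [FiniteDimensional ℂ A] :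
    Module.finrank ℂ ↥(V ⊔ A) ≤ Module.finrank ℂ V + Module.finrank ℂ ↥(A.map V.mkQ) := by
  have h1 := LinearMap.finrank_range_add_finrank_ker (V.mkQ.domRestrict (V ⊔ A))
  have h2 : LinearMap.range (V.mkQ.domRestrict (V ⊔ A)) = A.map V.mkQ := by
    rw [LinearMap.range_domRestrict, Submodule.map_sup, Submodule.mkQ_map_self, bot_sup_eq]
  have h3 : (LinearMap.ker (V.mkQ.domRestrict (V ⊔ A))).map (V ⊔ A).subtype ≤ V := by
    rintro _ ⟨x, hx, rfl⟩
    exact V.ker_mkQ.le (show (x : E) ∈ LinearMap.ker V.mkQ from hx)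
  have h4 := Submodule.finrank_mono h3
  rw [Submodule.finrank_map_subtype_eq] at h4
  rw [h2] at h1
  omega

theorem finrank_mul_self_le (A : Submodule ℂ (Poly n)) [FiniteDimensional ℂ A] :
    Module.finrank ℂ ↥(A * A) ≤ Module.finrank ℂ A * Module.finrank ℂ A := by
  rw [← Submodule.mulMap_range, ← Module.finrank_tensorProduct (R := ℂ) (S := ℂ)]
  exact LinearMap.finrank_range_le _

/-- Points dual to a basis of `V`, along which a nonvanishing polynomial stays nonzero. -/
theorem exists_points {V : Submodule ℂ (Poly n)} (hV : V ≤ Lin n) {Δ : Poly n} (hΔ : Δ ≠ 0) :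
    ∃ (ζ : Fin n → ℂ) (e : Fin (Module.finrank ℂ V) → Fin n → ℂ)
      (t : Fin (Module.finrank ℂ V) → ℂ), eval ζ Δ ≠ 0 ∧
      (∀ a, t a ≠ 0 ∧ eval (ζ + t a • e a) Δ ≠ 0) ∧
      ∀ d, ∃ c : Fin (Module.finrank ℂ V) → ℂ, ∀ v ∈ V, eval (d - ∑ a, c a • e a) v = 0 := by
  have := finiteDimensional_of_le hV
  set b := Module.finBasis ℂ V
  obtain ⟨ζ, hζ⟩ : ∃ ζ, eval ζ Δ ≠ 0 := by
    by_contra! h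
    exact hΔ (MvPolynomial.funext fun ζ => by rw [h, map_zero])
  have he : ∀ a, ∃ e : Fin n → ℂ, ∀ v : V, eval e v.1 = b.repr v a := fun a => by
    obtain ⟨ψ, hψ⟩ := (b.coord a).exists_extend
    obtain ⟨e, he⟩ := exists_point ψ
    refine ⟨e, fun v => ?_⟩
    rw [he _ (hV v.2), ← b.coord_apply, ← hψ]
    rfl
  choose e he using he
  have ht : ∀ a, ∃ t : ℂ, t ≠ 0 ∧ eval (ζ + t • e a) Δ ≠ 0 := fun a => by
    have hc : Continuous fun t : ℂ => eval (ζ + t • e a) Δ :=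
      (MvPolynomial.continuous_eval Δ).comp (by fun_prop)
    have h1 : ∀ᶠ t in nhds (0 : ℂ), eval (ζ + t • e a) Δ ≠ 0 :=
      hc.continuousAt.eventually_ne (by rwa [zero_smul, add_zero])
    obtain ⟨t, h2, h3⟩ := ((h1.filter_mono nhdsWithin_le_nhds).and
      (self_mem_nhdsWithin (s := {(0 : ℂ)}ᶜ))).exists
    exact ⟨t, h3, h2⟩
  choose t ht using ht
  refine ⟨ζ, e, t, hζ, ht, fun d => ⟨fun a => eval d (b a).1, ?_⟩⟩
  have hsum : ∀ v ∈ V, eval (∑ a, eval d (b a).1 • e a) v = ∑ a, eval d (b a).1 * eval (e a) v := by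
    intro v hv
    have hS : ∀ S : Finset (Fin (Module.finrank ℂ V)),
        eval (∑ a ∈ S, eval d (b a).1 • e a) v = ∑ a ∈ S, eval d (b a).1 * eval (e a) v := by
      intro S
      classical
      induction S using Finset.induction_on with
      | empty => simpa using eval_smul_lin (hV hv) 0 0
      | insert a S ha ih =>
        rw [Finset.sum_insert ha, Finset.sum_insert ha, eval_add_lin (hV hv),
          eval_smul_lin (hV hv), ih]
    exact hS _
  intro v hv
  have h1 : eval d v = ∑ a, b.repr ⟨v, hv⟩ a * eval d (b a).1 := by
    calc eval d v = eval d ((∑ a, b.repr ⟨v, hv⟩ a • b a : V) : Poly n) := by rw [b.sum_repr]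
      _ = _ := by simp only [Submodule.coe_sum, Submodule.coe_smul, map_sum, smul_eval]
  have h2 : d - ∑ a, eval d (b a).1 • e a = d + (-1 : ℂ) • ∑ a, eval d (b a).1 • e a := by
    module
  rw [h2, eval_add_lin (hV hv), eval_smul_lin (hV hv), hsum v hv, h1, neg_one_mul, ← sub_eq_add_neg,
    sub_eq_zero]
  exact Finset.sum_congr rfl fun a _ => by rw [he a ⟨v, hv⟩, mul_comm]

namespace Splitting
variable {V 𝒬 : Submodule ℂ (Poly n)} {s : ℕ} {Q q p : ι → Poly n}

theorem exists_mem_mul_self [Fintype ι] (h : Splitting V 𝒬 s Q q p) (hQ : IsConfig Q) :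
    ∃ Λ ≤ Lin n, Module.finrank ℂ Λ ≤
      (Module.finrank ℂ V + 1) * (Module.finrank ℂ V + 13) ∧ ∀ i, p i ∈ Λ * Λ := by
  obtain ⟨Δ, hΔ, hg⟩ := h.exists_generic hQ
  obtain ⟨ζ, e, t, hζ, ht, hd⟩ := exists_points h.le hΔ
  have := finiteDimensional_of_le h.le
  set z : Option (Fin (Module.finrank ℂ V)) → Fin n → ℂ :=
    fun a => a.elim ζ fun a => ζ + t a • e a with hz
  have hzΔ : ∀ a, eval (z a) Δ ≠ 0 := by
    rintro (_ | a)
    exacts [hζ, (ht a).2]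
  set A : Option (Fin (Module.finrank ℂ V)) → Submodule ℂ (Poly n) :=
    fun a => V ⊔ Submodule.span ℂ (Set.range fun i => der (z a) (p i)) with hA
  have hsL : ∀ a, Submodule.span ℂ (Set.range fun i => der (z a) (p i)) ≤ Lin n := fun a => by
    rw [Submodule.span_le]
    rintro _ ⟨i, rfl⟩
    exact der_quad _ (h.quad i)
  have hAL : ∀ a, A a ≤ Lin n := fun a => sup_le h.le (hsL a)
  have := fun a => finiteDimensional_of_le (hAL a)
  have hAr : ∀ a, Module.finrank ℂ (A a) ≤ Module.finrank ℂ V + 13 := fun a => by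
    have := finiteDimensional_of_le (hsL a)
    refine (finrank_sup_le_finrank_map_mkQ V _).trans (Nat.add_le_add_left ?_ _)
    rw [Submodule.map_span, ← Set.range_comp]
    exact (hg _ (hzΔ a)).2
  have hΛL : Finset.univ.sup A ≤ Lin n := Finset.sup_le fun a _ => hAL a
  have hAΛ : ∀ a, A a ≤ Finset.univ.sup A := fun a => Finset.le_sup (Finset.mem_univ a)
  have hzm : ∀ a i, der (z a) (p i) ∈ Finset.univ.sup A := fun a i =>
    hAΛ a (Submodule.mem_sup_right (Submodule.subset_span ⟨i, rfl⟩))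
  refine ⟨Finset.univ.sup A, hΛL, ?_, fun i => mem_mul_self_of_der hΛL (h.quad i) fun d => ?_⟩
  · refine (finrank_finset_sup_le Finset.univ A fun a _ => hAr a).trans ?_
    rw [Finset.card_univ, Fintype.card_option, Fintype.card_fin]
  set S : Submodule ℂ (Fin n → ℂ) :=
    { carrier := {d | der d (p i) ∈ Finset.univ.sup A}
      add_mem' := fun {x y} hx hy => by
        rw [Set.mem_ofPred_eq, der_add x y (h.quad i)]
        exact Submodule.add_mem _ hx hy
      zero_mem' := by
        rw [Set.mem_ofPred_eq, ← zero_smul ℂ (0 : Fin n → ℂ), der_smul _ _ (h.quad i), zero_smul]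
        exact Submodule.zero_mem _
      smul_mem' := fun c x hx => by
        rw [Set.mem_ofPred_eq, der_smul c x (h.quad i)]
        exact Submodule.smul_mem _ _ hx } with hS
  have heS : ∀ a, e a ∈ S := fun a => by
    have h1 : t a • e a ∈ S := by
      have := S.sub_mem (show z (some a) ∈ S from hzm (some a) i) (show z none ∈ S from hzm none i)
      simpa [hz] using this
    rwa [S.smul_mem_iff (ht a).1] at h1
  obtain ⟨c, hc⟩ := hd d
  have h1 : d - ∑ a, c a • e a ∈ S := by
    obtain ⟨α, hα⟩ := ((hg ζ hζ).1 i).exists_eval h.le (h.quad i)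
    have h2 := Submodule.add_mem _ (hAΛ none (Submodule.mem_sup_left (hα _ hc).2))
      (Submodule.smul_mem _ (2 * α * eval (d - ∑ a, c a • e a) (der ζ (p i))) (hzm none i))
    rwa [show z none = ζ from rfl, sub_add_cancel] at h2
  have h2 := S.add_mem h1 (S.sum_mem fun a (_ : a ∈ Finset.univ) => S.smul_mem (c a) (heS a))
  rw [sub_add_cancel] at h2
  exact h2

end Splitting

/-- The bound for the dimension of the span of a configuration whose members have rank at most `T`
modulo a space of quadratics of dimension at most `D`. -/
def dimBound (T D : ℕ) : ℕ :=
  1 + D + ((coreBound T D + 1) * (coreBound T D + 13)) *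
    ((coreBound T D + 1) * (coreBound T D + 13))

theorem one_le_dimBound (T D : ℕ) : 1 ≤ dimBound T D := by
  rw [dimBound, add_assoc]
  exact Nat.le_add_right _ _

theorem IsConfig.finrank_le [Fintype ι] {Q : ι → Poly n} (hQ : IsConfig Q)
    (hm : 2 ≤ Fintype.card ι) {T D : ℕ} {𝒬₀ : Submodule ℂ (Poly n)} (h1 : 𝒬₀ ≤ Lin n * Lin n)
    (h2 : Module.finrank ℂ 𝒬₀ ≤ D) (h3 : ∀ i, LowMod 𝒬₀ T (Q i)) :
    Module.finrank ℂ (Submodule.span ℂ (Set.range Q)) ≤ dimBound T D := by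
  obtain ⟨V, hV, 𝒬, h𝒬, hVr, h𝒬r, hreg, hcase⟩ := hQ.exists_core hm h1 h2 h3
  have := finiteDimensional_of_le hV
  have := finiteDimensional_of_le_quad h𝒬
  have hsplit : ∀ i, ∃ q ∈ 𝒬, ∃ p, Q i = q + p ∧ (p ∈ V * Lin n ∨
      ∃ y ∈ Lin n, p ∈ (V ⊔ Submodule.span ℂ {y}) * (V ⊔ Submodule.span ℂ {y})) := fun i => by
    rcases hcase i with h | ⟨y, hy, h⟩
    · obtain ⟨q, hq, p, hp, e⟩ := Submodule.mem_sup.1 h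
      exact ⟨q, hq, p, e.symm, Or.inl hp⟩
    · obtain ⟨q, hq, p, hp, e⟩ := Submodule.mem_sup.1 h
      exact ⟨q, hq, p, e.symm, Or.inr ⟨y, hy, hp⟩⟩
  choose q hq p e hp using hsplit
  have hVy : ∀ {y : Poly n}, y ∈ Lin n → V ⊔ Submodule.span ℂ {y} ≤ Lin n := fun hy =>
    sup_le hV (by rwa [Submodule.span_singleton_le_iff_mem])
  have hs : Splitting V 𝒬 (Module.finrank ℂ V + 1) Q q p :=
    { le := hV
      regular := fun q hq hl => hreg q hq (hl.mono (by rw [regBound]; omega))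
      mem := hq
      eq_add := e
      quad := fun i => by
        rw [quad_iff]
        rcases hp i with h | ⟨y, hy, h⟩
        exacts [mul_mem_mono hV le_rfl h, mul_mem_mono (hVy hy) (hVy hy) h]
      low := fun i => by
        rcases hp i with h | ⟨y, hy, h⟩
        exacts [⟨V, hV, Nat.le_succ _, h⟩,
          LowRank.of_mem (hVy hy) (finrank_sup_span_singleton_le V y) h]
      form := hp }
  obtain ⟨Λ, hΛ, hΛr, hpΛ⟩ := hs.exists_mem_mul_self hQ
  have := finiteDimensional_of_le hΛ
  have : FiniteDimensional ℂ ↥(Λ * Λ) :=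
    finiteDimensional_of_le_quad fun _ h => mul_mem_mono hΛ hΛ h
  have hle : Submodule.span ℂ (Set.range Q) ≤ 𝒬 ⊔ Λ * Λ := by
    rw [Submodule.span_le]
    rintro _ ⟨i, rfl⟩
    rw [e i]
    exact Submodule.add_mem_sup (hq i) (hpΛ i)
  have hΛr' : Module.finrank ℂ Λ ≤
      (coreBound T D + 1) * (coreBound T D + 13) :=
    hΛr.trans (Nat.mul_le_mul (Nat.add_le_add_right hVr _) (Nat.add_le_add_right hVr _))
  refine (Submodule.finrank_mono hle).trans
    ((Submodule.finrank_add_le_finrank_add_finrank _ _).trans ?_)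
  rw [dimBound]
  exact Nat.add_le_add (h𝒬r.trans (Nat.le_add_left _ _))
    ((finrank_mul_self_le Λ).trans (Nat.mul_le_mul hΛr' hΛr'))

end QuadSG

/-- **Sylvester–Gallai theorem for quadratic polynomials.**
There is an absolute constant `C` such that: if `Q 1, …, Q m` are pairwise linearly
independent homogeneous quadratic polynomials in `ℂ[x_1, …, x_n]`, each irreducible or a
square of a linear form, and for every `i ≠ j` there is `k ∉ {i, j}` such that `Q k`
vanishes on the common zero set of `Q i` and `Q j`, then the linear span of the `Q i`'s
has dimension at most `C`. -/
theorem stmt_0 :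
    ∃ C : ℕ, ∀ (n m : ℕ) (Q : Fin m → MvPolynomial (Fin n) ℂ),
      (∀ i, (Q i).IsHomogeneous 2) →
      (∀ i, Irreducible (Q i) ∨
        ∃ ℓ : MvPolynomial (Fin n) ℂ, ℓ.IsHomogeneous 1 ∧ Q i = ℓ ^ 2) →
      (∀ i j, i ≠ j → LinearIndependent ℂ ![Q i, Q j]) →
      (∀ i j, i ≠ j → ∃ k, k ≠ i ∧ k ≠ j ∧
        ∀ a : Fin n → ℂ, eval a (Q i) = 0 → eval a (Q j) = 0 → eval a (Q k) = 0) →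
      Module.finrank ℂ ↥(Submodule.span ℂ (Set.range Q)) ≤ C := by
  refine ⟨QuadSG.dimBound (2 ^ 41) 1653, fun n m Q h1 h2 h3 h4 => ?_⟩
  rcases lt_or_ge m 2 with hm | hm
  · refine (finrank_range_le_card Q).trans (le_trans ?_ (QuadSG.one_le_dimBound _ _))
    rw [Fintype.card_fin]
    omega
  · have hQ : QuadSG.IsConfig Q := ⟨h1, h2, h3, h4⟩
    obtain ⟨𝒬₀, h5, h6, h7⟩ := hQ.exists_lowMod
    exact hQ.finrank_le (by rwa [Fintype.card_fin]) h5 h6 h7
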